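/- For every ε > 0 there exists a homotopically non-trivial C¹ map from S^5 to S^4 with 4-dilation less than ε. (The class of such a map is the non-trivial element of π_5(S^4) ≅ ℤ/2, the double suspension of the Hopf fibration.) -/

import Mathlib

/-!
Basic notions: the unit sphere `S^{d-1} ⊆ ℝ^d`, the norm `‖Λ^k A‖` of the induced map on
`k`-th exterior powers of a linear map between inner product spaces, and the `k`-dilation of a
`C¹` map between unit spheres.  A (`C¹`) map from `S^{d₁-1}` to `S^{d₂-1}` is represented by a
(`C¹`) ambient map `F : ℝ^{d₁} → ℝ^{d₂}` mapping the unit sphere into the unit sphere; its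
`k`-dilation only depends on the restriction of `F` to the sphere, since the derivative is
restricted to the tangent space of the sphere.
-/

open scoped RealInnerProductSpace
open Set

noncomputable section

abbrev EucA (d : ℕ) := EuclideanSpace ℝ (Fin d)

/-- The unit sphere `S^{d-1}` in `ℝ^d` (with the round metric induced from `ℝ^d`). -/
def usph (d : ℕ) : Set (EucA d) := Metric.sphere 0 1

/-- The operator norm `‖Λ^k A‖` of the induced map on `k`-th exterior powers (with their induced
inner products): the supremum, over orthonormal `k`-frames `v` of the domain, of the `k`-volume
`√ det (⟪A vᵢ, A vⱼ⟫)` of the image frame `A v₁, …, A v_k`. -/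
noncomputable def lamNorm {E F : Type*} [NormedAddCommGroup E] [InnerProductSpace ℝ E]
    [NormedAddCommGroup F] [InnerProductSpace ℝ F] (k : ℕ) (A : E →ₗ[ℝ] F) : ℝ :=
  ⨆ v : {v : Fin k → E // Orthonormal ℝ v},
    Real.sqrt (Matrix.of fun (i j : Fin k) => ⟪A (v.1 i), A (v.1 j)⟫).det

/-- The `k`-dilation of a map of the unit sphere `S^{d-1}` into an inner product space (e.g. into
`ℝ^{d₂}`, for a map to the sphere `S^{d₂-1}`), the map being given by an ambient map `F`: the
supremum over points `x` of the sphere of `‖Λ^k df_x‖`, where `df_x` is the derivative of `F` at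
`x` restricted to the tangent space `(ℝ∙x)ᗮ` of the sphere at `x`. -/
noncomputable def kDilation {d : ℕ} {F' : Type*} [NormedAddCommGroup F']
    [InnerProductSpace ℝ F'] (k : ℕ) (F : EucA d → F') : ℝ :=
  ⨆ x : usph d,
    lamNorm k ((fderiv ℝ F (x : EucA d)).toLinearMap ∘ₗ ((ℝ ∙ (x : EucA d))ᗮ).subtype)

/-- A free homotopy, through maps of the unit sphere `S^{d-1}` into `T`, between (the
restrictions to the sphere of) `f` and `g`: a map `H` on `[0,1] × S^{d-1}`, continuous there,
with values in `T`, starting at `f` and ending at `g`. -/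
def FreelyHomotopic {d : ℕ} {E : Type*} [NormedAddCommGroup E] (T : Set E)
    (f g : EucA d → E) : Prop :=
  ∃ H : ℝ → EucA d → E,
    ContinuousOn (fun q : ℝ × EucA d => H q.1 q.2) (Icc (0:ℝ) 1 ×ˢ usph d) ∧
    (∀ t ∈ Icc (0:ℝ) 1, MapsTo (H t) (usph d) T) ∧
    EqOn (H 0) f (usph d) ∧ EqOn (H 1) g (usph d)

/-- A based homotopy (rel the basepoint `x₀` of the sphere, with basepoint value `y₀`), through
maps of the unit sphere `S^{d-1}` into `T`, between `f` and `g`. -/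
def BasedHomotopic {d : ℕ} {E : Type*} [NormedAddCommGroup E] (T : Set E)
    (x₀ : EucA d) (y₀ : E) (f g : EucA d → E) : Prop :=
  ∃ H : ℝ → EucA d → E,
    ContinuousOn (fun q : ℝ × EucA d => H q.1 q.2) (Icc (0:ℝ) 1 ×ˢ usph d) ∧
    (∀ t ∈ Icc (0:ℝ) 1, MapsTo (H t) (usph d) T) ∧
    (∀ t ∈ Icc (0:ℝ) 1, H t x₀ = y₀) ∧
    EqOn (H 0) f (usph d) ∧ EqOn (H 1) g (usph d)

/-- A sphere-valued map is nullhomotopic if it is freely homotopic, through sphere maps, to a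
constant map; a map is homotopically non-trivial if it is not nullhomotopic. -/
def SphereNullhomotopic {d₁ d₂ : ℕ} (F : EucA d₁ → EucA d₂) : Prop :=
  ∃ y ∈ usph d₂, FreelyHomotopic (usph d₂) F (fun _ => y)

/-! ### A mod 2 cup product calculus on the integer grid -/

section Grid

variable {ι : Type*} [DecidableEq ι]

/-- The move by `s i` in the `i`-th coordinate direction. -/
def gridStep (s : ι → ℤ) (i : ι) (x : ι → ℤ) : ι → ℤ := Function.update x i (x i + s i)

/-- The coefficient along the coordinates `S`, at the vertex `x` and in the directions `s`, of the
cup product of the coboundaries of a list of mod 2 functions. -/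
def cupD (s : ι → ℤ) : List ((ι → ℤ) → ZMod 2) → Finset ι → (ι → ℤ) → ZMod 2
  | [], S, _ => if S = ∅ then 1 else 0
  | χ :: l, S, x => ∑ i ∈ S, (χ (gridStep s i x) + χ x) * cupD s l (S.erase i) (gridStep s i x)

theorem gridStep_comm (s : ι → ℤ) (i j : ι) (x : ι → ℤ) :
    gridStep s i (gridStep s j x) = gridStep s j (gridStep s i x) := by
  by_cases h : i = j
  · subst h; rfl
  · have h' : j ≠ i := fun e => h e.symm
    simp only [gridStep, Function.update_of_ne h, Function.update_of_ne h']
    exact Function.update_comm h' _ _ _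

theorem sum_offDiag_eq_zero (S : Finset ι) (f : ι → ι → ZMod 2) (hf : ∀ i j, f i j = f j i) :
    ∑ i ∈ S, ∑ j ∈ S.erase i, f i j = 0 := by
  rw [Finset.sum_sigma']
  refine Finset.sum_involution (fun p _ => ⟨p.2, p.1⟩) ?_ ?_ ?_ ?_
  · rintro ⟨i, j⟩ _
    change f i j + f j i = 0
    rw [hf i j]; exact CharTwo.add_self_eq_zero _
  · rintro ⟨i, j⟩ h _ e
    simp only [Finset.mem_sigma, Finset.mem_erase] at h
    simp only [Sigma.mk.injEq] at e
    exact h.2.1 e.1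
  · rintro ⟨i, j⟩ h
    simp only [Finset.mem_sigma, Finset.mem_erase] at h ⊢
    exact ⟨h.2.2, fun e => h.2.1 e.symm, h.1⟩
  · rintro ⟨i, j⟩ _; rfl

theorem sum_offDiag_comm (S : Finset ι) (f : ι → ι → ZMod 2) :
    ∑ i ∈ S, ∑ j ∈ S.erase i, f i j = ∑ i ∈ S, ∑ j ∈ S.erase i, f j i := by
  rw [Finset.sum_sigma', Finset.sum_sigma']
  refine Finset.sum_nbij' (fun p => ⟨p.2, p.1⟩) (fun p => ⟨p.2, p.1⟩) ?_ ?_ ?_ ?_ ?_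
  · rintro ⟨i, j⟩ h
    simp only [Finset.mem_sigma, Finset.mem_erase] at h ⊢
    exact ⟨h.2.2, fun e => h.2.1 e.symm, h.1⟩
  · rintro ⟨i, j⟩ h
    simp only [Finset.mem_sigma, Finset.mem_erase] at h ⊢
    exact ⟨h.2.2, fun e => h.2.1 e.symm, h.1⟩
  all_goals rintro ⟨i, j⟩ _; rfl

/-- The cup product of coboundaries is closed. -/
theorem cupD_closed (s : ι → ℤ) (l : List ((ι → ℤ) → ZMod 2)) :
    ∀ (S : Finset ι) (x : ι → ℤ),
      ∑ i ∈ S, (cupD s l (S.erase i) (gridStep s i x) + cupD s l (S.erase i) x) = 0 := by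
  induction l with
  | nil =>
    intro S x
    refine Finset.sum_eq_zero fun i _ => ?_
    simp only [cupD]; exact CharTwo.add_self_eq_zero _
  | cons χ l ih =>
    intro S x
    have ih' : ∀ (S : Finset ι) (x : ι → ℤ), ∑ i ∈ S, cupD s l (S.erase i) (gridStep s i x)
        = ∑ i ∈ S, cupD s l (S.erase i) x := by
      intro S x
      have := ih S x
      rw [Finset.sum_add_distrib] at this
      exact CharTwo.add_eq_zero.mp this
    have e1 : ∑ i ∈ S, cupD s (χ :: l) (S.erase i) (gridStep s i x)
        = ∑ i ∈ S, ∑ k ∈ S.erase i, (χ (gridStep s i (gridStep s k x)) * cupD s l ((S.erase i).erase k) (gridStep s i (gridStep s k x)))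
        + ∑ i ∈ S, χ (gridStep s i x) * ∑ k ∈ S.erase i, cupD s l ((S.erase i).erase k) (gridStep s k (gridStep s i x)) := by
      rw [← Finset.sum_add_distrib]
      refine Finset.sum_congr rfl fun i _ => ?_
      simp only [cupD]
      rw [Finset.mul_sum, ← Finset.sum_add_distrib]
      refine Finset.sum_congr rfl fun k _ => ?_
      rw [gridStep_comm s k i]; ring
    have e2 : ∑ i ∈ S, cupD s (χ :: l) (S.erase i) x
        = ∑ i ∈ S, χ (gridStep s i x) * ∑ k ∈ S.erase i, cupD s l ((S.erase i).erase k) (gridStep s i x)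
        + χ x * ∑ i ∈ S, ∑ k ∈ S.erase i, cupD s l ((S.erase i).erase k) (gridStep s k x) := by
      have : ∑ i ∈ S, χ (gridStep s i x) * ∑ k ∈ S.erase i, cupD s l ((S.erase i).erase k) (gridStep s i x)
          = ∑ i ∈ S, ∑ k ∈ S.erase i, χ (gridStep s k x) * cupD s l ((S.erase i).erase k) (gridStep s k x) := by
        simp only [Finset.mul_sum]
        rw [sum_offDiag_comm]
        refine Finset.sum_congr rfl fun i _ => Finset.sum_congr rfl fun k _ => ?_
        rw [Finset.erase_right_comm]
      rw [this, Finset.mul_sum, ← Finset.sum_add_distrib]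
      refine Finset.sum_congr rfl fun i _ => ?_
      simp only [cupD]
      rw [Finset.mul_sum, ← Finset.sum_add_distrib]
      refine Finset.sum_congr rfl fun k _ => ?_
      ring
    rw [Finset.sum_add_distrib, e1, e2]
    have z1 : ∑ i ∈ S, ∑ k ∈ S.erase i,
        (χ (gridStep s i (gridStep s k x)) * cupD s l ((S.erase i).erase k) (gridStep s i (gridStep s k x))) = 0 := by
      refine sum_offDiag_eq_zero S _ fun i k => ?_
      rw [gridStep_comm s i k, Finset.erase_right_comm]
    have z2 : ∑ i ∈ S, ∑ k ∈ S.erase i, cupD s l ((S.erase i).erase k) (gridStep s k x) = 0 := by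
      simp only [ih']
      refine sum_offDiag_eq_zero S _ fun i k => ?_
      rw [Finset.erase_right_comm]
    rw [z1, z2, zero_add, mul_zero, add_zero]
    simp only [ih']
    exact CharTwo.add_self_eq_zero _

theorem cupD_cons (s : ι → ℤ) (χ : (ι → ℤ) → ZMod 2) (l : List ((ι → ℤ) → ZMod 2))
    (S : Finset ι) (x : ι → ℤ) :
    cupD s (χ :: l) S x = ∑ i ∈ S, (χ (gridStep s i x) * cupD s l (S.erase i) (gridStep s i x)
      + χ x * cupD s l (S.erase i) x) := by
  have h := cupD_closed s l S x
  rw [Finset.sum_add_distrib] at h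
  have h := CharTwo.add_eq_zero.mp h
  simp only [cupD, add_mul]
  rw [Finset.sum_add_distrib, Finset.sum_add_distrib, ← Finset.mul_sum, ← Finset.mul_sum, h]

theorem cupD_update (s : ι → ℤ) (j : ι) (a : ℤ) (l : List ((ι → ℤ) → ZMod 2)) :
    ∀ (S : Finset ι) (x : ι → ℤ), j ∉ S → cupD (Function.update s j a) l S x = cupD s l S x := by
  induction l with
  | nil => intro S x _; rfl
  | cons χ l ih =>
    intro S x hj
    refine Finset.sum_congr rfl fun i hi => ?_
    have hij : i ≠ j := fun e => hj (e ▸ hi)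
    have : gridStep (Function.update s j a) i x = gridStep s i x := by
      simp [gridStep, Function.update_of_ne hij]
    rw [this, ih _ _ (fun h => hj (Finset.mem_of_mem_erase h))]

/-- Changing the functions by constants does not change the cup product of the coboundaries. -/
theorem cupD_congr {s s' : ι → ℤ} {P : (ι → ℤ) → Prop} {ρ : (ι → ℤ) → (ι → ℤ)}
    {l l' : List ((ι → ℤ) → ZMod 2)}
    (h : List.Forall₂ (fun χ χ' => ∃ a, ∀ y, P y → χ' (ρ y) = χ y + a) l l') :
    ∀ (S : Finset ι) (x : ι → ℤ), P x → (∀ y, P y → ∀ i ∈ S, P (gridStep s i y)) →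
      (∀ y, P y → ∀ i ∈ S, ρ (gridStep s i y) = gridStep s' i (ρ y)) →
      cupD s' l' S (ρ x) = cupD s l S x := by
  induction h with
  | nil => intro S x _ _ _; rfl
  | cons h _ ih =>
    intro S x hx hP hρ
    obtain ⟨a, ha⟩ := h
    refine Finset.sum_congr rfl fun i hi => ?_
    rw [← hρ x hx i hi, ha _ hx, ha _ (hP x hx i hi),
      ih (S.erase i) _ (hP x hx i hi) (fun y hy j hj => hP y hy j (Finset.mem_of_mem_erase hj))
        (fun y hy j hj => hρ y hy j (Finset.mem_of_mem_erase hj))]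
    congr 1
    rw [add_add_add_comm, CharTwo.add_self_eq_zero, add_zero]

theorem cupD_eq_zero_of_indep {s : ι → ℤ} {j : ι} {l : List ((ι → ℤ) → ZMod 2)}
    (h : ∀ χ ∈ l, ∀ y, χ (gridStep s j y) = χ y) :
    ∀ (S : Finset ι) (x : ι → ℤ), j ∈ S → cupD s l S x = 0 := by
  induction l with
  | nil =>
    intro S x hj
    simp only [cupD]
    rw [if_neg (Finset.ne_empty_of_mem hj)]
  | cons χ l ih =>
    intro S x hj
    refine Finset.sum_eq_zero fun i _ => ?_
    by_cases hij : i = j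
    · rw [hij, h χ (by simp), CharTwo.add_self_eq_zero, zero_mul]
    · rw [ih (fun χ' h' => h χ' (by simp [h'])) _ _ (Finset.mem_erase.2 ⟨fun e => hij e.symm, hj⟩),
        mul_zero]

theorem exists_ne_of_cupD_ne_zero {s : ι → ℤ} {l : List ((ι → ℤ) → ZMod 2)} :
    ∀ {S : Finset ι} {x : ι → ℤ}, cupD s l S x ≠ 0 → ∀ χ ∈ l, ∃ y y' : ι → ℤ,
      (∀ k, y k = x k ∨ (k ∈ S ∧ y k = x k + s k)) ∧
      (∀ k, y' k = x k ∨ (k ∈ S ∧ y' k = x k + s k)) ∧ χ y ≠ χ y' := by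
  induction l with
  | nil => intro S x _ χ h; simp at h
  | cons χ₀ l ih =>
    intro S x h χ hχ
    obtain ⟨i, hi, hne⟩ := Finset.exists_ne_zero_of_sum_ne_zero h
    have hw := right_ne_zero_of_mul hne
    have hi' : gridStep s i x i = x i + s i := by simp [gridStep]
    have hk : ∀ k, k ≠ i → gridStep s i x k = x k := fun k hk => by
      simp [gridStep, Function.update_of_ne hk]
    rcases List.mem_cons.1 hχ with rfl | hχ
    · refine ⟨gridStep s i x, x, fun k => ?_, fun k => Or.inl rfl,
        fun e => left_ne_zero_of_mul hne ?_⟩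
      · by_cases h : k = i
        · subst h; exact Or.inr ⟨hi, hi'⟩
        · exact Or.inl (hk k h)
      · rw [e]; exact CharTwo.add_self_eq_zero _
    · have tr : ∀ y : ι → ℤ, (∀ k, y k = gridStep s i x k ∨
          (k ∈ S.erase i ∧ y k = gridStep s i x k + s k)) →
          ∀ k, y k = x k ∨ (k ∈ S ∧ y k = x k + s k) := by
        intro y hy k
        by_cases h : k = i
        · subst h
          rcases hy k with h | h
          · exact Or.inr ⟨hi, h.trans hi'⟩
          · simp at h
        · have := hy k
          rw [hk k h] at this
          exact this.imp id fun h => ⟨Finset.mem_of_mem_erase h.1, h.2⟩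
      obtain ⟨y, y', h1, h2, h3⟩ := ih hw χ hχ
      exact ⟨y, y', tr y h1, tr y' h2, h3⟩

end Grid

section CellReflect

variable {ι : Type*} [DecidableEq ι]

theorem comp_update_fun (g : ℤ → ℤ) (k : ι → ℤ) (i : ι) (j : ℤ) :
    g ∘ Function.update k i j = Function.update (g ∘ k) i (g j) := by
  ext a
  by_cases h : a = i
  · subst h; simp
  · simp [Function.update_of_ne h]

/-- The reflection of the box `[0, 2m]^J` in its centre. -/
def boxReflect (m : ℕ) (J : Finset ι) (x : ι → ℤ) : ι → ℤ :=
  fun i => if i ∈ J then 2 * m - x i else x i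

theorem boxReflect_boxReflect (m : ℕ) (J : Finset ι) (x : ι → ℤ) :
    boxReflect m J (boxReflect m J x) = x := by
  ext i; unfold boxReflect; split_ifs <;> ring

end CellReflect

section CellSum

variable {ι : Type*} [Fintype ι] [DecidableEq ι]

/-- The even endpoint of the interval `[k, k + 1]`. -/
def evenEnd (k : ℤ) : ℤ := if Even k then k else k + 1

/-- The direction from the even endpoint of `[k, k + 1]` to the odd one. -/
def evenDir (k : ℤ) : ℤ := if Even k then 1 else -1

/-- The cells of the box `[0, 2m]^S`, placed at height `c` in the other coordinates. -/
def boxCells (m : ℕ) (S : Finset ι) (c : ι → ℤ) : Finset (ι → ℤ) :=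
  Fintype.piFinset fun i => if i ∈ S then Finset.Ico 0 (2 * (m : ℤ)) else {c i}

/-- Sum over all the cells of a box. -/
def cellSum (m : ℕ) (F : (ι → ℤ) → (ι → ℤ) → ZMod 2) (S : Finset ι) (c : ι → ℤ) : ZMod 2 :=
  ∑ k ∈ boxCells m S c, F (evenDir ∘ k) (evenEnd ∘ k)

theorem mem_boxCells {m : ℕ} {S : Finset ι} {c k : ι → ℤ} :
    k ∈ boxCells m S c ↔ (∀ i ∈ S, 0 ≤ k i ∧ k i < 2 * (m : ℤ)) ∧ ∀ i ∉ S, k i = c i := by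
  simp only [boxCells, Fintype.mem_piFinset]
  constructor
  · intro h
    refine ⟨fun i hi => ?_, fun i hi => ?_⟩
    · have := h i; rw [if_pos hi, Finset.mem_Ico] at this; exact this
    · have := h i; rw [if_neg hi, Finset.mem_singleton] at this; exact this
  · rintro ⟨h1, h2⟩ i
    by_cases hi : i ∈ S
    · rw [if_pos hi, Finset.mem_Ico]; exact h1 i hi
    · rw [if_neg hi, Finset.mem_singleton]; exact h2 i hi

theorem evenEnd_of_even {k : ℤ} (h : Even k) : evenEnd k = k := if_pos h

theorem evenDir_eq (k : ℤ) : evenDir k = 1 ∨ evenDir k = -1 := by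
  unfold evenDir; split_ifs <;> simp

theorem evenEnd_mem {m : ℕ} {k : ℤ} (h : 0 ≤ k ∧ k < 2 * (m : ℤ)) :
    0 ≤ evenEnd k ∧ evenEnd k ≤ 2 * (m : ℤ) := by
  unfold evenEnd; split_ifs <;> constructor <;> linarith [h.1, h.2]

/-- Telescoping along an interval. -/
theorem sum_Ico_telescope (G : ℤ → ZMod 2) (n : ℕ) :
    ∑ j ∈ Finset.Ico (0 : ℤ) n, (G (evenEnd j + evenDir j) + G (evenEnd j)) = G n + G 0 := by
  have h : ∀ j, G (evenEnd j + evenDir j) + G (evenEnd j) = G (j + 1) + G j := by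
    intro j
    unfold evenEnd evenDir
    split_ifs
    · rfl
    · rw [add_neg_cancel_right, add_comm]
  simp only [h]
  induction n with
  | zero => simp [CharTwo.add_self_eq_zero]
  | succ n ih =>
    have : Finset.Ico (0 : ℤ) ((n + 1 : ℕ) : ℤ) = insert (n : ℤ) (Finset.Ico (0 : ℤ) n) := by
      ext a; simp only [Finset.mem_Ico, Finset.mem_insert]; push_cast; omega
    rw [this, Finset.sum_insert (by simp), ih]
    push_cast
    rw [← add_assoc, add_assoc (G (n + 1)), CharTwo.add_self_eq_zero, add_zero]

theorem sum_boxCells_slice (m : ℕ) {S : Finset ι} {i : ι} (hi : i ∈ S) (c : ι → ℤ)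
    (f : (ι → ℤ) → ZMod 2) :
    ∑ k ∈ boxCells m S c, f k = ∑ k ∈ boxCells m (S.erase i) (Function.update c i 0),
      ∑ j ∈ Finset.Ico (0 : ℤ) (2 * m : ℕ), f (Function.update k i j) := by
  rw [Finset.sum_sigma']
  refine Finset.sum_bij' (fun k _ => ⟨Function.update k i 0, k i⟩)
    (fun p _ => Function.update p.1 i p.2) ?_ ?_ ?_ ?_ ?_
  · intro k hk
    rw [mem_boxCells] at hk
    rw [Finset.mem_sigma, mem_boxCells, Finset.mem_Ico]
    refine ⟨⟨fun j hj => ?_, fun j hj => ?_⟩, ?_⟩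
    · rw [Finset.mem_erase] at hj
      simp only [Function.update_of_ne hj.1]
      exact hk.1 j hj.2
    · by_cases h : j = i
      · subst h; simp
      · simp only [Function.update_of_ne h]
        exact hk.2 j fun h' => hj (Finset.mem_erase.2 ⟨h, h'⟩)
    · have := hk.1 i hi
      push_cast; exact this
  · rintro ⟨k, j⟩ hk
    rw [Finset.mem_sigma, mem_boxCells, Finset.mem_Ico] at hk
    rw [mem_boxCells]
    obtain ⟨⟨h1, h2⟩, h3⟩ := hk
    refine ⟨fun a ha => ?_, fun a ha => ?_⟩
    · by_cases h : a = i
      · subst h; simp; push_cast at h3; exact h3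
      · simp only [Function.update_of_ne h]
        exact h1 a (Finset.mem_erase.2 ⟨h, ha⟩)
    · have h : a ≠ i := fun e => ha (e ▸ hi)
      have := h2 a fun h' => ha (Finset.mem_of_mem_erase h')
      simpa only [Function.update_of_ne h] using this
  · intro k _; simp
  · rintro ⟨k, j⟩ hk
    rw [Finset.mem_sigma, mem_boxCells] at hk
    have : k i = 0 := by have := hk.1.2 i (by simp); simpa using this
    simp only [Function.update_idem, Function.update_self]
    rw [← this, Function.update_eq_self]
  · intro k _; simp

theorem cellSum_face (m : ℕ) {F : (ι → ℤ) → (ι → ℤ) → ZMod 2} {S : Finset ι} {i : ι}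
    (hi : i ∉ S) (hF : ∀ s a x, F (Function.update s i a) x = F s x) (c : ι → ℤ) {a : ℤ}
    (ha : Even a) :
    cellSum m F S (Function.update c i a) = ∑ k ∈ boxCells m S (Function.update c i 0),
      F (evenDir ∘ k) (Function.update (evenEnd ∘ k) i a) := by
  refine Finset.sum_bij' (fun k _ => Function.update k i 0) (fun k _ => Function.update k i a)
    ?_ ?_ ?_ ?_ ?_
  · intro k hk
    rw [mem_boxCells] at hk ⊢
    refine ⟨fun j hj => ?_, fun j hj => ?_⟩
    · have h : j ≠ i := fun e => hi (e ▸ hj)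
      simp only [Function.update_of_ne h]; exact hk.1 j hj
    · by_cases h : j = i
      · subst h; simp
      · have := hk.2 j hj; simpa only [Function.update_of_ne h] using this
  · intro k hk
    rw [mem_boxCells] at hk ⊢
    refine ⟨fun j hj => ?_, fun j hj => ?_⟩
    · have h : j ≠ i := fun e => hi (e ▸ hj)
      simp only [Function.update_of_ne h]; exact hk.1 j hj
    · by_cases h : j = i
      · subst h; simp
      · have := hk.2 j hj; simpa only [Function.update_of_ne h] using this
  · intro k hk
    rw [mem_boxCells] at hk
    have := hk.2 i hi
    simp only [Function.update_self] at this
    simp only [Function.update_idem]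
    rw [← this, Function.update_eq_self]
  · intro k hk
    rw [mem_boxCells] at hk
    have := hk.2 i hi
    simp only [Function.update_self] at this
    simp only [Function.update_idem]
    rw [← this, Function.update_eq_self]
  · intro k hk
    rw [mem_boxCells] at hk
    have := hk.2 i hi
    simp only [Function.update_self] at this
    rw [comp_update_fun, comp_update_fun, hF, Function.update_idem]
    congr 1
    rw [← evenEnd_of_even ha, ← this, ← Function.comp_apply (f := evenEnd), Function.update_eq_self]

/-- Telescoping along one direction of a box. -/
theorem cellSum_telescope (m : ℕ) {F : (ι → ℤ) → (ι → ℤ) → ZMod 2} {S : Finset ι} {i : ι}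
    (hi : i ∈ S) (hF : ∀ s a x, F (Function.update s i a) x = F s x) (c : ι → ℤ) :
    cellSum m (fun s x => F s (gridStep s i x) + F s x) S c
      = cellSum m F (S.erase i) (Function.update c i (2 * m))
        + cellSum m F (S.erase i) (Function.update c i 0) := by
  rw [cellSum_face m (Finset.notMem_erase i S) hF c (even_two_mul _),
    cellSum_face m (Finset.notMem_erase i S) hF c Even.zero, cellSum, sum_boxCells_slice m hi,
    ← Finset.sum_add_distrib]
  refine Finset.sum_congr rfl fun k _ => ?_
  have e := sum_Ico_telescope (fun a => F (evenDir ∘ k) (Function.update (evenEnd ∘ k) i a)) (2 * m)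
  rw [Nat.cast_mul, Nat.cast_ofNat] at e ⊢
  rw [← e]
  refine Finset.sum_congr rfl fun j _ => ?_
  simp only [comp_update_fun, hF, gridStep, Function.update_self, Function.update_idem]

theorem cellSum_sum (m : ℕ) {κ : Type*} (T : Finset κ) (F : κ → (ι → ℤ) → (ι → ℤ) → ZMod 2)
    (S : Finset ι) (c : ι → ℤ) :
    cellSum m (fun s x => ∑ j ∈ T, F j s x) S c = ∑ j ∈ T, cellSum m (F j) S c := by
  unfold cellSum; rw [Finset.sum_comm]

/-- Stokes' formula for closed mod 2 cochains on a box. -/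
theorem sum_faces_eq_zero (m : ℕ) {F : ι → (ι → ℤ) → (ι → ℤ) → ZMod 2} {S : Finset ι}
    (hF : ∀ i ∈ S, ∀ s a x, F i (Function.update s i a) x = F i s x)
    (hc : ∀ s x, ∑ i ∈ S, (F i s (gridStep s i x) + F i s x) = 0) (c : ι → ℤ) :
    ∑ i ∈ S, (cellSum m (F i) (S.erase i) (Function.update c i (2 * m))
        + cellSum m (F i) (S.erase i) (Function.update c i 0)) = 0 := by
  calc _ = ∑ i ∈ S, cellSum m (fun s x => F i s (gridStep s i x) + F i s x) S c :=
        Finset.sum_congr rfl fun i hi => (cellSum_telescope m hi (hF i hi) c).symm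
    _ = cellSum m (fun s x => ∑ i ∈ S, (F i s (gridStep s i x) + F i s x)) S c :=
        (cellSum_sum m S _ S c).symm
    _ = 0 := by simp only [cellSum, hc, Finset.sum_const_zero]

/-- The total over a box of the cup product of the coboundaries of a list of functions. -/
def cupSum (m : ℕ) (l : List ((ι → ℤ) → ZMod 2)) (S : Finset ι) (c : ι → ℤ) : ZMod 2 :=
  cellSum m (fun s x => cupD s l S x) S c

theorem cupSum_faces_eq_zero (m : ℕ) (l : List ((ι → ℤ) → ZMod 2)) (S : Finset ι) (c : ι → ℤ) :
    ∑ i ∈ S, (cupSum m l (S.erase i) (Function.update c i (2 * m))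
        + cupSum m l (S.erase i) (Function.update c i 0)) = 0 :=
  sum_faces_eq_zero m (F := fun i s x => cupD s l (S.erase i) x)
    (fun i _ s a x => cupD_update s i a l _ x (Finset.notMem_erase i S))
    (fun s x => cupD_closed s l S x) c

theorem cupSum_cons (m : ℕ) (χ : (ι → ℤ) → ZMod 2) (l : List ((ι → ℤ) → ZMod 2))
    (S : Finset ι) (c : ι → ℤ) :
    cupSum m (χ :: l) S c = ∑ i ∈ S,
      (cellSum m (fun s x => χ x * cupD s l (S.erase i) x) (S.erase i) (Function.update c i (2 * m))
      + cellSum m (fun s x => χ x * cupD s l (S.erase i) x) (S.erase i)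
          (Function.update c i 0)) := by
  rw [cupSum]
  simp only [cupD_cons]
  rw [cellSum_sum]
  refine Finset.sum_congr rfl fun i hi => ?_
  refine cellSum_telescope m (F := fun s x => χ x * cupD s l (S.erase i) x) hi ?_ c
  intro s a x
  simp only [cupD_update s i a l _ x (Finset.notMem_erase i S)]

theorem cellSum_eq_zero {m : ℕ} {F : (ι → ℤ) → (ι → ℤ) → ZMod 2} {S : Finset ι} {c : ι → ℤ}
    (h : ∀ k ∈ boxCells m S c, F (evenDir ∘ k) (evenEnd ∘ k) = 0) : cellSum m F S c = 0 :=
  Finset.sum_eq_zero h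

/-- The cup product sum of functions of one coordinate each, all changing across the box. -/
theorem cupSum_eq_one {κ : Type*} (m : ℕ) (σ : κ → ι) (χ : κ → (ι → ℤ) → ZMod 2) (L : List κ)
    (hL : (L.map σ).Nodup) (hχ : ∀ k ∈ L, ∀ x y : ι → ℤ, x (σ k) = y (σ k) → χ k x = χ k y)
    (h : ∀ k ∈ L, ∀ x y : ι → ℤ, x (σ k) = 2 * m → y (σ k) = 0 → χ k x + χ k y = 1) :
    ∀ c : ι → ℤ, (∀ i, Even (c i)) → cupSum m (L.map χ) (L.map σ).toFinset c = 1 := by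
  induction L with
  | nil =>
    intro c _
    have : boxCells m (∅ : Finset ι) c = {c} := by
      ext k; rw [mem_boxCells]; simp [funext_iff]
    simp [cupSum, cellSum, this, cupD]
  | cons k L ih =>
    intro c hc
    rw [List.map_cons, List.nodup_cons] at hL
    have hk : (σ k) ∉ (L.map σ).toFinset := by simpa using hL.1
    have ih' := ih hL.2 (fun j hj => hχ j (by simp [hj])) (fun j hj => h j (by simp [hj]))
    rw [List.map_cons, List.map_cons, List.toFinset_cons, cupSum_cons, Finset.sum_insert hk,
      Finset.erase_insert hk, Finset.sum_eq_zero (s := (L.map σ).toFinset), add_zero]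
    · have e : ∀ a : ℤ, Even a → ∀ y : ι → ℤ, y (σ k) = a →
          cellSum m (fun s x => χ k x * cupD s (L.map χ) (L.map σ).toFinset x)
            (L.map σ).toFinset (Function.update c (σ k) a) = χ k y := by
        intro a ha y hy
        have : cellSum m (fun s x => χ k x * cupD s (L.map χ) (L.map σ).toFinset x)
            (L.map σ).toFinset (Function.update c (σ k) a)
            = χ k y * cupSum m (L.map χ) (L.map σ).toFinset (Function.update c (σ k) a) := by
          unfold cupSum cellSum
          rw [Finset.mul_sum]
          refine Finset.sum_congr rfl fun q hq => ?_
          rw [mem_boxCells] at hq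
          have := hq.2 _ hk
          dsimp only
          rw [hχ k (by simp) (evenEnd ∘ q) y]
          rw [Function.comp_apply, this, Function.update_self, hy, evenEnd_of_even ha]
        rw [this, ih', mul_one]
        intro i
        by_cases hi : i = σ k
        · subst hi; simpa using ha
        · simpa [Function.update_of_ne hi] using hc i
      rw [e (2 * m) (even_two_mul _) (fun _ => 2 * m) rfl, e 0 Even.zero (fun _ => 0) rfl]
      exact h k (by simp) _ _ rfl rfl
    · intro i hi
      have hik : σ k ≠ i := fun e => hk (e ▸ hi)
      have z : ∀ s x, cupD s (L.map χ) ((insert (σ k) (L.map σ).toFinset).erase i) x = 0 := by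
        intro s x
        refine cupD_eq_zero_of_indep (j := σ k) ?_ _ _ (by simp [hik])
        intro χ' hχ' y
        obtain ⟨j, hj, rfl⟩ := List.mem_map.1 hχ'
        refine hχ j (by simp [hj]) _ _ ?_
        rw [gridStep, Function.update_of_ne]
        rintro e
        exact hL.1 (e ▸ List.mem_map_of_mem hj)
      simp [cellSum, z]

theorem evenEnd_reflect (m : ℕ) (k : ℤ) : evenEnd (2 * m - 1 - k) = 2 * m - evenEnd k := by
  unfold evenEnd
  have : Even (2 * (m : ℤ) - 1 - k) ↔ ¬ Even k := by
    rw [Int.even_sub, Int.even_sub]; simp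
  by_cases h : Even k
  · rw [if_neg (by rw [this]; simpa using h), if_pos h]; ring
  · rw [if_pos (this.2 h), if_neg h]; ring

theorem evenDir_reflect (m : ℕ) (k : ℤ) : evenDir (2 * m - 1 - k) = - evenDir k := by
  unfold evenDir
  have : Even (2 * (m : ℤ) - 1 - k) ↔ ¬ Even k := by
    rw [Int.even_sub, Int.even_sub]; simp
  by_cases h : Even k
  · rw [if_neg (by rw [this]; simpa using h), if_pos h]
  · rw [if_pos (this.2 h), if_neg h]; ring

/-- Change of variables by a reflection. -/
theorem cellSum_reflect (m : ℕ) (J S : Finset ι) {c : ι → ℤ} (hc : ∀ i, Even (c i))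
    {F G : (ι → ℤ) → (ι → ℤ) → ZMod 2}
    (h : ∀ k ∈ boxCells m S c, ∀ s' : ι → ℤ,
      (∀ i ∈ S, s' i = if i ∈ J then - evenDir (k i) else evenDir (k i)) →
      G s' (boxReflect m J (evenEnd ∘ k)) = F (evenDir ∘ k) (evenEnd ∘ k)) :
    cellSum m G S (boxReflect m J c) = cellSum m F S c := by
  let T : (ι → ℤ) → ι → ℤ := fun k i =>
    if i ∈ J then (if i ∈ S then 2 * m - 1 - k i else 2 * m - k i) else k i
  have hT : ∀ k, T (T k) = k := by
    intro k; ext i; simp only [T]; split_ifs <;> ring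
  refine (Finset.sum_bij' (fun k _ => T k) (fun k _ => T k) ?_ ?_ ?_ ?_ ?_).symm
  · intro k hk
    rw [mem_boxCells] at hk ⊢
    refine ⟨fun i hi => ?_, fun i hi => ?_⟩
    · have := hk.1 i hi
      simp only [T, if_pos hi]; split_ifs <;> omega
    · have := hk.2 i hi
      simp only [T, if_neg hi, boxReflect, this]
  · intro k hk
    rw [mem_boxCells] at hk ⊢
    refine ⟨fun i hi => ?_, fun i hi => ?_⟩
    · have := hk.1 i hi
      simp only [T, if_pos hi]; split_ifs <;> omega
    · have := hk.2 i hi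
      simp only [T, if_neg hi, boxReflect] at this ⊢
      split_ifs at this ⊢ <;> omega
  · intro k _; exact hT k
  · intro k _; exact hT k
  · intro k hk
    rw [← h k hk (evenDir ∘ T k) ?_]
    · congr 1
      rw [mem_boxCells] at hk
      ext i
      simp only [boxReflect, Function.comp_apply, T]
      split_ifs with h1 h2
      · rw [evenEnd_reflect]
      · have e := hk.2 i h2
        have : Even (2 * (m : ℤ) - c i) := (even_two_mul _).sub (hc i)
        rw [e, evenEnd_of_even this, evenEnd_of_even (hc i)]
      · rfl
    · intro i hi
      simp only [Function.comp_apply, T, if_pos hi]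
      split_ifs
      · exact evenDir_reflect m _
      · rfl

end CellSum

/-- A mod 2 label recording the sign of a real number, arbitrary at zero. -/
def SignLabel (a : ZMod 2) (t : ℝ) : Prop := (a = 1 → 0 ≤ t) ∧ (a = 0 → t ≤ 0)

theorem signLabel_ite (t : ℝ) : SignLabel (if 0 < t then 1 else 0) t := by
  unfold SignLabel
  split_ifs with h
  · exact ⟨fun _ => h.le, fun e => absurd e one_ne_zero⟩
  · exact ⟨fun e => absurd e zero_ne_one, fun _ => not_lt.1 h⟩

section Mesh

variable {ι : Type*}

/-- The position of the grid vertices `[0, 2m]^ι` in the box with half sides `R`. -/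
def gridPos (R : ι → ℝ) (m : ℕ) (x : ι → ℤ) : ι → ℝ := fun i => R i * (x i / m - 1)

theorem abs_gridPos_le {R : ι → ℝ} (hR : ∀ i, 0 ≤ R i) {m : ℕ} (hm : 0 < m) {x : ι → ℤ} {i : ι}
    (h : 0 ≤ x i ∧ x i ≤ 2 * m) : |gridPos R m x i| ≤ R i := by
  have hm' : (0 : ℝ) < m := by exact_mod_cast hm
  have h0 : (0 : ℝ) ≤ x i := by exact_mod_cast h.1
  have h1 : (x i : ℝ) ≤ 2 * m := by exact_mod_cast h.2
  rw [gridPos, abs_mul, abs_of_nonneg (hR i)]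
  refine mul_le_of_le_one_right (hR i) (abs_le.2 ⟨?_, ?_⟩)
  · linarith [div_nonneg h0 hm'.le]
  · linarith [(div_le_iff₀ hm').2 h1]

theorem gridPos_zero {R : ι → ℝ} {m : ℕ} {x : ι → ℤ} {i : ι} (h : x i = 0) :
    gridPos R m x i = - R i := by simp [gridPos, h]

theorem gridPos_two_mul {R : ι → ℝ} {m : ℕ} (hm : 0 < m) {x : ι → ℤ} {i : ι}
    (h : x i = 2 * m) : gridPos R m x i = R i := by
  have hm' : (m : ℝ) ≠ 0 := by exact_mod_cast hm.ne'
  simp only [gridPos, h]; push_cast; field_simp; ring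

theorem isCompact_box (R : ι → ℝ) : IsCompact {p : ι → ℝ | ∀ i, |p i| ≤ R i} := by
  have : {p : ι → ℝ | ∀ i, |p i| ≤ R i} = Set.pi univ fun i => Icc (- R i) (R i) := by
    ext p; simp [abs_le, Pi.le_def, forall_and]
  rw [this]
  exact isCompact_univ_pi fun i => isCompact_Icc

variable [Fintype ι] [DecidableEq ι]

/-- On a fine grid, the cup product of the coboundaries of sign labels vanishes away from the
common zeros. -/
theorem cupD_eq_zero_of_no_zero {κ : Type*} (R : ι → ℝ) (L : List κ) (f : κ → (ι → ℝ) → ℝ)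
    (hf : ∀ k ∈ L, Continuous (f k)) {K : Set (ι → ℝ)} (hK : IsCompact K)
    (h : ∀ p ∈ K, ∃ k ∈ L, f k p ≠ 0) :
    ∃ m₀ : ℕ, ∀ m ≥ m₀, ∀ χ : κ → (ι → ℤ) → ZMod 2,
      (∀ k ∈ L, ∀ x, SignLabel (χ k x) (f k (gridPos R m x))) →
      ∀ (S : Finset ι) (s x : ι → ℤ), (∀ i, s i = 1 ∨ s i = -1) → gridPos R m x ∈ K →
        cupD s (L.map χ) S x = 0 := by
  obtain ⟨δ, hδ, hball⟩ := lebesgue_number_lemma_of_metric (s := K)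
    (c := fun k : {k // k ∈ L} => {p | f k p ≠ 0}) hK
    (fun k => isOpen_ne_fun (hf k k.2) continuous_const)
    (fun p hp => by
      obtain ⟨k, hk, hne⟩ := h p hp
      exact mem_iUnion.2 ⟨⟨k, hk⟩, hne⟩)
  obtain ⟨m₀, hm₀⟩ := exists_nat_gt ((∑ i, |R i|) / δ)
  refine ⟨m₀ + 1, fun m hm χ hχ S s x hs hx => ?_⟩
  obtain ⟨⟨k, hk⟩, hkb⟩ := hball _ hx
  have hm' : (0 : ℝ) < m := by exact_mod_cast (by omega : 0 < m)
  have hmR : (∑ i, |R i|) / m < δ := by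
    rw [div_lt_iff₀ hm', mul_comm, ← div_lt_iff₀ hδ]
    exact hm₀.trans_le (by exact_mod_cast (by omega : m₀ ≤ m))
  have near : ∀ y : ι → ℤ, (∀ i, y i = x i ∨ (i ∈ S ∧ y i = x i + s i)) →
      gridPos R m y ∈ Metric.ball (gridPos R m x) δ := by
    intro y hy
    rw [Metric.mem_ball, dist_pi_lt_iff hδ]
    intro i
    refine lt_of_le_of_lt ?_ hmR
    have e : dist (gridPos R m y i) (gridPos R m x i) = |R i| * |(y i : ℝ) - x i| / m := by
      rw [Real.dist_eq, gridPos, gridPos, ← mul_sub, abs_mul, sub_sub_sub_cancel_right,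
        ← sub_div, abs_div, abs_of_pos hm', mul_div_assoc]
    rw [e]
    refine div_le_div_of_nonneg_right ?_ hm'.le
    have h1 : |(y i : ℝ) - x i| ≤ 1 := by
      rcases hy i with h | ⟨-, h⟩
      · simp [h]
      · rcases hs i with h' | h' <;> simp [h, h']
    exact (mul_le_of_le_one_right (abs_nonneg _) h1).trans
      (Finset.single_le_sum (f := fun i => |R i|) (fun j _ => abs_nonneg _) (Finset.mem_univ i))
  by_contra hne
  obtain ⟨y, y', hy, hy', hyy⟩ := exists_ne_of_cupD_ne_zero hne _ (List.mem_map_of_mem hk)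
  have conv := (convex_ball (gridPos R m x) δ).isPreconnected
  have key : ∀ y y' : ι → ℤ, gridPos R m y ∈ Metric.ball (gridPos R m x) δ →
      gridPos R m y' ∈ Metric.ball (gridPos R m x) δ → χ k y = 1 → χ k y' = 0 → False := by
    intro y y' h1 h2 e1 e2
    have a1 := (hχ k hk y).1 e1
    have a2 := (hχ k hk y').2 e2
    obtain ⟨q, hq, hq0⟩ := conv.intermediate_value h2 h1 (hf k hk).continuousOn ⟨a2, a1⟩
    exact hkb hq hq0
  have zo : ∀ a : ZMod 2, a = 0 ∨ a = 1 := by decide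
  rcases zo (χ k y) with e1 | e1 <;> rcases zo (χ k y') with e2 | e2
  · exact hyy (e1.trans e2.symm)
  · exact key _ _ (near y' hy') (near y hy) e2 e1
  · exact key _ _ (near y hy) (near y' hy') e1 e2
  · exact hyy (e1.trans e2.symm)

/-- A cell of a face of the grid is positioned in the corresponding face of the box. -/
theorem gridPos_mem_box {R : ι → ℝ} (hR : ∀ i, 0 ≤ R i) {m : ℕ} (hm : 0 < m) {S : Finset ι}
    {c k : ι → ℤ} (hc : ∀ i ∉ S, c i = 0 ∨ c i = 2 * m) (hk : k ∈ boxCells m S c) (i : ι) :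
    |gridPos R m (evenEnd ∘ k) i| ≤ R i := by
  refine abs_gridPos_le hR hm ?_
  rw [mem_boxCells] at hk
  by_cases hi : i ∈ S
  · exact evenEnd_mem (hk.1 i hi)
  · rw [Function.comp_apply, hk.2 i hi]
    rcases hc i hi with h | h <;> rw [h]
    · rw [evenEnd_of_even Even.zero]; constructor <;> omega
    · rw [evenEnd_of_even (even_two_mul _)]; constructor <;> omega

theorem evenEnd_boxCells {m : ℕ} {S : Finset ι} {c k : ι → ℤ} (hk : k ∈ boxCells m S c) {i : ι}
    (hi : i ∉ S) (hc : Even (c i)) : (evenEnd ∘ k) i = c i := by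
  rw [mem_boxCells] at hk
  rw [Function.comp_apply, hk.2 i hi, evenEnd_of_even hc]

theorem cupSum_update (m : ℕ) (l : List ((ι → ℤ) → ZMod 2)) {S : Finset ι} {i : ι}
    (hi : i ∉ S) (c : ι → ℤ) {a : ℤ} (ha : Even a) :
    cupSum m l S (Function.update c i a) = ∑ k ∈ boxCells m S (Function.update c i 0),
      cupD (evenDir ∘ k) l S (Function.update (evenEnd ∘ k) i a) :=
  cellSum_face m hi (fun s a x => cupD_update s i a l S x hi) c ha

theorem cupSum_congr_slice {κ : Type*} (m : ℕ) (L : List κ) {χ χ' : κ → (ι → ℤ) → ZMod 2}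
    {S : Finset ι} {i : ι} (hi : i ∉ S) (c : ι → ℤ) {a : ℤ} (ha : Even a)
    (h : ∀ k ∈ L, ∀ x, x i = 0 → χ k (Function.update x i a) = χ' k x) :
    cupSum m (L.map χ) S (Function.update c i a)
      = cupSum m (L.map χ') S (Function.update c i 0) := by
  rw [cupSum_update m _ hi c ha, cupSum, cellSum]
  refine Finset.sum_congr rfl fun k hk => ?_
  refine cupD_congr (P := fun x => x i = 0) (ρ := fun x => Function.update x i a) ?_ S _ ?_ ?_ ?_
  · clear hk
    induction L with
    | nil => exact List.Forall₂.nil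
    | cons j L ih =>
      refine List.Forall₂.cons ⟨0, fun y hy => ?_⟩ (ih fun k hk => h k (by simp [hk]))
      rw [h j (by simp) y hy, add_zero]
  · rw [evenEnd_boxCells hk hi] <;> simp
  · intro y hy j hj
    have : i ≠ j := fun e => hi (e ▸ hj)
    rw [gridStep, Function.update_of_ne this]; exact hy
  · intro y hy j hj
    have : j ≠ i := fun e => hi (e ▸ hj)
    simp only [gridStep, Function.update_of_ne this]
    exact Function.update_comm this _ _ _

/-- Homotopy invariance of the degree mod 2. -/
theorem cupSum_homotopy {κ : Type*} {R : ι → ℝ} (hR : ∀ i, 0 ≤ R i) (τ : ι) (L : List κ)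
    (H : κ → (ι → ℝ) → ℝ) (hH : ∀ k ∈ L, Continuous (H k))
    (h : ∀ p : ι → ℝ, (∀ i, |p i| ≤ R i) → (∃ i, i ≠ τ ∧ |p i| = R i) → ∃ k ∈ L, H k p ≠ 0) :
    ∃ m₀ : ℕ, ∀ m ≥ m₀, ∀ χ₀ χ₁ : κ → (ι → ℤ) → ZMod 2,
      (∀ k ∈ L, ∀ x, x τ = 0 → SignLabel (χ₀ k x) (H k (gridPos R m x))) →
      (∀ k ∈ L, ∀ x, x τ = 0 →
        SignLabel (χ₁ k x) (H k (gridPos R m (Function.update x τ (2 * m))))) →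
      cupSum m (L.map χ₀) (Finset.univ.erase τ) 0 = cupSum m (L.map χ₁) (Finset.univ.erase τ) 0 := by
  have hK : IsCompact {p : ι → ℝ | (∀ i, |p i| ≤ R i) ∧ ∃ i, i ≠ τ ∧ |p i| = R i} := by
    refine (isCompact_box R).inter_right ?_
    have : {p : ι → ℝ | ∃ i, i ≠ τ ∧ |p i| = R i} = ⋃ i : {i // i ≠ τ}, {p | |p i| = R i} := by
      ext p; simp
    change IsClosed {p : ι → ℝ | ∃ i, i ≠ τ ∧ |p i| = R i}
    rw [this]
    exact isClosed_iUnion_of_finite fun i =>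
      isClosed_eq (continuous_apply _).abs continuous_const
  obtain ⟨m₀, hm₀⟩ := cupD_eq_zero_of_no_zero R L H hH hK (fun p hp => h p hp.1 hp.2)
  refine ⟨m₀ + 1, fun m hm χ₀ χ₁ h₀ h₁ => ?_⟩
  have hmpos : 0 < m := by omega
  let χ : κ → (ι → ℤ) → ZMod 2 := fun k x =>
    if x τ = 0 then χ₀ k x else if x τ = 2 * m then χ₁ k (Function.update x τ 0)
    else if 0 < H k (gridPos R m x) then 1 else 0
  have hχ : ∀ k ∈ L, ∀ x, SignLabel (χ k x) (H k (gridPos R m x)) := by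
    intro k hk x
    simp only [χ]
    split_ifs with h1 h2 h3
    · exact h₀ k hk x h1
    · have := h₁ k hk (Function.update x τ 0) (by simp)
      rwa [Function.update_idem, ← h2, Function.update_eq_self] at this
    · have := signLabel_ite (H k (gridPos R m x)); rwa [if_pos h3] at this
    · have := signLabel_ite (H k (gridPos R m x)); rwa [if_neg h3] at this
  have st := cupSum_faces_eq_zero m (L.map χ) Finset.univ (0 : ι → ℤ)
  rw [← Finset.add_sum_erase _ _ (Finset.mem_univ τ), Finset.sum_eq_zero (s := Finset.univ.erase τ),
    add_zero] at st
  · have hτ : τ ∉ Finset.univ.erase τ := by simp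
    have z : Function.update (0 : ι → ℤ) τ 0 = 0 := by
      rw [← Pi.zero_apply (M := fun _ => ℤ) τ, Function.update_eq_self]
    have e1 := cupSum_congr_slice m L (χ := χ) (χ' := χ₁) hτ 0 (even_two_mul (m : ℤ)) (by
      intro k _ x hx
      have : (2 * (m : ℤ)) ≠ 0 := by omega
      simp only [χ, Function.update_self, if_neg this, if_true, Function.update_idem]
      rw [← hx, Function.update_eq_self])
    have e0 := cupSum_congr_slice m L (χ := χ) (χ' := χ₀) hτ 0 (Even.zero (α := ℤ)) (by
      intro k _ x hx
      simp only [χ, Function.update_self, if_true]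
      rw [← hx, Function.update_eq_self])
    rw [e1, e0, z] at st
    exact (CharTwo.add_eq_zero.mp st).symm
  · have van : ∀ i, i ≠ τ → ∀ a : ℤ, (a = 0 ∨ a = 2 * m) →
        cupSum m (L.map χ) (Finset.univ.erase i) (Function.update 0 i a) = 0 := by
      intro i hi a ha
      refine cellSum_eq_zero fun k hk => ?_
      refine hm₀ m (by omega) χ hχ _ _ _ (fun j => evenDir_eq _) ⟨?_, i, hi, ?_⟩
      · refine gridPos_mem_box hR hmpos (fun j hj => ?_) hk
        have : j = i := by simpa using hj
        subst this; simpa using ha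
      · have hii : i ∉ Finset.univ.erase i := by simp
        have e := evenEnd_boxCells hk hii (by
          rcases ha with rfl | rfl <;> simp)
        rw [Function.update_self] at e
        rcases ha with rfl | rfl
        · rw [gridPos_zero e, abs_neg, abs_of_nonneg (hR i)]
        · rw [gridPos_two_mul hmpos e, abs_of_nonneg (hR i)]
    intro i hi
    rw [van i (Finset.ne_of_mem_erase hi) _ (Or.inr rfl),
      van i (Finset.ne_of_mem_erase hi) _ (Or.inl rfl), add_zero]

end Mesh

section Antipodal

variable {ι : Type*} [DecidableEq ι]

/-- The reflection of `ℝ^ι` in the coordinates `J`. -/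
def coordReflect (J : Finset ι) (p : ι → ℝ) : ι → ℝ := fun i => if i ∈ J then - p i else p i

theorem coordReflect_gridPos (J : Finset ι) (R : ι → ℝ) {m : ℕ} (hm : 0 < m) (x : ι → ℤ) :
    gridPos R m (boxReflect m J x) = coordReflect J (gridPos R m x) := by
  have hm' : (m : ℝ) ≠ 0 := by exact_mod_cast hm.ne'
  ext i
  simp only [gridPos, boxReflect, coordReflect]
  split_ifs
  · push_cast; field_simp; ring
  · rfl

theorem continuous_coordReflect (J : Finset ι) : Continuous (coordReflect J) := by
  refine continuous_pi fun i => ?_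
  unfold coordReflect
  split_ifs <;> fun_prop

theorem cupD_reflect {κ : Type*} {m : ℕ} (hm : 0 < m) {J : Finset ι} (L : List κ)
    (χ : κ → (ι → ℤ) → ZMod 2) (a : κ → ZMod 2)
    (hχ : ∀ k ∈ L, ∀ x, (∃ i ∈ J, x i ≠ (m : ℤ)) → χ k (boxReflect m J x) = χ k x + a k)
    {S : Finset ι} {i : ι} (hiJ : i ∈ J) (hiS : i ∉ S) {s s' x : ι → ℤ}
    (hx : x i = 0 ∨ x i = 2 * m) (hs : ∀ j ∈ S, s' j = if j ∈ J then - s j else s j) :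
    cupD s' (L.map χ) S (boxReflect m J x) = cupD s (L.map χ) S x := by
  refine cupD_congr (P := fun y => y i = 0 ∨ y i = 2 * m) (ρ := boxReflect m J) ?_ S x hx ?_ ?_
  · induction L with
    | nil => exact List.Forall₂.nil
    | cons k L ih =>
      refine List.Forall₂.cons ⟨a k, fun y hy => hχ k (by simp) y ⟨i, hiJ, ?_⟩⟩
        (ih fun k hk => hχ k (by simp [hk]))
      rcases hy with h | h <;> omega
  · intro y hy j hj
    have : i ≠ j := fun e => hiS (e ▸ hj)
    rw [gridStep, Function.update_of_ne this]; exact hy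
  · intro y _ j hj
    ext b
    by_cases h : b = j
    · subst h
      simp only [boxReflect, gridStep, Function.update_self, hs b hj]
      split_ifs <;> ring
    · simp only [boxReflect, gridStep, Function.update_of_ne h]

variable [Fintype ι]

theorem boxCells_congr (m : ℕ) {S : Finset ι} {c c' : ι → ℤ} (h : ∀ i ∉ S, c i = c' i) :
    boxCells m S c = boxCells m S c' := by
  ext k
  rw [mem_boxCells, mem_boxCells]
  refine and_congr_right fun _ => forall₂_congr fun i hi => ?_
  rw [h i hi]

theorem cellSum_congr_height (m : ℕ) (F : (ι → ℤ) → (ι → ℤ) → ZMod 2) {S : Finset ι}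
    {c c' : ι → ℤ} (h : ∀ i ∉ S, c i = c' i) : cellSum m F S c = cellSum m F S c' := by
  rw [cellSum, boxCells_congr m h, cellSum]

/-- A mod 2 degree vanishes when, away from the common zeros, the functions are odd or even under
a reflection and an equivariant homotopy removes the zeros on the boundary. -/
theorem cupSum_eq_zero_of_antipodal {κ : Type*} {R : ι → ℝ} (hR : ∀ i, 0 ≤ R i) {τ : ι}
    {J : Finset ι} (hτ : τ ∉ J) (k₀ : κ) (L : List κ) (g : κ → (ι → ℝ) → ℝ)
    (hg : ∀ k, Continuous (g k)) (odd : κ → Bool)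
    (par : ∀ k ∈ L, ∀ p, g k (coordReflect J p) = if odd k then - g k p else g k p)
    (tie : ℕ → (ι → ℤ) → Prop)
    (htie : ∀ m : ℕ, 0 < m → ∀ x, (∃ i ∈ J, x i ≠ (m : ℤ)) → (tie m (boxReflect m J x) ↔ ¬ tie m x))
    (h₁ : ∀ p : ι → ℝ, (∀ i, |p i| ≤ R i) → p τ = - R τ → (∃ i, i ≠ τ ∧ i ∉ J ∧ |p i| = R i) →
      0 ≤ g k₀ p → ∃ k ∈ L, g k p ≠ 0)
    (h₂ : ∀ p : ι → ℝ, (∀ i, |p i| ≤ R i) → p τ = - R τ → (∃ i ∈ J, p i = R i) →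
      g k₀ p ≤ 0 → g k₀ (coordReflect J p) ≤ 0 → ∃ k ∈ L, g k p ≠ 0)
    (h₂' : ∀ p, 0 ≤ g k₀ p → 0 ≤ g k₀ (coordReflect J p) → False)
    (h₃ : ∀ p : ι → ℝ, (∀ i, |p i| ≤ R i) → p τ = R τ → (∃ i ∈ J, p i = R i) →
      ∃ k ∈ L, g k p ≠ 0)
    (h₄ : ∀ p : ι → ℝ, (∀ i, |p i| ≤ R i) → (∃ i, i ≠ τ ∧ i ∉ J ∧ |p i| = R i) →
      (∃ i ∈ J, p i = R i) → ∃ k ∈ L, g k p ≠ 0) :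
    ∃ m₀ : ℕ, ∀ m ≥ m₀, ∃ χ : κ → (ι → ℤ) → ZMod 2,
      (∀ k x, SignLabel (χ k x) (g k (gridPos R m x))) ∧
      cupSum m ((k₀ :: L).map χ) (Finset.univ.erase τ) 0 = 0 := by
  have cl₁ : IsClosed {p : ι → ℝ | ∃ i, i ≠ τ ∧ i ∉ J ∧ |p i| = R i} := by
    have : {p : ι → ℝ | ∃ i, i ≠ τ ∧ i ∉ J ∧ |p i| = R i}
        = ⋃ i : {i // i ≠ τ ∧ i ∉ J}, {p | |p i| = R i} := by
      ext p; simp [and_assoc]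
    rw [this]
    exact isClosed_iUnion_of_finite fun i =>
      isClosed_eq (continuous_apply _).abs continuous_const
  have cl₂ : IsClosed {p : ι → ℝ | ∃ i ∈ J, p i = R i} := by
    have : {p : ι → ℝ | ∃ i ∈ J, p i = R i} = ⋃ i : {i // i ∈ J}, {p | p i = R i} := by
      ext p; simp
    rw [this]
    exact isClosed_iUnion_of_finite fun i => isClosed_eq (continuous_apply _) continuous_const
  have clτ : ∀ a : ℝ, IsClosed {p : ι → ℝ | p τ = a} := fun a =>
    isClosed_eq (continuous_apply _) continuous_const
  obtain ⟨m₁, H₁⟩ := cupD_eq_zero_of_no_zero R L g (fun k _ => hg k)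
    (((isCompact_box R).inter_right (clτ (- R τ))).inter_right
      (cl₁.inter (isClosed_le continuous_const (hg k₀))))
    (fun p hp => h₁ p hp.1.1 hp.1.2 hp.2.1 hp.2.2)
  obtain ⟨m₂, H₂⟩ := cupD_eq_zero_of_no_zero R L g (fun k _ => hg k)
    (((isCompact_box R).inter_right (clτ (- R τ))).inter_right
      (cl₂.inter ((isClosed_le (hg k₀) continuous_const).inter
        (isClosed_le ((hg k₀).comp (continuous_coordReflect J)) continuous_const))))
    (fun p hp => h₂ p hp.1.1 hp.1.2 hp.2.1 hp.2.2.1 hp.2.2.2)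
  obtain ⟨m₃, H₃⟩ := cupD_eq_zero_of_no_zero R L g (fun k _ => hg k)
    (((isCompact_box R).inter_right (clτ (R τ))).inter_right cl₂)
    (fun p hp => h₃ p hp.1.1 hp.1.2 hp.2)
  obtain ⟨m₄, H₄⟩ := cupD_eq_zero_of_no_zero R L g (fun k _ => hg k)
    ((isCompact_box R).inter_right (cl₁.inter cl₂)) (fun p hp => h₄ p hp.1 hp.2.1 hp.2.2)
  refine ⟨m₁ + m₂ + m₃ + m₄ + 1, fun m hm => ?_⟩
  have hm0 : 0 < m := by omega
  classical
  let χ : κ → (ι → ℤ) → ZMod 2 := fun k x =>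
    if 0 < g k (gridPos R m x) ∨ (odd k = true ∧ g k (gridPos R m x) = 0 ∧ tie m x) then 1 else 0
  have hχ : ∀ k x, SignLabel (χ k x) (g k (gridPos R m x)) := by
    intro k x
    simp only [χ, SignLabel]
    split_ifs with h
    · refine ⟨fun _ => ?_, fun e => absurd e one_ne_zero⟩
      rcases h with h | h
      · exact h.le
      · exact h.2.1.ge
    · refine ⟨fun e => absurd e zero_ne_one, fun _ => ?_⟩
      exact not_lt.1 fun h' => h (Or.inl h')
  have hχr : ∀ k ∈ L, ∀ x, (∃ i ∈ J, x i ≠ (m : ℤ)) →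
      χ k (boxReflect m J x) = χ k x + (if odd k then 1 else 0) := by
    intro k hk x hx
    have ht := htie m hm0 x hx
    simp only [χ, coordReflect_gridPos J R hm0, par k hk, ht]
    by_cases ho : odd k = true
    · simp only [ho, if_true, true_and, Left.neg_pos_iff, neg_eq_zero]
      rcases lt_trichotomy (g k (gridPos R m x)) 0 with h | h | h
      · simp [h, h.ne, h.le]
      · by_cases ht' : tie m x <;> simp [h, ht', CharTwo.add_self_eq_zero]
      · simp [h, h.ne', h.le, CharTwo.add_self_eq_zero]
    · simp [ho]
  refine ⟨χ, hχ, ?_⟩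
  -- the position of a cell
  have hpos : ∀ (S : Finset ι) (c k : ι → ℤ), (∀ i ∉ S, c i = 0 ∨ c i = 2 * m) →
      k ∈ boxCells m S c → ∀ i, |gridPos R m (evenEnd ∘ k) i| ≤ R i :=
    fun S c k hc hk => gridPos_mem_box hR hm0 hc hk
  have hval : ∀ (S : Finset ι) (c k : ι → ℤ), (∀ i ∉ S, c i = 0 ∨ c i = 2 * m) →
      k ∈ boxCells m S c → ∀ i ∉ S, (evenEnd ∘ k) i = c i := by
    intro S c k hc hk i hi
    refine evenEnd_boxCells hk hi ?_
    rcases hc i hi with h | h <;> rw [h]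
    · exact Even.zero
    · exact even_two_mul _
  have hface : ∀ (S : Finset ι) (c k : ι → ℤ), (∀ i ∉ S, c i = 0 ∨ c i = 2 * m) →
      k ∈ boxCells m S c → ∀ i ∉ S, |gridPos R m (evenEnd ∘ k) i| = R i := by
    intro S c k hc hk i hi
    have e := hval S c k hc hk i hi
    rcases hc i hi with h | h <;> rw [h] at e
    · rw [gridPos_zero e, abs_neg, abs_of_nonneg (hR i)]
    · rw [gridPos_two_mul hm0 e, abs_of_nonneg (hR i)]
  have refl_eq : ∀ (S : Finset ι) (c c' : ι → ℤ) (i : ι), i ∈ J → i ∉ S →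
      (∀ j ∉ S, c j = 0 ∨ c j = 2 * m) → (∀ j ∉ S, c' j = boxReflect m J c j) →
      (∀ j, Even (c j)) → ∀ w : (ι → ℤ) → ZMod 2,
      cellSum m (fun s x => w x * cupD s (L.map χ) S x) S c'
        = cellSum m (fun s x => w (boxReflect m J x) * cupD s (L.map χ) S x) S c := by
    intro S c c' i hiJ hiS hc hcc' hev w
    rw [cellSum_congr_height m _ hcc']
    refine cellSum_reflect m J S hev fun k hk s' hs' => ?_
    rw [cupD_reflect hm0 L χ _ hχr hiJ hiS (s := evenDir ∘ k) _ hs']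
    rw [hval S c k hc hk i hiS]
    exact hc i hiS
  let F : ι → ZMod 2 := fun i =>
    cupSum m (L.map χ) ((Finset.univ.erase τ).erase i) (Function.update 0 i (2 * m))
  have stepA : cupSum m ((k₀ :: L).map χ) (Finset.univ.erase τ) 0 = ∑ i ∈ J, F i := by
    rw [List.map_cons, cupSum_cons, ← Finset.sum_subset (s₁ := J)]
    · refine Finset.sum_congr rfl fun i hi => ?_
      have hiτ : i ≠ τ := fun e => hτ (e ▸ hi)
      have hiS : i ∉ (Finset.univ.erase τ).erase i := by simp
      have hc : ∀ j ∉ (Finset.univ.erase τ).erase i,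
          Function.update (0 : ι → ℤ) i (2 * m) j = 0 ∨
          Function.update (0 : ι → ℤ) i (2 * m) j = 2 * m := by
        intro j _
        by_cases h : j = i
        · subst h; simp
        · simp [Function.update_of_ne h]
      rw [refl_eq _ (Function.update 0 i (2 * m)) (Function.update 0 i 0) i hi hiS hc ?_ ?_ (χ k₀)]
      · simp only [F, cupSum, cellSum]
        rw [← Finset.sum_add_distrib]
        refine Finset.sum_congr rfl fun k hk => ?_
        rw [← add_mul]
        have zo : ∀ a b : ZMod 2, a + b = 1 ∨ (a = 0 ∧ b = 0) ∨ (a = 1 ∧ b = 1) := by decide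
        have hi2 : (evenEnd ∘ k) i = 2 * m := by
          rw [hval _ _ k hc hk i hiS, Function.update_self]
        have hτ2 : (evenEnd ∘ k) τ = 0 := by
          rw [hval _ _ k hc hk τ (by simp), Function.update_of_ne hiτ.symm]; rfl
        have l1 := hχ k₀ (evenEnd ∘ k)
        have l2 := hχ k₀ (boxReflect m J (evenEnd ∘ k))
        rw [coordReflect_gridPos J R hm0] at l2
        rcases zo (χ k₀ (evenEnd ∘ k)) (χ k₀ (boxReflect m J (evenEnd ∘ k))) with h | h | h
        · rw [h, one_mul]
        · rw [H₂ m (by omega) χ (fun k _ => hχ k) _ (evenDir ∘ k) _ (fun j => evenDir_eq (k j))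
            ⟨⟨hpos _ _ k hc hk, gridPos_zero hτ2⟩, ⟨i, hi, gridPos_two_mul hm0 hi2⟩,
              l1.2 h.1, l2.2 h.2⟩, mul_zero]
        · exact (h₂' _ (l1.1 h.1) (l2.1 h.2)).elim
      · intro j hj
        by_cases h : j = i
        · subst h; simp [boxReflect, hi]
        · have : j = τ := by simpa [h] using hj
          subst this
          simp [boxReflect, hτ, Function.update_of_ne h]
      · intro j
        by_cases h : j = i
        · subst h; simp
        · simp [Function.update_of_ne h]
    · intro i hi
      exact Finset.mem_erase.2 ⟨fun e => hτ (e ▸ hi), Finset.mem_univ _⟩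
    · intro i hi hiJ
      have hiτ : i ≠ τ := Finset.ne_of_mem_erase hi
      have van : ∀ a : ℤ, (a = 0 ∨ a = 2 * m) → cellSum m (fun s x => χ k₀ x *
          cupD s (L.map χ) ((Finset.univ.erase τ).erase i) x) ((Finset.univ.erase τ).erase i)
          (Function.update 0 i a) = 0 := by
        intro a ha
        refine cellSum_eq_zero fun k hk => ?_
        have hc : ∀ j ∉ (Finset.univ.erase τ).erase i,
            Function.update (0 : ι → ℤ) i a j = 0 ∨
            Function.update (0 : ι → ℤ) i a j = 2 * m := by
          intro j _
          by_cases h : j = i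
          · subst h; simpa using ha
          · simp [Function.update_of_ne h]
        have hτ2 : (evenEnd ∘ k) τ = 0 := by
          rw [hval _ _ k hc hk τ (by simp), Function.update_of_ne hiτ.symm]; rfl
        have zo : ∀ a : ZMod 2, a = 0 ∨ a = 1 := by decide
        rcases zo (χ k₀ (evenEnd ∘ k)) with h | h
        · rw [h, zero_mul]
        · rw [H₁ m (by omega) χ (fun k _ => hχ k) _ (evenDir ∘ k) _ (fun j => evenDir_eq (k j))
            ⟨⟨hpos _ _ k hc hk, gridPos_zero hτ2⟩, ⟨i, hiτ, hiJ, hface _ _ k hc hk i (by simp)⟩,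
              (hχ k₀ _).1 h⟩, mul_zero]
      rw [van _ (Or.inr rfl), van _ (Or.inl rfl), add_zero]
  let E : ℤ → ι → ι → ZMod 2 := fun a i j =>
    cupSum m (L.map χ) ((Finset.univ.erase i).erase j)
      (Function.update (Function.update 0 i (2 * m)) j a)
  have hcE : ∀ (i j : ι) (a : ℤ), (a = 0 ∨ a = 2 * m) → ∀ b,
      Function.update (Function.update (0 : ι → ℤ) i (2 * m)) j a b = 0 ∨
      Function.update (Function.update (0 : ι → ℤ) i (2 * m)) j a b = 2 * m := by
    intro i j a ha b
    by_cases h : b = j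
    · subst h; simpa using ha
    · rw [Function.update_of_ne h]
      by_cases h : b = i
      · subst h; simp
      · simp [Function.update_of_ne h]
  have stepC : ∀ i ∈ J, F i = ∑ j ∈ J.erase i, (E (2 * m) i j + E 0 i j) := by
    intro i hi
    have hiτ : i ≠ τ := fun e => hτ (e ▸ hi)
    have st := cupSum_faces_eq_zero m (L.map χ) (Finset.univ.erase i)
      (Function.update 0 i (2 * (m : ℤ)))
    have van : ∀ j, j ≠ i → j ∉ J → ∀ a : ℤ, (a = 0 ∨ a = 2 * m) → (j = τ → a = 2 * m) →
        E a i j = 0 := by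
      intro j hji hjJ a ha hja
      refine cellSum_eq_zero fun k hk => ?_
      have hc := fun b (_ : b ∉ (Finset.univ.erase i).erase j) => hcE i j a ha b
      have hi2 : (evenEnd ∘ k) i = 2 * m := by
        rw [hval _ _ k hc hk i (by simp), Function.update_of_ne hji.symm, Function.update_self]
      by_cases hjτ : j = τ
      · have hj2 : (evenEnd ∘ k) τ = 2 * m := by
          rw [← hjτ, hval _ _ k hc hk j (by simp), Function.update_self, hja hjτ]
        exact H₃ m (by omega) χ (fun k _ => hχ k) _ (evenDir ∘ k) _ (fun j => evenDir_eq (k j))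
          ⟨⟨hpos _ _ k hc hk, gridPos_two_mul hm0 hj2⟩, ⟨i, hi, gridPos_two_mul hm0 hi2⟩⟩
      · exact H₄ m (by omega) χ (fun k _ => hχ k) _ (evenDir ∘ k) _ (fun j => evenDir_eq (k j))
          ⟨hpos _ _ k hc hk, ⟨j, hjτ, hjJ, hface _ _ k hc hk j (by simp)⟩,
            ⟨i, hi, gridPos_two_mul hm0 hi2⟩⟩
    have hF : F i = E 0 i τ := by
      simp only [F, E]
      rw [Finset.erase_right_comm]
      refine cellSum_congr_height m _ fun j _ => ?_
      by_cases h : j = τ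
      · subst h; simp [Function.update_of_ne hiτ.symm]
      · rw [Function.update_of_ne h]
    change ∑ j ∈ Finset.univ.erase i, (E (2 * m) i j + E 0 i j) = 0 at st
    rw [← Finset.sum_subset (s₁ := insert τ (J.erase i)), Finset.sum_insert,
      van τ hiτ.symm hτ _ (Or.inr rfl) (fun _ => rfl), zero_add] at st
    · rw [hF]; exact CharTwo.add_eq_zero.mp st
    · exact fun h => hτ (Finset.mem_of_mem_erase h)
    · intro j hj
      rcases Finset.mem_insert.1 hj with rfl | hj
      · exact Finset.mem_erase.2 ⟨hiτ.symm, Finset.mem_univ _⟩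
      · exact Finset.mem_erase.2 ⟨Finset.ne_of_mem_erase hj, Finset.mem_univ _⟩
    · intro j hj hj'
      have hji := Finset.ne_of_mem_erase hj
      have hjτ : j ≠ τ := fun e => hj' (by simp [e])
      have hjJ : j ∉ J := fun e => hj' (by simp [e, hji])
      rw [van j hji hjJ _ (Or.inr rfl) (fun _ => rfl),
        van j hji hjJ _ (Or.inl rfl) (fun e => absurd e hjτ), add_zero]
  rw [stepA, Finset.sum_congr rfl stepC]
  simp only [Finset.sum_add_distrib]
  have s₁ : ∀ i j, E (2 * m) i j = E (2 * m) j i := by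
    intro i j
    simp only [E]
    rw [Finset.erase_right_comm]
    by_cases h : i = j
    · rw [h]
    · rw [Function.update_comm h]
  have s₂ : ∑ i ∈ J, ∑ j ∈ J.erase i, E 0 i j = 0 := by
    have : ∀ i ∈ J, ∀ j ∈ J.erase i, E 0 i j = E 0 j i := by
      intro i hi j hj
      have hji := Finset.ne_of_mem_erase hj
      have hjJ := Finset.mem_of_mem_erase hj
      simp only [E]
      rw [Finset.erase_right_comm]
      have := refl_eq ((Finset.univ.erase j).erase i)
        (Function.update (Function.update 0 j (2 * m)) i 0)
        (Function.update (Function.update 0 i (2 * m)) j 0) i hi (by simp)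
        (fun b _ => hcE j i 0 (Or.inl rfl) b) ?_ ?_ (fun _ => 1)
      · simpa only [one_mul, cupSum] using this
      · intro b hb
        by_cases h1 : b = i
        · subst h1; simp [boxReflect, hi, Function.update_of_ne hji.symm]
        · have : b = j := by by_contra h; simp [h1, h] at hb
          subst this; simp [boxReflect, hjJ, Function.update_of_ne hji]
      · intro b
        rcases hcE j i 0 (Or.inl rfl) b with h | h <;> rw [h]
        · exact Even.zero
        · exact even_two_mul _
    -- symmetrise off the diagonal set
    let E' : ι → ι → ZMod 2 := fun i j => if i ∈ J ∧ j ∈ J ∧ i ≠ j then E 0 i j else 0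
    rw [Finset.sum_congr rfl fun i hi => Finset.sum_congr rfl fun j hj => (?_ : E 0 i j = E' i j)]
    · refine sum_offDiag_eq_zero J E' fun i j => ?_
      simp only [E']
      by_cases h : i ∈ J ∧ j ∈ J ∧ i ≠ j
      · rw [if_pos h, if_pos ⟨h.2.1, h.1, h.2.2.symm⟩]
        exact this i h.1 j (Finset.mem_erase.2 ⟨h.2.2.symm, h.2.1⟩)
      · rw [if_neg h, if_neg fun h' => h ⟨h'.2.1, h'.1, h'.2.2.symm⟩]
    · simp only [E']
      rw [if_pos ⟨hi, Finset.mem_of_mem_erase hj, (Finset.ne_of_mem_erase hj).symm⟩]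
  rw [sum_offDiag_eq_zero J _ s₁, s₂, add_zero]

end Antipodal

section Twist

/-- The vector of `ℝ⁵` with the given coordinates. -/
def vec5 (a b c d e : ℝ) : EucA 5 := !₂[a, b, c, d, e]

@[simp] theorem vec5_zero (a b c d e : ℝ) : vec5 a b c d e 0 = a := rfl
@[simp] theorem vec5_one (a b c d e : ℝ) : vec5 a b c d e 1 = b := rfl
@[simp] theorem vec5_two (a b c d e : ℝ) : vec5 a b c d e 2 = c := rfl
@[simp] theorem vec5_three (a b c d e : ℝ) : vec5 a b c d e 3 = d := rfl
@[simp] theorem vec5_four (a b c d e : ℝ) : vec5 a b c d e 4 = e := rfl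

theorem continuous_vec5 {X : Type*} [TopologicalSpace X] {a b c d e : X → ℝ} (ha : Continuous a)
    (hb : Continuous b) (hc : Continuous c) (hd : Continuous d) (he : Continuous e) :
    Continuous fun x => vec5 (a x) (b x) (c x) (d x) (e x) := by
  refine (PiLp.continuous_toLp 2 _).comp (continuous_pi fun i => ?_)
  fin_cases i <;> assumption

theorem norm_sq_eucA5 (x : EucA 5) :
    ‖x‖ ^ 2 = x 0 ^ 2 + x 1 ^ 2 + x 2 ^ 2 + x 3 ^ 2 + x 4 ^ 2 := by
  rw [EuclideanSpace.norm_sq_eq, Fin.sum_univ_five]; simp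

/-- A positively homogeneous, norm preserving family of self-maps of `ℝ⁵`, parametrized by the
plane, which over the exterior of the unit disk is the rotation of the first two coordinates by
the polar angle of the parameter. -/
structure IsDiskTwist (r : ℝ → ℝ → EucA 5 → EucA 5) : Prop where
  cont : Continuous fun q : ℝ × ℝ × EucA 5 => r q.1 q.2.1 q.2.2
  norm_eq : ∀ b c Y, ‖r b c Y‖ = ‖Y‖
  smul_eq : ∀ b c Y, ∀ l : ℝ, 0 < l → r b c (l • Y) = l • r b c Y
  twist_zero : ∀ b c Y, 1 ≤ b ^ 2 + c ^ 2 → r b c Y 0 = (b * Y 0 - c * Y 1) / √(b ^ 2 + c ^ 2)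
  twist_one : ∀ b c Y, 1 ≤ b ^ 2 + c ^ 2 → r b c Y 1 = (b * Y 1 + c * Y 0) / √(b ^ 2 + c ^ 2)
  twist_two : ∀ b c Y, 1 ≤ b ^ 2 + c ^ 2 → r b c Y 2 = Y 2
  twist_three : ∀ b c Y, 1 ≤ b ^ 2 + c ^ 2 → r b c Y 3 = Y 3
  twist_four : ∀ b c Y, 1 ≤ b ^ 2 + c ^ 2 → r b c Y 4 = Y 4

variable {r : ℝ → ℝ → EucA 5 → EucA 5}

theorem IsDiskTwist.exists_close (hr : IsDiskTwist r) : ∃ C : ℝ, 1 ≤ C ∧ ∀ b c Y δ, |b| ≤ 1 →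
    |c| ≤ 1 → C ≤ ‖Y‖ → ‖δ‖ ≤ 2 → ‖r b c (Y + δ) - r b c Y‖ < ‖Y‖ := by
  have hK : IsCompact ((Metric.closedBall (0:ℝ) 1) ×ˢ (Metric.closedBall (0:ℝ) 1) ×ˢ
      (Metric.closedBall (0 : EucA 5) 2)) :=
    (isCompact_closedBall _ _).prod ((isCompact_closedBall _ _).prod (isCompact_closedBall _ _))
  have huc := hK.uniformContinuousOn_of_continuous hr.cont.continuousOn
  rw [Metric.uniformContinuousOn_iff] at huc
  obtain ⟨η, hη, h⟩ := huc 1 one_pos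
  refine ⟨max 2 (4 / η), le_trans (by norm_num) (le_max_left _ _), fun b c Y δ hb hc hY hδ => ?_⟩
  have hY2 : 2 ≤ ‖Y‖ := (le_max_left _ _).trans hY
  have hYη : 4 / η ≤ ‖Y‖ := (le_max_right _ _).trans hY
  have hY0 : 0 < ‖Y‖ := by linarith
  have hu : ‖‖Y‖⁻¹ • Y‖ = 1 := by
    rw [norm_smul, norm_inv, norm_norm, inv_mul_cancel₀ hY0.ne']
  have hd : ‖‖Y‖⁻¹ • δ‖ ≤ 2 / ‖Y‖ := by
    rw [norm_smul, norm_inv, norm_norm, div_eq_inv_mul]; gcongr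
  have hd1 : 2 / ‖Y‖ ≤ 1 := by rw [div_le_one hY0]; exact hY2
  have hdη : 2 / ‖Y‖ < η := by
    rw [div_le_iff₀ hη] at hYη
    rw [div_lt_iff₀ hY0]; nlinarith
  have e1 : r b c (Y + δ) = ‖Y‖ • r b c (‖Y‖⁻¹ • Y + ‖Y‖⁻¹ • δ) := by
    rw [← hr.smul_eq _ _ _ _ hY0, ← smul_add, smul_inv_smul₀ hY0.ne']
  have e2 : r b c Y = ‖Y‖ • r b c (‖Y‖⁻¹ • Y) := by
    rw [← hr.smul_eq _ _ _ _ hY0, smul_inv_smul₀ hY0.ne']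
  rw [e1, e2, ← smul_sub, norm_smul, norm_norm]
  have key := h (b, c, ‖Y‖⁻¹ • Y + ‖Y‖⁻¹ • δ) (by
      simp only [Set.mem_prod, mem_closedBall_zero_iff, Real.norm_eq_abs]
      exact ⟨hb, hc, (norm_add_le _ _).trans (by linarith)⟩)
    (b, c, ‖Y‖⁻¹ • Y) (by
      simp only [Set.mem_prod, mem_closedBall_zero_iff, Real.norm_eq_abs]
      exact ⟨hb, hc, by linarith⟩) (by
      rw [Prod.dist_eq, Prod.dist_eq]
      simp only [dist_self, dist_self_add_left]
      exact max_lt hη (max_lt hη (by linarith)))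
  rw [dist_eq_norm] at key
  nlinarith

/-- The comparison function: it vanishes iff `a = (1/2, 0, 0, 0, 0) = - a'`. -/
def cmpFun (a a' : EucA 5) : Fin 10 → ℝ :=
  ![a 0 - a' 0 - 1, a 0 + a' 0, a 1 + a' 1, a 2 + a' 2, a 3 + a' 3, a 4 + a' 4, a 1 - a' 1,
    a 2 - a' 2, a 3 - a' 3, a 4 - a' 4]

theorem continuous_cmpFun {X : Type*} [TopologicalSpace X] {a a' : X → EucA 5}
    (ha : Continuous a) (ha' : Continuous a') (k : Fin 10) :
    Continuous fun x => cmpFun (a x) (a' x) k := by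
  have h (i : Fin 5) : Continuous fun x => a x i := by fun_prop
  have h' (i : Fin 5) : Continuous fun x => a' x i := by fun_prop
  fin_cases k <;> simp [cmpFun] <;> fun_prop

end Twist

section DiskTwist

variable {r : ℝ → ℝ → EucA 5 → EucA 5}

/-- The half-widths of the box on which the local degrees are computed. -/
def boxWidth (C : ℝ) : Fin 11 → ℝ := ![1, 1, 1, C, C, C, C, C, 1, 1, 1]

theorem one_le_boxWidth {C : ℝ} (hC : 1 ≤ C) (i : Fin 11) : 1 ≤ boxWidth C i := by
  fin_cases i <;> simp [boxWidth, hC]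

/-- The indices of the comparison function. -/
def cmpIdx : List (Fin 10) := [0, 1, 2, 3, 4, 5, 6, 7, 8, 9]

theorem eq_of_cmpFun_eq_zero {a a' : EucA 5} (h : ∀ k ∈ cmpIdx, cmpFun a a' k = 0) :
    a 0 = 1 / 2 ∧ a 1 = 0 ∧ a 2 = 0 ∧ a 3 = 0 ∧ a 4 = 0 ∧
      a' 0 = -1 / 2 ∧ a' 1 = 0 ∧ a' 2 = 0 ∧ a' 3 = 0 ∧ a' 4 = 0 := by
  simp [cmpIdx, cmpFun] at h
  obtain ⟨h0, h1, h2, h3, h4, h5, h6, h7, h8, h9⟩ := h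
  refine ⟨?_, ?_, ?_, ?_, ?_, ?_, ?_, ?_, ?_, ?_⟩ <;> linarith

theorem norm_sq_of_cmpFun_eq_zero {a a' : EucA 5} (h : ∀ k ∈ cmpIdx, cmpFun a a' k = 0) :
    ‖a‖ ^ 2 = 1 / 4 ∧ ‖a'‖ ^ 2 = 1 / 4 := by
  obtain ⟨h0, h1, h2, h3, h4, h5, h6, h7, h8, h9⟩ := eq_of_cmpFun_eq_zero h
  rw [norm_sq_eucA5, norm_sq_eucA5, h0, h1, h2, h3, h4, h5, h6, h7, h8, h9]
  norm_num

theorem one_le_sq_of_abs_eq {C : ℝ} (hC : 1 ≤ C) {p : Fin 11 → ℝ} {i : Fin 11}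
    (h : |p i| = boxWidth C i) : 1 ≤ p i ^ 2 := by
  have := one_le_boxWidth hC i
  rw [← sq_abs, h]; nlinarith

/-- The vector of the first kind of perturbed argument. -/
def argAdd (p : Fin 11 → ℝ) (u v : ℝ) : EucA 5 := vec5 u v (p 5 + p 8) (p 6 + p 9) (p 7 + p 10)

/-- The vector of the second kind of perturbed argument. -/
def argSub (p : Fin 11 → ℝ) (u v : ℝ) : EucA 5 := vec5 u v (p 5 - p 8) (p 6 - p 9) (p 7 - p 10)

theorem continuous_argAdd {u v : (Fin 11 → ℝ) → ℝ} (hu : Continuous u) (hv : Continuous v) :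
    Continuous fun p => argAdd p (u p) (v p) :=
  continuous_vec5 hu hv (by fun_prop) (by fun_prop) (by fun_prop)

theorem continuous_argSub {u v : (Fin 11 → ℝ) → ℝ} (hu : Continuous u) (hv : Continuous v) :
    Continuous fun p => argSub p (u p) (v p) :=
  continuous_vec5 hu hv (by fun_prop) (by fun_prop) (by fun_prop)

theorem IsDiskTwist.continuous_comp (hr : IsDiskTwist r) {X : Type*} [TopologicalSpace X]
    {b c : X → ℝ} {Y : X → EucA 5} (hb : Continuous b) (hc : Continuous c) (hY : Continuous Y) :
    Continuous fun x => r (b x) (c x) (Y x) :=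
  hr.cont.comp (hb.prodMk (hc.prodMk hY))

theorem IsDiskTwist.interior_of_cmpFun_eq_zero (hr : IsDiskTwist r) {p : Fin 11 → ℝ}
    {b c b' c' u v u' v' : ℝ}
    (h : ∀ k ∈ cmpIdx, cmpFun (r b c (argAdd p u v)) (r b' c' (argSub p u' v')) k = 0) :
    u ^ 2 + v ^ 2 + u' ^ 2 + v' ^ 2 + 2 * (p 5 ^ 2 + p 6 ^ 2 + p 7 ^ 2)
      + 2 * (p 8 ^ 2 + p 9 ^ 2 + p 10 ^ 2) = 1 / 2 ∧ u ^ 2 + v ^ 2 ≤ 1 / 4 := by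
  obtain ⟨h1, h2⟩ := norm_sq_of_cmpFun_eq_zero h
  rw [hr.norm_eq, norm_sq_eucA5] at h1 h2
  simp only [argAdd, argSub, vec5_zero, vec5_one, vec5_two, vec5_three, vec5_four] at h1 h2
  constructor
  · linarith
  · nlinarith [sq_nonneg (p 5 + p 8), sq_nonneg (p 6 + p 9), sq_nonneg (p 7 + p 10)]

/-- The first homotopy. -/
def homA (r : ℝ → ℝ → EucA 5 → EucA 5) (k : Fin 10) (p : Fin 11 → ℝ) : ℝ :=
  cmpFun (r (p 1) (p 2) (argAdd p ((1 - p 0) / 2 * p 3 - (1 + p 0) / 2 * p 1)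
      ((1 - p 0) / 2 * p 4 + (1 + p 0) / 2 * p 2)))
    (r (p 1) (p 2) (argSub p (p 3) (p 4))) k

/-- The second homotopy. -/
def homB (r : ℝ → ℝ → EucA 5 → EucA 5) (k : Fin 10) (p : Fin 11 → ℝ) : ℝ :=
  cmpFun (r ((1 - p 0) / 2 * p 1 + (1 + p 0) / 2) ((1 - p 0) / 2 * p 2)
      (argAdd p (- p 1) (p 2)))
    (r ((1 - p 0) / 2 * p 1 + (1 + p 0) / 2) ((1 - p 0) / 2 * p 2) (argSub p (p 3) (p 4))) k

/-- The third homotopy. -/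
def homC (k : Fin 10) (p : Fin 11 → ℝ) : ℝ :=
  (![-p 1 - (1 - p 0) / 2 * p 3 - 1 + (1 + p 0) / 4, -((1 - p 0) / 2) * p 1 + p 3 + (1 + p 0) / 4,
    (1 - p 0) / 2 * p 2 + p 4, 2 * p 5, 2 * p 6, 2 * p 7, p 2 - (1 - p 0) / 2 * p 4,
    2 * p 8, 2 * p 9, 2 * p 10] : Fin 10 → ℝ) k

theorem IsDiskTwist.continuous_homA (hr : IsDiskTwist r) (k : Fin 10) : Continuous (homA r k) := by
  refine continuous_cmpFun (hr.continuous_comp (by fun_prop) (by fun_prop)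
      (continuous_argAdd (by fun_prop) (by fun_prop)))
    (hr.continuous_comp (by fun_prop) (by fun_prop)
      (continuous_argSub (by fun_prop) (by fun_prop))) k

theorem IsDiskTwist.continuous_homB (hr : IsDiskTwist r) (k : Fin 10) : Continuous (homB r k) := by
  refine continuous_cmpFun (hr.continuous_comp (by fun_prop) (by fun_prop)
      (continuous_argAdd (by fun_prop) (by fun_prop)))
    (hr.continuous_comp (by fun_prop) (by fun_prop)
      (continuous_argSub (by fun_prop) (by fun_prop))) k

theorem continuous_homC (k : Fin 10) : Continuous (homC k) := by
  unfold homC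
  fin_cases k <;> simp <;> fun_prop

theorem IsDiskTwist.homA_ne_zero (hr : IsDiskTwist r) {C : ℝ} (hC : 1 ≤ C) (p : Fin 11 → ℝ)
    (hp : ∀ i, |p i| ≤ boxWidth C i) (hi : ∃ i, i ≠ 0 ∧ |p i| = boxWidth C i) :
    ∃ k ∈ cmpIdx, homA r k p ≠ 0 := by
  by_contra! hz
  obtain ⟨i, hi0, hi⟩ := hi
  obtain ⟨hs, -⟩ := hr.interior_of_cmpFun_eq_zero hz
  obtain ⟨e0, -, -, -, -, e0', -⟩ := eq_of_cmpFun_eq_zero hz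
  have hT := abs_le.1 (hp 0)
  simp only [boxWidth, Matrix.cons_val_zero] at hT
  have hb : p 1 ^ 2 + p 2 ^ 2 < 1 := by
    by_contra! hb
    rw [hr.twist_zero _ _ _ hb] at e0 e0'
    have hn : 1 ≤ √(p 1 ^ 2 + p 2 ^ 2) := Real.one_le_sqrt.2 hb
    have hn2 : √(p 1 ^ 2 + p 2 ^ 2) * √(p 1 ^ 2 + p 2 ^ 2) = p 1 ^ 2 + p 2 ^ 2 :=
      Real.mul_self_sqrt (by linarith)
    generalize √(p 1 ^ 2 + p 2 ^ 2) = n at *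
    rw [div_eq_iff (by linarith)] at e0 e0'
    simp only [argAdd, argSub, vec5_zero, vec5_one] at e0 e0'
    have key : n * (1 / 2 + (1 - p 0) / 2 * (1 / 2) + (1 + p 0) / 2 * n) = 0 := by
      linear_combination (-1) * e0 + (1 - p 0) / 2 * e0' + (1 + p 0) / 2 * hn2
    have : 0 ≤ (1 + p 0) / 2 * n := by apply mul_nonneg <;> linarith
    nlinarith
  have h1 := one_le_sq_of_abs_eq hC hi
  generalize (1 - p 0) / 2 * p 3 - (1 + p 0) / 2 * p 1 = u at hs
  generalize (1 - p 0) / 2 * p 4 + (1 + p 0) / 2 * p 2 = v at hs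
  have H := fun j => sq_nonneg (p j)
  fin_cases i
  · exact hi0 rfl
  all_goals
    simp only [Fin.reduceFinMk] at h1
    linarith [H 1, H 2, H 3, H 4, H 5, H 6, H 7, H 8, H 9, H 10, sq_nonneg u, sq_nonneg v]

theorem IsDiskTwist.homB_ne_zero (hr : IsDiskTwist r) {C : ℝ} (hC : 1 ≤ C) (p : Fin 11 → ℝ)
    (hi : ∃ i, i ≠ 0 ∧ |p i| = boxWidth C i) : ∃ k ∈ cmpIdx, homB r k p ≠ 0 := by
  by_contra! hz
  obtain ⟨i, hi0, hi⟩ := hi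
  obtain ⟨hs, -⟩ := hr.interior_of_cmpFun_eq_zero hz
  have h1 := one_le_sq_of_abs_eq hC hi
  have H := fun j => sq_nonneg (p j)
  fin_cases i
  · exact hi0 rfl
  all_goals
    simp only [Fin.reduceFinMk] at h1
    linarith [H 1, H 2, H 3, H 4, H 5, H 6, H 7, H 8, H 9, H 10]

theorem homC_ne_zero {C : ℝ} (hC : 1 ≤ C) (p : Fin 11 → ℝ)
    (hi : ∃ i, i ≠ 0 ∧ |p i| = boxWidth C i) : ∃ k ∈ cmpIdx, homC k p ≠ 0 := by
  by_contra! hz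
  obtain ⟨i, hi0, hi⟩ := hi
  have h1 := one_le_sq_of_abs_eq hC hi
  simp [cmpIdx, homC] at hz
  obtain ⟨h0, h1', h2, h3, h4, h5, h6, h7, h8, h9⟩ := hz
  have hμ : 0 < 1 + ((1 - p 0) / 2) ^ 2 := by positivity
  have e1 : p 1 = -1 / 2 := by
    refine mul_left_cancel₀ hμ.ne' ?_
    linear_combination (-1) * h0 - (1 - p 0) / 2 * h1'
  have e3 : p 3 = -1 / 2 := by
    refine mul_left_cancel₀ hμ.ne' ?_
    linear_combination h1' - (1 - p 0) / 2 * h0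
  have e2 : p 2 = 0 := by
    refine mul_left_cancel₀ hμ.ne' ?_
    linear_combination h6 + (1 - p 0) / 2 * h2
  have e4 : p 4 = 0 := by
    refine mul_left_cancel₀ hμ.ne' ?_
    linear_combination h2 - (1 - p 0) / 2 * h6
  fin_cases i
  · exact hi0 rfl
  all_goals
    simp only [Fin.reduceFinMk] at h1
    simp only [e1, e2, e3, e4, h3, h4, h5, h7, h8, h9] at h1
    norm_num at h1

theorem IsDiskTwist.homA_eq_homB {p q : Fin 11 → ℝ} (hp : p 0 = 1) (hq : q 0 = -1)
    (h : ∀ i, i ≠ 0 → p i = q i) (k : Fin 10) : homA r k p = homB r k q := by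
  simp [homA, homB, argAdd, argSub, hp, hq, h]

theorem IsDiskTwist.homB_eq_homC (hr : IsDiskTwist r) {p q : Fin 11 → ℝ} (hp : p 0 = 1)
    (hq : q 0 = -1) (h : ∀ i, i ≠ 0 → p i = q i) (k : Fin 10) : homB r k p = homC k q := by
  have h1 : (1:ℝ) ≤ 1 ^ 2 + 0 ^ 2 := by norm_num
  simp only [homB, homC, hp, hq, cmpFun, sub_self, zero_div, zero_mul, zero_add, add_self_div_two,
    hr.twist_zero _ _ _ h1, hr.twist_one _ _ _ h1, hr.twist_two _ _ _ h1,
    hr.twist_three _ _ _ h1, hr.twist_four _ _ _ h1]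
  fin_cases k <;> simp [argAdd, argSub, h] <;> ring

theorem IsDiskTwist.exists_cupSum_eq_one (hr : IsDiskTwist r) {C : ℝ} (hC : 1 ≤ C) :
    ∃ m₀ : ℕ, ∀ m ≥ m₀, ∀ χ : Fin 10 → (Fin 11 → ℤ) → ZMod 2,
      (∀ k x, x 0 = 0 → SignLabel (χ k x) (homA r k (gridPos (boxWidth C) m x))) →
      cupSum m (cmpIdx.map χ) (Finset.univ.erase 0) 0 = 1 := by
  have hR : ∀ i, 0 ≤ boxWidth C i := fun i => zero_le_one.trans (one_le_boxWidth hC i)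
  obtain ⟨m₁, h₁⟩ := cupSum_homotopy hR 0 cmpIdx (homA r) (fun k _ => hr.continuous_homA k)
    (hr.homA_ne_zero hC)
  obtain ⟨m₂, h₂⟩ := cupSum_homotopy hR 0 cmpIdx (homB r) (fun k _ => hr.continuous_homB k)
    (fun p _ => hr.homB_ne_zero hC p)
  obtain ⟨m₃, h₃⟩ := cupSum_homotopy hR 0 cmpIdx homC (fun k _ => continuous_homC k)
    (fun p _ => homC_ne_zero hC p)
  refine ⟨max (max m₁ m₂) (max m₃ 1), fun m hm χ hχ => ?_⟩
  simp only [ge_iff_le, max_le_iff] at hm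
  obtain ⟨⟨hm₁, hm₂⟩, hm₃, hm₀⟩ := hm
  set top : (Fin 11 → ℤ) → (Fin 11 → ℝ) :=
    fun x => gridPos (boxWidth C) m (Function.update x 0 (2 * m)) with htop
  have top0 (x) : top x 0 = 1 := by
    rw [htop]; simp only []
    rw [gridPos_two_mul hm₀ (by simp)]; simp [boxWidth]
  have bot0 (x : Fin 11 → ℤ) (hx : x 0 = 0) : gridPos (boxWidth C) m x 0 = -1 := by
    rw [gridPos_zero hx]; simp [boxWidth]
  have htb (x : Fin 11 → ℤ) (i : Fin 11) (hi : i ≠ 0) : top x i = gridPos (boxWidth C) m x i := by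
    simp [htop, gridPos, hi]
  set lab : (Fin 10 → (Fin 11 → ℝ) → ℝ) → Fin 10 → (Fin 11 → ℤ) → ZMod 2 :=
    fun f k x => if 0 < f k (top x) then 1 else 0 with hlab
  have hsl (f : Fin 10 → (Fin 11 → ℝ) → ℝ) (k x) : SignLabel (lab f k x) (f k (top x)) :=
    signLabel_ite _
  rw [h₁ m hm₁ χ (lab (homA r)) (fun k _ x hx => hχ k x hx) (fun k _ x _ => hsl _ k x),
    h₂ m hm₂ (lab (homA r)) (lab (homB r)) (fun k _ x hx => by
      rw [← IsDiskTwist.homA_eq_homB (top0 x) (bot0 x hx) (htb x) k]; exact hsl _ k x)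
      (fun k _ x _ => hsl _ k x),
    h₃ m hm₃ (lab (homB r)) (lab homC) (fun k _ x hx => by
      rw [← hr.homB_eq_homC (top0 x) (bot0 x hx) (htb x) k]; exact hsl _ k x)
      (fun k _ x _ => hsl _ k x)]
  have hset : (Finset.univ.erase 0 : Finset (Fin 11)) =
      (cmpIdx.map (![1, 3, 4, 5, 6, 7, 2, 8, 9, 10] : Fin 10 → Fin 11)).toFinset := by decide
  have hval (k x) : homC k (top x) =
      (![-1 / 2, 1 / 2, 0, 0, 0, 0, 0, 0, 0, 0] : Fin 10 → ℝ) k +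
      (![-1, 1, 1, 2, 2, 2, 1, 2, 2, 2] : Fin 10 → ℝ) k * gridPos (boxWidth C) m x
        ((![1, 3, 4, 5, 6, 7, 2, 8, 9, 10] : Fin 10 → Fin 11) k) := by
    unfold homC
    fin_cases k <;> simp [top0, htb] <;> ring
  rw [hset]
  refine cupSum_eq_one m _ _ _ (by decide) (fun k _ x y h => ?_) (fun k _ x y hx hy => ?_) 0
    (by simp)
  · have e : homC k (top x) = homC k (top y) := by rw [hval, hval, gridPos, gridPos, h]
    simp only [hlab, e]
  · simp only [hlab, hval]
    rw [gridPos_two_mul hm₀ hx, gridPos_zero hy]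
    fin_cases k <;> simp [boxWidth]
    · norm_num
    all_goals rw [if_pos (by linarith), if_neg (by linarith), add_zero]

end DiskTwist

section NoDiskTwist

variable {r : ℝ → ℝ → EucA 5 → EucA 5}

/-- The deformation of the comparison function in terms of its arguments. -/
def antVec (t d₂ d₃ d₄ : ℝ) (a a' y : EucA 5) : Fin 10 → ℝ :=
  ![a 0 - a' 0 - 1, (1 - t) / 2 * (a 0 + a' 0) + (1 + t) * y 0,
    (1 - t) / 2 * (a 1 + a' 1) + (1 + t) * y 1, (1 - t) / 2 * (a 2 + a' 2) + (1 + t) * y 2,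
    (1 - t) / 2 * (a 3 + a' 3) + (1 + t) * y 3, (1 - t) / 2 * (a 4 + a' 4) + (1 + t) * y 4,
    (1 - t) / 2 * (a 1 - a' 1), (1 - t) / 2 * (a 2 - a' 2) + (1 + t) * d₂,
    (1 - t) / 2 * (a 3 - a' 3) + (1 + t) * d₃, (1 - t) / 2 * (a 4 - a' 4) + (1 + t) * d₄]

theorem continuous_antVec {X : Type*} [TopologicalSpace X] {t d₂ d₃ d₄ : X → ℝ}
    {a a' y : X → EucA 5} (ht : Continuous t) (h₂ : Continuous d₂) (h₃ : Continuous d₃)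
    (h₄ : Continuous d₄) (ha : Continuous a) (ha' : Continuous a') (hy : Continuous y)
    (k : Fin 10) : Continuous fun x => antVec (t x) (d₂ x) (d₃ x) (d₄ x) (a x) (a' x) (y x) k := by
  have h (i : Fin 5) : Continuous fun x => a x i := by fun_prop
  have h' (i : Fin 5) : Continuous fun x => a' x i := by fun_prop
  have h'' (i : Fin 5) : Continuous fun x => y x i := by fun_prop
  have hs (i : Fin 5) : Continuous fun x => (1 - t x) / 2 * (a x i + a' x i) + (1 + t x) * y x i :=
    (((continuous_const.sub ht).div_const 2).mul ((h i).add (h' i))).add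
      ((continuous_const.add ht).mul (h'' i))
  have hd (i : Fin 5) : Continuous fun x => (1 - t x) / 2 * (a x i - a' x i) :=
    ((continuous_const.sub ht).div_const 2).mul ((h i).sub (h' i))
  fin_cases k
  exacts [((h 0).sub (h' 0)).sub continuous_const, hs 0, hs 1, hs 2, hs 3, hs 4, hd 1,
    (hd 2).add ((continuous_const.add ht).mul h₂), (hd 3).add ((continuous_const.add ht).mul h₃),
    (hd 4).add ((continuous_const.add ht).mul h₄)]

/-- The deformation of the comparison function used for the antipodal symmetry. -/
def antFun (r : ℝ → ℝ → EucA 5 → EucA 5) (k : Fin 10) (p : Fin 11 → ℝ) : ℝ :=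
  antVec (p 0) (p 8) (p 9) (p 10) (r (p 1) (p 2) (argAdd p (p 3) (p 4)))
    (r (p 1) (p 2) (argSub p (p 3) (p 4))) (r (p 1) (p 2) (vec5 (p 3) (p 4) (p 5) (p 6) (p 7))) k

theorem IsDiskTwist.continuous_antFun (hr : IsDiskTwist r) (k : Fin 10) :
    Continuous (antFun r k) := by
  have h (i : Fin 11) : Continuous fun p : Fin 11 → ℝ => p i := continuous_apply i
  exact continuous_antVec (h 0) (h 8) (h 9) (h 10)
    (hr.continuous_comp (h 1) (h 2) (continuous_argAdd (h 3) (h 4)))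
    (hr.continuous_comp (h 1) (h 2) (continuous_argSub (h 3) (h 4)))
    (hr.continuous_comp (h 1) (h 2) (continuous_vec5 (h 3) (h 4) (h 5) (h 6) (h 7))) k

/-- The coordinates reversed by the antipodal symmetry. -/
def antIdx : Finset (Fin 11) := {8, 9, 10}

theorem antFun_coordReflect_eq (k : Fin 10) (p : Fin 11 → ℝ) :
    antFun r k (coordReflect antIdx p) =
      antVec (p 0) (-p 8) (-p 9) (-p 10) (r (p 1) (p 2) (argSub p (p 3) (p 4)))
        (r (p 1) (p 2) (argAdd p (p 3) (p 4)))
        (r (p 1) (p 2) (vec5 (p 3) (p 4) (p 5) (p 6) (p 7))) k := by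
  have h1 (u v : ℝ) : argAdd (coordReflect antIdx p) u v = argSub p u v := by
    simp [argAdd, argSub, coordReflect, antIdx, sub_eq_add_neg]
  have h2 (u v : ℝ) : argSub (coordReflect antIdx p) u v = argAdd p u v := by
    simp [argAdd, argSub, coordReflect, antIdx]
  unfold antFun
  rw [h1, h2]
  simp [coordReflect, antIdx]

theorem antFun_coordReflect (k : Fin 10) (hk : k ∈ cmpIdx.tail) (p : Fin 11 → ℝ) :
    antFun r k (coordReflect antIdx p) = if 6 ≤ k then - antFun r k p else antFun r k p := by
  rw [antFun_coordReflect_eq, antFun]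
  generalize r (p 1) (p 2) (argSub p (p 3) (p 4)) = a'
  generalize r (p 1) (p 2) (argAdd p (p 3) (p 4)) = a
  generalize r (p 1) (p 2) (vec5 (p 3) (p 4) (p 5) (p 6) (p 7)) = y
  fin_cases k
  · simp [cmpIdx] at hk
  all_goals first | (simp [antVec]; ring1) | (simp [antVec]; left; ring1)

theorem antFun_zero_coordReflect (p : Fin 11 → ℝ) :
    antFun r 0 (coordReflect antIdx p) = - 2 - antFun r 0 p := by
  rw [antFun_coordReflect_eq, antFun]
  simp [antVec]
  ring

/-- The tie-breaking rule on the grid. -/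
def antTie (m : ℕ) (x : Fin 11 → ℤ) : Prop :=
  (m : ℤ) < x 8 ∨ (x 8 = m ∧ ((m : ℤ) < x 9 ∨ (x 9 = m ∧ (m : ℤ) < x 10)))

theorem antTie_boxReflect (m : ℕ) (x : Fin 11 → ℤ) (h : ∃ i ∈ antIdx, x i ≠ (m : ℤ)) :
    antTie m (boxReflect m antIdx x) ↔ ¬ antTie m x := by
  simp [antIdx] at h
  simp [antTie, boxReflect, antIdx]
  omega

theorem antFun_eq_homA {p : Fin 11 → ℝ} (hp : p 0 = -1) (k : Fin 10) :
    antFun r k p = homA r k p := by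
  unfold antFun homA cmpFun antVec
  fin_cases k <;> simp [hp]

theorem coord_of_antIdx {C : ℝ} {p : Fin 11 → ℝ} (h : ∃ i ∈ antIdx, p i = boxWidth C i) :
    1 ≤ p 8 ^ 2 + p 9 ^ 2 + p 10 ^ 2 := by
  obtain ⟨i, hi, h⟩ := h
  simp [antIdx] at hi
  rcases hi with rfl | rfl | rfl <;> simp [boxWidth] at h <;> rw [h] <;>
    nlinarith [sq_nonneg (p 8), sq_nonneg (p 9), sq_nonneg (p 10)]

theorem IsDiskTwist.antFun_boundary (hr : IsDiskTwist r) {C : ℝ} (hC : 1 ≤ C)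
    (hclose : ∀ b c Y δ, |b| ≤ 1 → |c| ≤ 1 → C ≤ ‖Y‖ → ‖δ‖ ≤ 2 →
      ‖r b c (Y + δ) - r b c Y‖ < ‖Y‖) (p : Fin 11 → ℝ)
    (hp : ∀ i, |p i| ≤ boxWidth C i) (hi : ∃ i, i ≠ 0 ∧ i ∉ antIdx ∧ |p i| = boxWidth C i)
    (hz : ∀ k ∈ cmpIdx.tail, antFun r k p = 0) :
    antFun r 0 p < 0 ∧ p 8 = 0 ∧ p 9 = 0 ∧ p 10 = 0 := by
  obtain ⟨i, hi0, hiJ, hi⟩ := hi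
  have hT := abs_le.1 (hp 0)
  simp only [boxWidth, Matrix.cons_val_zero] at hT
  simp only [cmpIdx, List.tail, List.mem_cons, List.not_mem_nil, or_false, forall_eq_or_imp,
    forall_eq] at hz
  obtain ⟨z1, z2, z3, z4, z5, z6, z7, z8, z9⟩ := hz
  by_cases hb : 1 ≤ p 1 ^ 2 + p 2 ^ 2
  · have hn : 1 ≤ √(p 1 ^ 2 + p 2 ^ 2) := Real.one_le_sqrt.2 hb
    have hn0 : 0 < √(p 1 ^ 2 + p 2 ^ 2) := by linarith
    simp only [antFun, antVec, hr.twist_zero _ _ _ hb, hr.twist_one _ _ _ hb, hr.twist_two _ _ _ hb,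
      hr.twist_three _ _ _ hb, hr.twist_four _ _ _ hb, argAdd, argSub] at *
    generalize √(p 1 ^ 2 + p 2 ^ 2) = n at *
    simp at z7 z8 z9
    refine ⟨by simp, ?_, ?_, ?_⟩ <;> linarith
  · exfalso
    push Not at hb
    have hbw : |p 1| ≤ 1 ∧ |p 2| ≤ 1 := ⟨hp 1, hp 2⟩
    have hY : C ≤ ‖vec5 (p 3) (p 4) (p 5) (p 6) (p 7)‖ := by
      refine le_of_sq_le_sq ?_ (norm_nonneg _)
      rw [norm_sq_eucA5]
      simp only [vec5_zero, vec5_one, vec5_two, vec5_three, vec5_four]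
      have h1 := one_le_sq_of_abs_eq hC hi
      have h2 : p i ^ 2 = boxWidth C i ^ 2 := by rw [← hi, sq_abs]
      have H := fun j => sq_nonneg (p j)
      simp only [boxWidth] at h2
      simp [antIdx] at hiJ
      fin_cases i
      · simp at hi0
      all_goals
        simp at hiJ
      all_goals
        simp only [Fin.reduceFinMk] at h1 h2
        simp only [Matrix.cons_val] at h2
        linarith [H 1, H 2, H 3, H 4, H 5, H 6, H 7]
    set Y := vec5 (p 3) (p 4) (p 5) (p 6) (p 7) with hYdef
    set δ := vec5 0 0 (p 8) (p 9) (p 10) with hδ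
    have hδ2 : ‖δ‖ ≤ 2 := by
      refine abs_le_of_sq_le_sq' ?_ (by norm_num) |>.2
      rw [norm_sq_eucA5]
      have h8 := abs_le.1 (hp 8)
      have h9 := abs_le.1 (hp 9)
      have h10 := abs_le.1 (hp 10)
      simp [boxWidth] at h8 h9 h10
      simp [hδ]; nlinarith
    have e1 : argAdd p (p 3) (p 4) = Y + δ := by
      ext j; fin_cases j <;> simp [argAdd, hYdef, hδ]
    have e2 : argSub p (p 3) (p 4) = Y + (-δ) := by
      ext j; fin_cases j <;> simp [argSub, hYdef, hδ, sub_eq_add_neg]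
    have c1 := hclose _ _ Y δ hbw.1 hbw.2 hY hδ2
    have c2 := hclose _ _ Y (-δ) hbw.1 hbw.2 hY (by rwa [norm_neg])
    rw [← e1] at c1
    rw [← e2] at c2
    simp only [antFun, antVec, ← hYdef] at z1 z2 z3 z4 z5
    set a := r (p 1) (p 2) (argAdd p (p 3) (p 4))
    set a' := r (p 1) (p 2) (argSub p (p 3) (p 4))
    have hy := hr.norm_eq (p 1) (p 2) Y
    set y := r (p 1) (p 2) Y
    have e3 : (2:ℝ) • y = -(((1 - p 0) / 2) • ((a - y) + (a' - y))) := by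
      simp at z1 z2 z3 z4 z5
      ext j; fin_cases j <;> simp <;> linarith
    have e4 := congrArg norm e3
    rw [norm_neg, norm_smul, norm_smul, Real.norm_of_nonneg zero_le_two,
      Real.norm_of_nonneg (by linarith), hy] at e4
    have e5 := norm_add_le (a - y) (a' - y)
    have e6 : (1 - p 0) / 2 * ‖a - y + (a' - y)‖ ≤ 1 * ‖a - y + (a' - y)‖ := by
      gcongr; linarith
    linarith

/-- There is no disk twist of `ℝ⁵`: the nontrivial loop of rotations cannot be extended over the
disk by a family of homogeneous norm preserving maps. -/
theorem IsDiskTwist.false (hr : IsDiskTwist r) : False := by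
  obtain ⟨C, hC, hclose⟩ := hr.exists_close
  have hR : ∀ i, 0 ≤ boxWidth C i := fun i => zero_le_one.trans (one_le_boxWidth hC i)
  have hR0 : boxWidth C 0 = 1 := rfl
  obtain ⟨m₁, h₁⟩ := hr.exists_cupSum_eq_one hC
  obtain ⟨m₂, h₂⟩ := cupSum_eq_zero_of_antipodal hR (τ := 0) (J := antIdx) (by decide) (0 : Fin 10)
    cmpIdx.tail (antFun r) hr.continuous_antFun (fun k => decide (6 ≤ k))
    (fun k hk p => by simpa using antFun_coordReflect k hk p) antTie
    (fun m _ x h => antTie_boxReflect m x h)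
    (fun p hp _ hi hg => by
      by_contra! hz
      exact absurd (hr.antFun_boundary hC hclose p hp hi hz).1 (not_lt.2 hg))
    (fun p hp h0 hi hg hg' => by
      by_contra! hz
      rw [antFun_zero_coordReflect] at hg'
      rw [hR0] at h0
      have hd := coord_of_antIdx hi
      have hn1 := hr.norm_eq (p 1) (p 2) (argAdd p (p 3) (p 4))
      have hn2 := hr.norm_eq (p 1) (p 2) (argSub p (p 3) (p 4))
      have hn1 := congrArg (· ^ 2) hn1
      have hn2 := congrArg (· ^ 2) hn2
      simp only [norm_sq_eucA5, argAdd, argSub, vec5_zero, vec5_one, vec5_two, vec5_three,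
        vec5_four] at hn1 hn2
      simp [cmpIdx, antFun, antVec, argAdd, argSub, h0] at hz hg hg'
      generalize r (p 1) (p 2) (vec5 (p 3) (p 4) (p 5 + p 8) (p 6 + p 9) (p 7 + p 10)) = a at *
      generalize r (p 1) (p 2) (vec5 (p 3) (p 4) (p 5 - p 8) (p 6 - p 9) (p 7 - p 10)) = a' at *
      obtain ⟨z1, z2, z3, z4, z5, z6, z7, z8, z9⟩ := hz
      have e1 : a 1 = 0 := by linarith
      have e2 : a 2 = 0 := by linarith
      have e3 : a 3 = 0 := by linarith
      have e4 : a 4 = 0 := by linarith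
      have e5 : a' 0 = - a 0 := by linarith
      have e6 : a' 1 = 0 := by linarith
      have e7 : a' 2 = 0 := by linarith
      have e8 : a' 3 = 0 := by linarith
      have e9 : a' 4 = 0 := by linarith
      rw [e1, e2, e3, e4] at hn1
      rw [e5, e6, e7, e8, e9] at hn2
      rw [e5] at hg hg'
      have hq : a 0 ^ 2 ≤ 1 / 4 := by nlinarith
      nlinarith [sq_nonneg (p 3), sq_nonneg (p 4), sq_nonneg (p 5), sq_nonneg (p 6),
        sq_nonneg (p 7)])
    (fun p h h' => by rw [antFun_zero_coordReflect] at h'; linarith)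
    (fun p hp h0 hi => by
      by_contra! hz
      have hd := coord_of_antIdx hi
      rw [hR0] at h0
      simp [cmpIdx, antFun, antVec, h0] at hz
      obtain ⟨-, -, -, -, -, z7, z8, z9⟩ := hz
      rw [z7, z8, z9] at hd
      norm_num at hd)
    (fun p hp hi hi' => by
      by_contra! hz
      have hd := coord_of_antIdx hi'
      obtain ⟨-, z7, z8, z9⟩ := hr.antFun_boundary hC hclose p hp hi hz
      rw [z7, z8, z9] at hd
      norm_num at hd)
  obtain ⟨χ, hχ, hsum⟩ := h₂ (max m₁ m₂) (le_max_right _ _)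
  have := h₁ (max m₁ m₂) (le_max_left _ _) χ (fun k x hx => by
    rw [← antFun_eq_homA (by rw [gridPos_zero hx, hR0])]; exact hχ k x)
  change cupSum _ (((0 : Fin 10) :: cmpIdx.tail).map χ) _ _ = 1 at this
  rw [hsum] at this
  exact absurd this (by decide)

end NoDiskTwist

section JoinMap

theorem norm_sq_eucA6 (x : EucA 6) :
    ‖x‖ ^ 2 = x 0 ^ 2 + x 1 ^ 2 + x 2 ^ 2 + x 3 ^ 2 + x 4 ^ 2 + x 5 ^ 2 := by
  rw [EuclideanSpace.norm_sq_eq, Fin.sum_univ_six]; simp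

/-- The vector of `ℝ⁶` with the given coordinates. -/
def vec6 (a b c d e f : ℝ) : EucA 6 := !₂[a, b, c, d, e, f]

@[simp] theorem vec6_zero (a b c d e f : ℝ) : vec6 a b c d e f 0 = a := rfl
@[simp] theorem vec6_one (a b c d e f : ℝ) : vec6 a b c d e f 1 = b := rfl
@[simp] theorem vec6_two (a b c d e f : ℝ) : vec6 a b c d e f 2 = c := rfl
@[simp] theorem vec6_three (a b c d e f : ℝ) : vec6 a b c d e f 3 = d := rfl
@[simp] theorem vec6_four (a b c d e f : ℝ) : vec6 a b c d e f 4 = e := rfl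
@[simp] theorem vec6_five (a b c d e f : ℝ) : vec6 a b c d e f 5 = f := rfl

/-- The join of `S¹` and `S³` (with coordinates `ζ` and `w = (z, u)`) mapped to the suspension
`S⁴` of `S³` by the action of `S¹` on the first factor of `S³ ⊆ ℂ × ℂ`, extended homogeneously. -/
def joinMap (e : EucA 6) : EucA 5 :=
  (‖e‖ ^ 2)⁻¹ • vec5 (2 * (e 0 * e 2 - e 1 * e 3)) (2 * (e 0 * e 3 + e 1 * e 2))
    (2 * √(e 0 ^ 2 + e 1 ^ 2) * e 4) (2 * √(e 0 ^ 2 + e 1 ^ 2) * e 5)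
    (e 2 ^ 2 + e 3 ^ 2 + e 4 ^ 2 + e 5 ^ 2 - e 0 ^ 2 - e 1 ^ 2)

theorem norm_joinMap {e : EucA 6} (he : e ≠ 0) : ‖joinMap e‖ = 1 := by
  have h0 : 0 < ‖e‖ ^ 2 := by positivity
  have hs : √(e 0 ^ 2 + e 1 ^ 2) ^ 2 = e 0 ^ 2 + e 1 ^ 2 := Real.sq_sqrt (by positivity)
  have hv : ‖vec5 (2 * (e 0 * e 2 - e 1 * e 3)) (2 * (e 0 * e 3 + e 1 * e 2))
    (2 * √(e 0 ^ 2 + e 1 ^ 2) * e 4) (2 * √(e 0 ^ 2 + e 1 ^ 2) * e 5)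
    (e 2 ^ 2 + e 3 ^ 2 + e 4 ^ 2 + e 5 ^ 2 - e 0 ^ 2 - e 1 ^ 2)‖ = ‖e‖ ^ 2 := by
    rw [← sq_eq_sq₀ (norm_nonneg _) h0.le, norm_sq_eucA5, norm_sq_eucA6]
    simp only [vec5_zero, vec5_one, vec5_two, vec5_three, vec5_four]
    linear_combination (4 * e 4 ^ 2 + 4 * e 5 ^ 2) * hs
  rw [joinMap, norm_smul, hv, norm_inv, Real.norm_of_nonneg h0.le, inv_mul_cancel₀ h0.ne']

theorem joinMap_smul {l : ℝ} (hl : 0 < l) (e : EucA 6) : joinMap (l • e) = joinMap e := by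
  have hs : √((l * e 0) ^ 2 + (l * e 1) ^ 2) = l * √(e 0 ^ 2 + e 1 ^ 2) := by
    rw [mul_pow, mul_pow, ← mul_add, Real.sqrt_mul (by positivity), Real.sqrt_sq hl.le]
  simp only [joinMap, norm_smul, PiLp.smul_apply, smul_eq_mul, hs, Real.norm_of_nonneg hl.le]
  have hl2 : l ^ 2 ≠ 0 := by positivity
  rw [mul_pow, mul_inv_rev, mul_smul]
  congr 1
  rw [inv_smul_eq_iff₀ hl2]
  ext i
  fin_cases i <;> simp <;> ring

theorem continuousAt_joinMap {e : EucA 6} (he : e ≠ 0) : ContinuousAt joinMap e := by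
  have h0 : ‖e‖ ^ 2 ≠ 0 := by positivity
  unfold joinMap
  have h1 : ContinuousAt (fun e : EucA 6 => (‖e‖ ^ 2)⁻¹) e :=
    ContinuousAt.inv₀ (f := fun e : EucA 6 => ‖e‖ ^ 2) (by fun_prop) h0
  refine h1.smul (Continuous.continuousAt ?_)
  apply continuous_vec5 <;> fun_prop

theorem continuousOn_joinMap : ContinuousOn joinMap {0}ᶜ :=
  fun _ he => (continuousAt_joinMap he).continuousWithinAt

theorem SphereNullhomotopic.exists_extension {d₁ d₂ : ℕ} {f : EucA d₁ → EucA d₂}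
    (h : SphereNullhomotopic f) : ∃ G : EucA d₁ → EucA d₂, Continuous G ∧ (∀ v, ‖G v‖ = 1) ∧
      ∀ v, 1 / 2 ≤ ‖v‖ → G v = f (‖v‖⁻¹ • v) := by
  classical
  obtain ⟨y, hy, H, hH, hmap, h0, h1⟩ := h
  set t : EucA d₁ → ℝ := fun v => max 0 (min 1 (2 - 4 * ‖v‖)) with ht
  have htc : Continuous t := by fun_prop
  have htm (v) : t v ∈ Icc (0:ℝ) 1 := ⟨le_max_left _ _, max_le zero_le_one (min_le_left _ _)⟩
  have hsph {v : EucA d₁} (hv : v ≠ 0) : ‖v‖⁻¹ • v ∈ usph d₁ := by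
    simp [usph, norm_smul, hv]
  refine ⟨fun v => if v = 0 then y else H (t v) (‖v‖⁻¹ • v), ?_, fun v => ?_, fun v hv => ?_⟩
  · rw [continuous_iff_continuousAt]
    intro v
    by_cases hv : v = 0
    · refine (continuousAt_const (y := y)).congr ?_
      rw [hv]
      filter_upwards [Metric.ball_mem_nhds (0 : EucA d₁) (show (0:ℝ) < 1 / 4 by norm_num)] with w hw
      rw [mem_ball_zero_iff] at hw
      by_cases hw0 : w = 0
      · simp [hw0]
      · have : t w = 1 := by simp only [ht]; rw [min_eq_left (by linarith)]; simp
        rw [if_neg hw0, this]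
        exact (h1 (hsph hw0)).symm
    · have hne : ∀ᶠ w in nhds v, w ≠ 0 := isOpen_ne.mem_nhds hv
      have hco : ContinuousOn (fun w => H (t w) (‖w‖⁻¹ • w)) {0}ᶜ := by
        refine hH.comp (f := fun w : EucA d₁ => (t w, ‖w‖⁻¹ • w)) ?_
          (fun w hw => ⟨htm w, hsph hw⟩)
        have hinv : ContinuousOn (fun w : EucA d₁ => ‖w‖⁻¹) {0}ᶜ :=
          continuous_norm.continuousOn.inv₀ fun w hw => by simpa using hw
        exact htc.continuousOn.prodMk (hinv.smul continuousOn_id)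
      refine (hco.continuousAt hne).congr ?_
      filter_upwards [hne] with w hw
      rw [if_neg hw]
  · by_cases hv : v = 0
    · simpa [hv, usph] using hy
    · simp only [if_neg hv]
      simpa [usph] using hmap _ (htm v) (hsph hv)
  · have hv0 : v ≠ 0 := by rintro rfl; norm_num at hv
    have : t v = 0 := by
      simp only [ht]
      exact max_eq_left ((min_le_right _ _).trans (by linarith))
    simp only [if_neg hv0, this]
    exact h0 (hsph hv0)

theorem exists_joinMap_extension {L M : EucA 6 →L[ℝ] EucA 6} (hLM : ∀ v, L (M v) = v)
    (h : SphereNullhomotopic fun x => joinMap (L x)) : ∃ G : EucA 6 → EucA 5, Continuous G ∧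
      (∀ v, ‖G v‖ = 1) ∧ ∀ v, 1 / 2 ≤ ‖v‖ → G v = joinMap v := by
  obtain ⟨G, hG, hn, he⟩ := h.exists_extension
  have hK : 0 < ‖L‖ + 1 := by positivity
  refine ⟨fun v => G ((‖L‖ + 1) • M v), by fun_prop, fun v => hn _, fun v hv => ?_⟩
  have h1 : ‖v‖ ≤ ‖L‖ * ‖M v‖ := by
    simpa only [hLM] using L.le_opNorm (M v)
  have h2 : 1 / 2 ≤ ‖(‖L‖ + 1) • M v‖ := by
    rw [norm_smul, Real.norm_of_nonneg hK.le]
    nlinarith [norm_nonneg (M v)]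
  have h3 : 0 < ‖(‖L‖ + 1) • M v‖⁻¹ := inv_pos.2 (by linarith)
  simp only []
  rw [he _ h2, map_smul, map_smul, hLM, joinMap_smul h3, joinMap_smul hK]

end JoinMap

section TwistOfExtension

/-- The product of complex numbers in coordinates, real and imaginary part, completed to the
unnormalized explicit formula of the disk twist over the exterior of the unit disk. -/
def outVec (β γ ρ : ℝ) (Y : EucA 5) : EucA 5 :=
  (ρ / ((β ^ 2 + γ ^ 2) * (ρ - Y 4) + (ρ + Y 4))) •
    vec5 (2 * (β * Y 0 - γ * Y 1)) (2 * (β * Y 1 + γ * Y 0)) (2 * √(β ^ 2 + γ ^ 2) * Y 2)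
      (2 * √(β ^ 2 + γ ^ 2) * Y 3) ((ρ + Y 4) - (β ^ 2 + γ ^ 2) * (ρ - Y 4))

/-- The point of `ℝ⁶` over which the twist is given by the extension of `joinMap`. -/
def innerArg (β γ ρ : ℝ) (Y : EucA 5) : EucA 6 :=
  vec6 (β * √((ρ - Y 4) / (2 * ρ))) (γ * √((ρ - Y 4) / (2 * ρ)))
    (Y 0 / √(2 * ρ * (ρ - Y 4))) (Y 1 / √(2 * ρ * (ρ - Y 4)))
    (Y 2 / √(2 * ρ * (ρ - Y 4))) (Y 3 / √(2 * ρ * (ρ - Y 4)))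

theorem norm_sq_innerArg {β γ : ℝ} {Y : EucA 5} (h : Y 4 < ‖Y‖) :
    ‖innerArg β γ ‖Y‖ Y‖ ^ 2 =
      ((β ^ 2 + γ ^ 2) * (‖Y‖ - Y 4) + (‖Y‖ + Y 4)) / (2 * ‖Y‖) := by
  have hρ : 0 < ‖Y‖ := by
    rcases (norm_nonneg Y).eq_or_lt with h0 | h0
    · rw [norm_eq_zero.1 h0.symm] at h; simp at h
    · exact h0
  have hY := norm_sq_eucA5 Y
  set ρ := ‖Y‖
  have hd : 0 < ρ - Y 4 := by linarith
  have h1 : √((ρ - Y 4) / (2 * ρ)) ^ 2 = (ρ - Y 4) / (2 * ρ) := Real.sq_sqrt (by positivity)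
  have h2 : √(2 * ρ * (ρ - Y 4)) ^ 2 = 2 * ρ * (ρ - Y 4) := Real.sq_sqrt (by positivity)
  rw [norm_sq_eucA6]
  simp only [innerArg, vec6_zero, vec6_one, vec6_two, vec6_three, vec6_four, vec6_five, mul_pow,
    div_pow, h1, h2]
  field_simp
  linear_combination (-1) * hY

theorem joinMap_innerArg {β γ : ℝ} {Y : EucA 5} (h : Y 4 < ‖Y‖) :
    ‖Y‖ • joinMap (innerArg β γ ‖Y‖ Y) = outVec β γ ‖Y‖ Y := by
  have hN := norm_sq_innerArg (β := β) (γ := γ) h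
  have hρ : 0 < ‖Y‖ := by
    rcases (norm_nonneg Y).eq_or_lt with h0 | h0
    · rw [norm_eq_zero.1 h0.symm] at h; simp at h
    · exact h0
  have hY := norm_sq_eucA5 Y
  rw [joinMap, hN, outVec, inv_div, smul_smul]
  set ρ := ‖Y‖
  have hd : 0 < ρ - Y 4 := by linarith
  set D := (β ^ 2 + γ ^ 2) * (ρ - Y 4) + (ρ + Y 4)
  have h1 : √((ρ - Y 4) / (2 * ρ)) ^ 2 = (ρ - Y 4) / (2 * ρ) := Real.sq_sqrt (by positivity)
  have h2 : √(2 * ρ * (ρ - Y 4)) ^ 2 = 2 * ρ * (ρ - Y 4) := Real.sq_sqrt (by positivity)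
  have h3 : √((ρ - Y 4) / (2 * ρ)) / √(2 * ρ * (ρ - Y 4)) = 1 / (2 * ρ) := by
    rw [← Real.sqrt_div (by positivity),
      show (ρ - Y 4) / (2 * ρ) / (2 * ρ * (ρ - Y 4)) = (1 / (2 * ρ)) ^ 2 by field_simp; try ring]
    exact Real.sqrt_sq (by positivity)
  have h4 : √((innerArg β γ ρ Y) 0 ^ 2 + (innerArg β γ ρ Y) 1 ^ 2) =
      √(β ^ 2 + γ ^ 2) * √((ρ - Y 4) / (2 * ρ)) := by
    simp only [innerArg, vec6_zero, vec6_one, mul_pow]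
    rw [← add_mul, Real.sqrt_mul (by positivity), Real.sqrt_sq (by positivity)]
  rw [h4, mul_div_assoc' ρ, show ρ * (2 * ρ) / D = (ρ / D) * (2 * ρ) by ring, mul_smul]
  congr 1
  have h5 : 2 * ρ * (√((ρ - Y 4) / (2 * ρ)) / √(2 * ρ * (ρ - Y 4))) = 1 := by rw [h3]; field_simp
  ext i
  fin_cases i
  · simp [innerArg]
    linear_combination (2 * (β * Y 0 - γ * Y 1)) * h5
  · simp [innerArg]
    linear_combination (2 * (β * Y 1 + γ * Y 0)) * h5
  · simp [innerArg]
    linear_combination (2 * √(β ^ 2 + γ ^ 2) * Y 2) * h5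
  · simp [innerArg]
    linear_combination (2 * √(β ^ 2 + γ ^ 2) * Y 3) * h5
  · simp [innerArg, mul_pow, div_pow, h1, h2]
    field_simp
    linear_combination (-1) * hY

/-- The disk twist obtained from an extension `G` of `joinMap`, over the unit disk. -/
def twistOf (G : EucA 6 → EucA 5) (β γ : ℝ) (Y : EucA 5) : EucA 5 :=
  if 5 / 4 * ‖Y‖ ≤ (β ^ 2 + γ ^ 2) * (‖Y‖ - Y 4) + (‖Y‖ + Y 4) then outVec β γ ‖Y‖ Y
    else ‖Y‖ • G (innerArg β γ ‖Y‖ Y)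

theorem abs_coord_le_norm (Y : EucA 5) : |Y 4| ≤ ‖Y‖ := by
  simpa using PiLp.norm_apply_le Y 4

theorem outVec_eq {G : EucA 6 → EucA 5} (he : ∀ v, 1 / 2 ≤ ‖v‖ → G v = joinMap v)
    {β γ : ℝ} {Y : EucA 5}
    (h : ‖Y‖ < (β ^ 2 + γ ^ 2) * (‖Y‖ - Y 4) + (‖Y‖ + Y 4))
    (h' : (β ^ 2 + γ ^ 2) * (‖Y‖ - Y 4) + (‖Y‖ + Y 4) < 3 / 2 * ‖Y‖) :
    outVec β γ ‖Y‖ Y = ‖Y‖ • G (innerArg β γ ‖Y‖ Y) := by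
  have habs := abs_le.1 (abs_coord_le_norm Y)
  have hp : 0 ≤ (β ^ 2 + γ ^ 2) * (‖Y‖ - Y 4) := mul_nonneg (by positivity) (by linarith)
  have hlt : Y 4 < ‖Y‖ := by linarith
  have hY : 0 < ‖Y‖ := by linarith [norm_nonneg Y]
  rw [he _ ?_, joinMap_innerArg hlt]
  refine abs_le_of_sq_le_sq' ?_ (norm_nonneg _) |>.2
  rw [norm_sq_innerArg hlt, le_div_iff₀ (by linarith)]
  linarith

theorem norm_twistOf {G : EucA 6 → EucA 5} (hn : ∀ v, ‖G v‖ = 1) {β γ : ℝ}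
    (Y : EucA 5) : ‖twistOf G β γ Y‖ = ‖Y‖ := by
  unfold twistOf
  split_ifs with h
  · rcases (norm_nonneg Y).eq_or_lt with h0 | h0
    · simp [outVec, ← h0]
    have hD : 0 < (β ^ 2 + γ ^ 2) * (‖Y‖ - Y 4) + (‖Y‖ + Y 4) := by linarith
    have hY := norm_sq_eucA5 Y
    rw [outVec, norm_smul, norm_div, Real.norm_of_nonneg hD.le, norm_norm]
    have hs : √(β ^ 2 + γ ^ 2) ^ 2 = β ^ 2 + γ ^ 2 := Real.sq_sqrt (by positivity)
    set ρ := ‖Y‖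
    set D := (β ^ 2 + γ ^ 2) * (ρ - Y 4) + (ρ + Y 4) with hDdef
    have hv : ‖vec5 (2 * (β * Y 0 - γ * Y 1)) (2 * (β * Y 1 + γ * Y 0))
        (2 * √(β ^ 2 + γ ^ 2) * Y 2) (2 * √(β ^ 2 + γ ^ 2) * Y 3)
        ((ρ + Y 4) - (β ^ 2 + γ ^ 2) * (ρ - Y 4))‖ = D := by
      rw [← sq_eq_sq₀ (norm_nonneg _) hD.le, norm_sq_eucA5, hDdef]
      simp only [vec5_zero, vec5_one, vec5_two, vec5_three, vec5_four]
      linear_combination (4 * Y 2 ^ 2 + 4 * Y 3 ^ 2) * hs - 4 * (β ^ 2 + γ ^ 2) * hY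
    rw [hv, div_mul_cancel₀ _ hD.ne']
  · rw [norm_smul, hn, norm_norm, mul_one]

theorem twistOf_smul {G : EucA 6 → EucA 5} {β γ : ℝ} (Y : EucA 5) {l : ℝ} (hl : 0 < l) :
    twistOf G β γ (l • Y) = l • twistOf G β γ Y := by
  have e0 : ‖l • Y‖ = l * ‖Y‖ := by rw [norm_smul, Real.norm_of_nonneg hl.le]
  have e1 : (β ^ 2 + γ ^ 2) * (l * ‖Y‖ - l * Y 4) + (l * ‖Y‖ + l * Y 4) =
      l * ((β ^ 2 + γ ^ 2) * (‖Y‖ - Y 4) + (‖Y‖ + Y 4)) := by ring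
  have e2 : outVec β γ (l * ‖Y‖) (l • Y) = l • outVec β γ ‖Y‖ Y := by
    unfold outVec
    simp only [PiLp.smul_apply, smul_eq_mul, e1]
    rw [mul_div_mul_left _ _ hl.ne', smul_comm]
    congr 1
    ext i; fin_cases i <;> simp <;> ring
  have e3 : innerArg β γ (l * ‖Y‖) (l • Y) = innerArg β γ ‖Y‖ Y := by
    have h1 : (l * ‖Y‖ - l * Y 4) / (2 * (l * ‖Y‖)) = (‖Y‖ - Y 4) / (2 * ‖Y‖) := by
      rw [← mul_sub, mul_left_comm, mul_div_mul_left _ _ hl.ne']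
    have h2 : √(2 * (l * ‖Y‖) * (l * ‖Y‖ - l * Y 4)) = l * √(2 * ‖Y‖ * (‖Y‖ - Y 4)) := by
      rw [show 2 * (l * ‖Y‖) * (l * ‖Y‖ - l * Y 4) = l ^ 2 * (2 * ‖Y‖ * (‖Y‖ - Y 4)) by ring,
        Real.sqrt_mul (by positivity), Real.sqrt_sq hl.le]
    unfold innerArg
    simp only [PiLp.smul_apply, smul_eq_mul, h1, h2, mul_div_mul_left _ _ hl.ne']
  unfold twistOf
  rw [e0, e2, e3]
  simp only [PiLp.smul_apply, smul_eq_mul, e1, mul_left_comm _ l, mul_le_mul_iff_right₀ hl]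
  split_ifs
  · rfl
  · rw [mul_smul]

theorem continuousAt_twistOf {G : EucA 6 → EucA 5} (hG : Continuous G)
    (he : ∀ v, 1 / 2 ≤ ‖v‖ → G v = joinMap v) {X : Type*} [TopologicalSpace X] {β γ : X → ℝ} {Y : X → EucA 5}
    (hβ : Continuous β) (hγ : Continuous γ) (hY : Continuous Y)
    {x₀ : X} (h0 : Y x₀ ≠ 0) :
    ContinuousAt (fun x => twistOf G (β x) (γ x) (Y x)) x₀ := by
  have hρ : 0 < ‖Y x₀‖ := norm_pos_iff.2 h0
  have habs := abs_le.1 (abs_coord_le_norm (Y x₀))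
  set D : X → ℝ := fun x => (β x ^ 2 + γ x ^ 2) * (‖Y x‖ - Y x 4) + (‖Y x‖ + Y x 4) with hD
  have hDc : Continuous D := by fun_prop
  have hYi (i : Fin 5) : Continuous fun x => Y x i := by fun_prop
  rcases lt_or_ge ‖Y x₀‖ (D x₀) with hlt | hge
  · have hco : ContinuousAt (fun x => outVec (β x) (γ x) ‖Y x‖ (Y x)) x₀ := by
      have hc : ContinuousAt (fun x => ‖Y x‖ / D x) x₀ :=
        hY.norm.continuousAt.div hDc.continuousAt (by linarith)
      refine hc.smul (Continuous.continuousAt ?_)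
      apply continuous_vec5 <;> fun_prop
    refine hco.congr ?_
    filter_upwards [(isOpen_lt hY.norm hDc).mem_nhds hlt] with x hx
    unfold twistOf
    split_ifs with h
    · rfl
    · exact outVec_eq he hx (by
        push Not at h
        have := norm_nonneg (Y x)
        linarith)
  · have hlt : D x₀ < 5 / 4 * ‖Y x₀‖ := by linarith
    have hne : Y x₀ 4 < ‖Y x₀‖ := by
      refine lt_of_le_of_ne habs.2 fun h => ?_
      simp only [hD, h] at hge
      linarith
    have hq : √(2 * ‖Y x₀‖ * (‖Y x₀‖ - Y x₀ 4)) ≠ 0 :=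
      (Real.sqrt_pos.2 (mul_pos (by linarith) (by linarith))).ne'
    have hco : ContinuousAt (fun x => ‖Y x‖ • G (innerArg (β x) (γ x) ‖Y x‖ (Y x))) x₀ := by
      refine hY.norm.continuousAt.smul (hG.continuousAt.comp ?_)
      have hs : ContinuousAt (fun x => √((‖Y x‖ - Y x 4) / (2 * ‖Y x‖))) x₀ := by
        refine Real.continuous_sqrt.continuousAt.comp (ContinuousAt.div (Continuous.continuousAt ?_)
          (Continuous.continuousAt ?_) (by linarith)) <;> fun_prop
      have hd (i : Fin 5) : ContinuousAt
          (fun x => Y x i / √(2 * ‖Y x‖ * (‖Y x‖ - Y x 4))) x₀ :=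
        ContinuousAt.div (hYi i).continuousAt (Continuous.continuousAt (by fun_prop)) hq
      refine (PiLp.continuous_toLp 2 _).continuousAt.comp (continuousAt_pi.2 fun i => ?_)
      fin_cases i
      exacts [hβ.continuousAt.mul hs, hγ.continuousAt.mul hs, hd 0, hd 1, hd 2, hd 3]
    refine hco.congr ?_
    filter_upwards [(isOpen_lt hDc (continuous_const.mul hY.norm)).mem_nhds hlt] with x hx
    exact (if_neg (not_le.2 hx)).symm

theorem isDiskTwist_twistOf {G : EucA 6 → EucA 5} (hG : Continuous G)
    (hn : ∀ v, ‖G v‖ = 1) (he : ∀ v, 1 / 2 ≤ ‖v‖ → G v = joinMap v) : IsDiskTwist fun b c =>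
    twistOf G (b / max 1 √(b ^ 2 + c ^ 2)) (c / max 1 √(b ^ 2 + c ^ 2)) := by
  have hm (b c : ℝ) : 0 < max 1 √(b ^ 2 + c ^ 2) := lt_max_of_lt_left one_pos
  have key (b c : ℝ) (h : 1 ≤ b ^ 2 + c ^ 2) (Y : EucA 5) :
      twistOf G (b / max 1 √(b ^ 2 + c ^ 2)) (c / max 1 √(b ^ 2 + c ^ 2)) Y =
        vec5 ((b * Y 0 - c * Y 1) / √(b ^ 2 + c ^ 2)) ((b * Y 1 + c * Y 0) / √(b ^ 2 + c ^ 2))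
          (Y 2) (Y 3) (Y 4) := by
    have hn1 : 1 ≤ √(b ^ 2 + c ^ 2) := Real.one_le_sqrt.2 h
    have hn2 : √(b ^ 2 + c ^ 2) ^ 2 = b ^ 2 + c ^ 2 := Real.sq_sqrt (by linarith)
    rw [max_eq_right hn1]
    set n := √(b ^ 2 + c ^ 2)
    have hs : (b / n) ^ 2 + (c / n) ^ 2 = 1 := by
      rw [div_pow, div_pow, ← add_div, hn2, div_self (by linarith)]
    unfold twistOf outVec
    rw [hs, Real.sqrt_one, if_pos (by linarith [norm_nonneg Y])]
    rcases (norm_nonneg Y).eq_or_lt with h0 | h0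
    · have : Y = 0 := norm_eq_zero.1 h0.symm
      ext i; fin_cases i <;> simp [this]
    · rw [show ‖Y‖ / (1 * (‖Y‖ - Y 4) + (‖Y‖ + Y 4)) = 1 / 2 by
        rw [show 1 * (‖Y‖ - Y 4) + (‖Y‖ + Y 4) = 2 * ‖Y‖ by ring]; field_simp]
      ext i; fin_cases i <;> simp <;> ring
  refine ⟨?_, fun b c Y => norm_twistOf hn Y, fun b c Y l hl => twistOf_smul Y hl, ?_, ?_, ?_, ?_,
    ?_⟩
  · rw [continuous_iff_continuousAt]
    rintro ⟨b₀, c₀, Y₀⟩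
    by_cases h0 : Y₀ = 0
    · rw [h0, ContinuousAt]
      have e : twistOf G (b₀ / max 1 √(b₀ ^ 2 + c₀ ^ 2)) (c₀ / max 1 √(b₀ ^ 2 + c₀ ^ 2)) 0 = 0 := by
        rw [← norm_eq_zero, norm_twistOf hn, norm_zero]
      simp only [e]
      rw [tendsto_zero_iff_norm_tendsto_zero]
      simp only [norm_twistOf hn]
      have : Continuous fun q : ℝ × ℝ × EucA 5 => ‖q.2.2‖ := by fun_prop
      simpa using this.tendsto (b₀, c₀, 0)
    · have hden : Continuous fun q : ℝ × ℝ × EucA 5 => max 1 √(q.1 ^ 2 + q.2.1 ^ 2) := by fun_prop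
      refine continuousAt_twistOf hG he (β := fun q : ℝ × ℝ × EucA 5 =>
        q.1 / max 1 √(q.1 ^ 2 + q.2.1 ^ 2)) (γ := fun q : ℝ × ℝ × EucA 5 =>
        q.2.1 / max 1 √(q.1 ^ 2 + q.2.1 ^ 2)) (Y := fun q => q.2.2) ?_ ?_ (by fun_prop)
        h0
      · exact (by fun_prop : Continuous fun q : ℝ × ℝ × EucA 5 => q.1).div hden fun q => (hm _ _).ne'
      · exact (by fun_prop : Continuous fun q : ℝ × ℝ × EucA 5 => q.2.1).div hden
          fun q => (hm _ _).ne'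
  all_goals
    intro b c Y h
    simp only [key b c h]
    simp

end TwistOfExtension

/-- The homogeneous join map, precomposed with a linear isomorphism, is not nullhomotopic. -/
theorem not_sphereNullhomotopic_joinMap {L M : EucA 6 →L[ℝ] EucA 6} (hLM : ∀ v, L (M v) = v) :
    ¬ SphereNullhomotopic fun x => joinMap (L x) := by
  intro h
  obtain ⟨G, hG, hn, he⟩ := exists_joinMap_extension hLM h
  exact (isDiskTwist_twistOf hG hn he).false

section Phase

open ComplexConjugate in
/-- The conjugate of `z`, rotated by the angle `N * θ`. -/
def rotConj (N θ : ℝ) (z : ℂ) : ℂ := Complex.exp ((N * θ : ℝ) * Complex.I) * conj z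

/-- The difference between the angle `N * θ` and the phase of `z`, in `(-π, π]`. -/
def phaseGap (N θ : ℝ) (z : ℂ) : ℝ := (rotConj N θ z).arg

/-- The determination of the phase of `z` that is closest to `N * θ`. -/
def phaseNear (N θ : ℝ) (z : ℂ) : ℝ := N * θ - phaseGap N θ z

theorem norm_rotConj (N θ : ℝ) (z : ℂ) : ‖rotConj N θ z‖ = ‖z‖ := by
  rw [rotConj, norm_mul, Complex.norm_exp_ofReal_mul_I, one_mul, RCLike.norm_conj]

theorem abs_phaseGap_le (N θ : ℝ) (z : ℂ) : |phaseGap N θ z| ≤ 4 :=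
  (Complex.abs_arg_le_pi _).trans Real.pi_le_four

theorem eq_norm_mul_exp_phaseNear (N θ : ℝ) (z : ℂ) :
    z = ‖z‖ * Complex.exp ((phaseNear N θ z : ℝ) * Complex.I) := by
  have h1 : ‖z‖ * Complex.exp (phaseGap N θ z * Complex.I) = rotConj N θ z := by
    rw [← norm_rotConj N θ z]; exact Complex.norm_mul_exp_arg_mul_I _
  have h2 := congrArg (starRingEnd ℂ) h1
  simp only [rotConj, map_mul, Complex.conj_conj, ← Complex.exp_conj, Complex.conj_ofReal,
    Complex.conj_I] at h2
  rw [phaseNear, Complex.ofReal_sub, sub_mul, sub_eq_add_neg, Complex.exp_add, mul_left_comm,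
    ← mul_neg, h2, ← mul_assoc, ← Complex.exp_add]
  simp

theorem re_eq_norm_mul_cos (N θ : ℝ) (z : ℂ) : z.re = ‖z‖ * Real.cos (phaseNear N θ z) := by
  conv_lhs => rw [eq_norm_mul_exp_phaseNear N θ z]
  rw [Complex.re_ofReal_mul, Complex.exp_ofReal_mul_I_re]

theorem im_eq_norm_mul_sin (N θ : ℝ) (z : ℂ) : z.im = ‖z‖ * Real.sin (phaseNear N θ z) := by
  conv_lhs => rw [eq_norm_mul_exp_phaseNear N θ z]
  rw [Complex.im_ofReal_mul, Complex.exp_ofReal_mul_I_im]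

variable {E : Type*} [NormedAddCommGroup E] [NormedSpace ℝ E]

theorem contDiff_rotConj {n : WithTop ℕ∞} (N : ℝ) :
    ContDiff ℝ n fun q : ℝ × ℂ => rotConj N q.1 q.2 := by
  unfold rotConj
  have h1 : ContDiff ℝ n fun q : ℝ × ℂ => ((N * q.1 : ℝ) : ℂ) * Complex.I :=
    (Complex.ofRealCLM.contDiff.comp (contDiff_const.mul contDiff_fst)).mul contDiff_const
  exact h1.cexp.mul (Complex.conjCLE.contDiff.comp contDiff_snd)

theorem contDiffAt_arg {n : WithTop ℕ∞} {w : ℂ} (hw : w ∈ Complex.slitPlane) :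
    ContDiffAt ℝ n Complex.arg w := by
  have h : ContDiffAt ℝ n Complex.log w := (Complex.contDiffAt_log hw).restrict_scalars ℝ
  exact (Complex.imCLM.contDiff.contDiffAt.comp w h).congr_of_eventuallyEq
    (Filter.Eventually.of_forall fun x => (Complex.log_im x).symm)

theorem contDiffAt_phaseGap {n : WithTop ℕ∞} {N : ℝ} {θ : E → ℝ} {z : E → ℂ} {x : E}
    (hθ : ContDiffAt ℝ n θ x) (hz : ContDiffAt ℝ n z x)
    (h : rotConj N (θ x) (z x) ∈ Complex.slitPlane) :
    ContDiffAt ℝ n (fun y => phaseGap N (θ y) (z y)) x := by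
  have h1 : ContDiffAt ℝ n (fun y => rotConj N (θ y) (z y)) x :=
    (contDiff_rotConj N).contDiffAt.comp x (hθ.prodMk hz)
  exact (contDiffAt_arg h).comp x h1

theorem contDiffAt_phaseNear {n : WithTop ℕ∞} {N : ℝ} {θ : E → ℝ} {z : E → ℂ} {x : E}
    (hθ : ContDiffAt ℝ n θ x) (hz : ContDiffAt ℝ n z x)
    (h : rotConj N (θ x) (z x) ∈ Complex.slitPlane) :
    ContDiffAt ℝ n (fun y => phaseNear N (θ y) (z y)) x :=
  (contDiffAt_const.mul hθ).sub (contDiffAt_phaseGap hθ hz h)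

/-- Near a point where `w` is a negative real number, the phase is at least `3`. -/
theorem eventually_three_le_abs_arg {X : Type*} [TopologicalSpace X] {w : X → ℂ} {x₀ : X}
    (hw : ContinuousAt w x₀) (h : w x₀ ∉ Complex.slitPlane) (h0 : w x₀ ≠ 0) :
    ∀ᶠ x in nhds x₀, 3 ≤ |(w x).arg| := by
  rw [Complex.mem_slitPlane_iff_arg] at h
  have h1 : (w x₀).arg = Real.pi := by tauto
  have h2 : (w x₀).re / ‖w x₀‖ = -1 := by
    rw [← Complex.cos_arg h0, h1, Real.cos_pi]
  have h3 : ContinuousAt (fun x => (w x).re / ‖w x‖) x₀ :=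
    (Complex.continuous_re.continuousAt.comp hw).div hw.norm (norm_ne_zero_iff.2 h0)
  have h4 : Real.cos 3 > -1 := by
    rw [gt_iff_lt, ← Real.cos_pi]
    exact Real.cos_lt_cos_of_nonneg_of_le_pi (by norm_num) le_rfl
      (by linarith [Real.pi_gt_three])
  filter_upwards [h3.eventually (gt_mem_nhds (show (w x₀).re / ‖w x₀‖ < Real.cos 3 by
    rw [h2]; exact h4)), hw.eventually_ne h0] with x hx hx0
  by_contra! hlt
  have := Real.cos_lt_cos_of_nonneg_of_le_pi (abs_nonneg _) Real.pi_gt_three.le hlt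
  rw [Real.cos_abs, Complex.cos_arg hx0] at this
  linarith

end Phase

section Collapse

/-- The distance of the first two coordinates from the origin. -/
def cylRadius (y : EucA 5) : ℝ := √(y 0 ^ 2 + y 1 ^ 2)

/-- The square of the (weighted) distance from the unit circle. -/
def tubeSq (y : EucA 5) : ℝ :=
  4 * (cylRadius y - 1) ^ 2 + 4 * y 2 ^ 2 + y 3 ^ 2 + y 4 ^ 2

/-- The normal coordinates around the unit circle, rotated by the angle along the circle. -/
def tubeCoord (y : EucA 5) : EucA 4 :=
  !₂[2 * (y 0 * (1 - (cylRadius y)⁻¹) - y 1 * (y 2 * (cylRadius y)⁻¹)),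
    2 * (y 1 * (1 - (cylRadius y)⁻¹) + y 0 * (y 2 * (cylRadius y)⁻¹)), y 3, y 4]

/-- The collapse of the exterior of the unit ball of `ℝ⁴` to the north pole of `S⁴`. -/
def ballCollapse (u : EucA 4) : EucA 5 :=
  ((Real.smoothTransition (1 - ‖u‖ ^ 2)) ^ 2 + ‖u‖ ^ 2)⁻¹ •
    vec5 (2 * Real.smoothTransition (1 - ‖u‖ ^ 2) * u 0)
      (2 * Real.smoothTransition (1 - ‖u‖ ^ 2) * u 1)
      (2 * Real.smoothTransition (1 - ‖u‖ ^ 2) * u 2)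
      (2 * Real.smoothTransition (1 - ‖u‖ ^ 2) * u 3)
      (‖u‖ ^ 2 - Real.smoothTransition (1 - ‖u‖ ^ 2) ^ 2)

/-- The north pole of `S⁴`. -/
def northPole : EucA 5 := vec5 0 0 0 0 1

/-- The cutoff at radius between `2` and `3`. -/
def farCut (y : EucA 5) : ℝ := max 0 (min 1 (‖y‖ - 2))

/-- A nowhere vanishing map on `ℝ⁵`, constant far away, whose composition with `joinMap` is
the collapse onto a twisted tubular neighbourhood of the unit circle. -/
def liftCollapse (y : EucA 5) : EucA 6 :=
  vec6 ((1 - farCut y) * (Real.smoothTransition (1 - tubeSq y) * (y 0 / max (cylRadius y) (1 / 2))))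
    ((1 - farCut y) * (Real.smoothTransition (1 - tubeSq y) * (y 1 / max (cylRadius y) (1 / 2))))
    ((1 - farCut y) * (2 * (cylRadius y - 1)) + farCut y)
    ((1 - farCut y) * (2 * y 2)) ((1 - farCut y) * y 3) ((1 - farCut y) * y 4)

/-- The value of `liftCollapse` far away. -/
def farVec : EucA 6 := vec6 0 0 1 0 0 0

theorem norm_sq_eucA4 (x : EucA 4) :
    ‖x‖ ^ 2 = x 0 ^ 2 + x 1 ^ 2 + x 2 ^ 2 + x 3 ^ 2 := by
  rw [EuclideanSpace.norm_sq_eq, Fin.sum_univ_four]; simp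

theorem cylRadius_nonneg (y : EucA 5) : 0 ≤ cylRadius y := Real.sqrt_nonneg _

theorem sq_cylRadius (y : EucA 5) : cylRadius y ^ 2 = y 0 ^ 2 + y 1 ^ 2 :=
  Real.sq_sqrt (by positivity)

theorem continuous_cylRadius : Continuous cylRadius := by unfold cylRadius; fun_prop

theorem continuous_tubeSq : Continuous tubeSq := by
  have := continuous_cylRadius
  unfold tubeSq; fun_prop

theorem continuous_farCut : Continuous farCut := by unfold farCut; fun_prop

theorem continuous_vec6 {X : Type*} [TopologicalSpace X] {a b c d e f : X → ℝ}
    (ha : Continuous a) (hb : Continuous b) (hc : Continuous c) (hd : Continuous d)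
    (he : Continuous e) (hf : Continuous f) :
    Continuous fun x => vec6 (a x) (b x) (c x) (d x) (e x) (f x) := by
  refine (PiLp.continuous_toLp 2 _).comp (continuous_pi fun i => ?_)
  fin_cases i <;> simpa

theorem continuous_smoothTransition : Continuous Real.smoothTransition :=
  (Real.smoothTransition.contDiff (n := 0)).continuous

theorem continuous_liftCollapse : Continuous liftCollapse := by
  have h1 := continuous_cylRadius
  have h2 := continuous_tubeSq
  have h3 := continuous_farCut
  have h4 := continuous_smoothTransition
  have h5 : ∀ y, max (cylRadius y) (1 / 2) ≠ 0 := fun y =>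
    (lt_max_of_lt_right (by norm_num)).ne'
  unfold liftCollapse
  apply continuous_vec6 <;> fun_prop (disch := exact h5 _)

theorem farCut_mem (y : EucA 5) : 0 ≤ farCut y ∧ farCut y ≤ 1 :=
  ⟨le_max_left _ _, max_le zero_le_one (min_le_left _ _)⟩

theorem farCut_of_le {y : EucA 5} (h : ‖y‖ ≤ 2) : farCut y = 0 :=
  max_eq_left ((min_le_right _ _).trans (by linarith))

theorem farCut_of_ge {y : EucA 5} (h : 3 ≤ ‖y‖) : farCut y = 1 := by
  rw [farCut, min_eq_left (by linarith), max_eq_right zero_le_one]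

theorem liftCollapse_of_farCut {y : EucA 5} (h : farCut y = 1) : liftCollapse y = farVec := by
  simp [liftCollapse, farVec, h]

theorem liftCollapse_of_ge {y : EucA 5} (h : 3 ≤ ‖y‖) : liftCollapse y = farVec :=
  liftCollapse_of_farCut (farCut_of_ge h)

theorem norm_sq_eq_cylRadius (y : EucA 5) :
    ‖y‖ ^ 2 = cylRadius y ^ 2 + y 2 ^ 2 + y 3 ^ 2 + y 4 ^ 2 := by
  rw [norm_sq_eucA5, sq_cylRadius]

theorem near_of_tubeSq_lt {y : EucA 5} (h : tubeSq y ≤ 1) :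
    1 / 2 ≤ cylRadius y ∧ ‖y‖ ≤ 2 := by
  have h0 := cylRadius_nonneg y
  unfold tubeSq at h
  have h1 : (2 * (cylRadius y - 1)) ^ 2 ≤ 1 := by
    nlinarith [sq_nonneg (y 2), sq_nonneg (y 3), sq_nonneg (y 4)]
  have h2 := abs_le_of_sq_le_sq' (h1.trans_eq (one_pow 2).symm) zero_le_one
  refine ⟨by linarith [h2.1], abs_le_of_sq_le_sq' (b := 2) ?_ (by norm_num) |>.2⟩
  rw [norm_sq_eq_cylRadius]
  nlinarith [sq_nonneg (y 2), sq_nonneg (y 3), sq_nonneg (y 4), h2.2]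

theorem liftCollapse_ne_zero (y : EucA 5) : liftCollapse y ≠ 0 := by
  intro h
  have e0 := congrArg (fun v : EucA 6 => v 0) h
  have e1 := congrArg (fun v : EucA 6 => v 1) h
  have e2 := congrArg (fun v : EucA 6 => v 2) h
  have e3 := congrArg (fun v : EucA 6 => v 3) h
  have e4 := congrArg (fun v : EucA 6 => v 4) h
  have e5 := congrArg (fun v : EucA 6 => v 5) h
  simp only [liftCollapse, vec6_zero, vec6_one, vec6_two, vec6_three, vec6_four, vec6_five,
    PiLp.zero_apply] at e0 e1 e2 e3 e4 e5
  obtain ⟨hl0, hl1⟩ := farCut_mem y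
  rcases hl1.lt_or_eq with hl | hl
  · have hp : 1 - farCut y ≠ 0 := by linarith
    have y2 : y 2 = 0 := by simpa [hp] using e3
    have y3 : y 3 = 0 := by simpa [hp] using e4
    have y4 : y 4 = 0 := by simpa [hp] using e5
    have hn : ‖y‖ = cylRadius y := by
      rw [← sq_eq_sq₀ (norm_nonneg _) (cylRadius_nonneg _), norm_sq_eq_cylRadius, y2, y3, y4]
      ring
    rcases le_or_gt ‖y‖ 2 with h2 | h2
    · have hc := farCut_of_le h2
      rw [hc] at e0 e1 e2
      have hr : cylRadius y = 1 := by linarith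
      have ht : tubeSq y = 0 := by simp [tubeSq, hr, y2, y3, y4]
      have hm : max (cylRadius y) (1 / 2) = 1 := by rw [hr]; norm_num
      rw [ht, hm] at e0 e1
      simp [Real.smoothTransition.one] at e0 e1
      have := sq_cylRadius y
      rw [hr, e0, e1] at this
      norm_num at this
    · nlinarith [mul_pos (sub_pos.2 hl) (show 0 < cylRadius y - 2 by linarith)]
  · rw [hl] at e2; norm_num at e2

theorem joinMap_of_fst_eq_zero {e : EucA 6} (h0 : e 0 = 0) (h1 : e 1 = 0) (he : e ≠ 0) :
    joinMap e = northPole := by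
  have h2 : ‖e‖ ^ 2 ≠ 0 := by positivity
  have h3 := norm_sq_eucA6 e
  rw [h0, h1] at h3
  rw [joinMap, inv_smul_eq_iff₀ h2, h3]
  ext i
  fin_cases i <;> simp [northPole, h0, h1]

theorem joinMap_farVec : joinMap farVec = northPole :=
  joinMap_of_fst_eq_zero rfl rfl fun h => by
    have := congrArg (fun v : EucA 6 => v 2) h
    simp [farVec] at this

theorem joinMap_liftCollapse_of_ge {y : EucA 5} (h : 1 ≤ tubeSq y) :
    joinMap (liftCollapse y) = northPole := by
  have h1 : Real.smoothTransition (1 - tubeSq y) = 0 :=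
    Real.smoothTransition.zero_of_nonpos (by linarith)
  exact joinMap_of_fst_eq_zero (by simp [liftCollapse, h1]) (by simp [liftCollapse, h1])
    (liftCollapse_ne_zero y)

theorem norm_sq_tubeCoord {y : EucA 5} (h : 0 < cylRadius y) :
    ‖tubeCoord y‖ ^ 2 = tubeSq y := by
  rw [norm_sq_eucA4]
  simp only [tubeCoord, tubeSq, PiLp.toLp_apply, Matrix.cons_val]
  have h1 := sq_cylRadius y
  have h2 : cylRadius y * (cylRadius y)⁻¹ = 1 := mul_inv_cancel₀ h.ne'
  generalize cylRadius y = r at *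
  generalize r⁻¹ = s at *
  have h3 : (y 0 ^ 2 + y 1 ^ 2) = r ^ 2 := h1.symm
  linear_combination (4 * ((1 - s) ^ 2 + y 2 ^ 2 * s ^ 2)) * h3 +
    (4 * (r * s - 1) + 4 * y 2 ^ 2 * (r * s + 1) - 8 * (r - 1)) * h2

theorem ballCollapse_of_ge {u : EucA 4} (h : 1 ≤ ‖u‖) : ballCollapse u = northPole := by
  have h0 : (1 : ℝ) ≤ ‖u‖ ^ 2 := one_le_pow₀ h
  have h1 : Real.smoothTransition (1 - ‖u‖ ^ 2) = 0 :=
    Real.smoothTransition.zero_of_nonpos (by linarith)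
  have h2 : ‖u‖ ^ 2 ≠ 0 := by positivity
  rw [ballCollapse, h1, inv_smul_eq_iff₀ (by simpa using h2)]
  ext i
  fin_cases i <;> simp [northPole]

theorem joinMap_liftCollapse {y : EucA 5} (h : 0 < cylRadius y) :
    joinMap (liftCollapse y) = ballCollapse (tubeCoord y) := by
  have hn := norm_sq_tubeCoord h
  rcases le_or_gt 1 (tubeSq y) with h1 | h1
  · rw [joinMap_liftCollapse_of_ge h1, ballCollapse_of_ge]
    rw [← hn] at h1
    exact (one_le_sq_iff₀ (norm_nonneg _)).1 h1
  · obtain ⟨h2, h3⟩ := near_of_tubeSq_lt h1.le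
    have hc := farCut_of_le h3
    have hs := sq_cylRadius y
    have hη := Real.smoothTransition.pos_of_pos (show 0 < 1 - tubeSq y by linarith)
    have hL : liftCollapse y = vec6 (Real.smoothTransition (1 - tubeSq y) * (y 0 / cylRadius y))
        (Real.smoothTransition (1 - tubeSq y) * (y 1 / cylRadius y)) (2 * (cylRadius y - 1))
        (2 * y 2) (y 3) (y 4) := by
      simp [liftCollapse, hc, max_eq_left (show 2⁻¹ ≤ cylRadius y by linarith)]
    have hq : (Real.smoothTransition (1 - tubeSq y) * (y 0 / cylRadius y)) ^ 2 +
        (Real.smoothTransition (1 - tubeSq y) * (y 1 / cylRadius y)) ^ 2 =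
        Real.smoothTransition (1 - tubeSq y) ^ 2 := by
      have : (y 0 / cylRadius y) ^ 2 + (y 1 / cylRadius y) ^ 2 = 1 := by
        rw [div_pow, div_pow, ← add_div, ← hs, div_self (by positivity)]
      linear_combination Real.smoothTransition (1 - tubeSq y) ^ 2 * this
    have hN : ‖liftCollapse y‖ ^ 2 = Real.smoothTransition (1 - tubeSq y) ^ 2 + tubeSq y := by
      rw [hL, norm_sq_eucA6]
      simp only [vec6_zero, vec6_one, vec6_two, vec6_three, vec6_four, vec6_five]
      rw [hq]
      unfold tubeSq; ring
    rw [joinMap, hN, ballCollapse, hn, hL]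
    congr 1
    simp only [vec6_zero, vec6_one, vec6_two, vec6_three, vec6_four, vec6_five]
    rw [hq, Real.sqrt_sq hη.le]
    have h4 : cylRadius y ≠ 0 := h.ne'
    ext i
    fin_cases i
    · simp [tubeCoord]; field_simp
    · simp [tubeCoord]; field_simp; ring
    · simp [tubeCoord]
    · simp [tubeCoord]
    · simp only [Fin.reduceFinMk, vec5_four]
      rw [sub_sub, hq]; unfold tubeSq; ring

theorem contDiff_ballCollapse {n : ℕ∞} : ContDiff ℝ n ballCollapse := by
  have h1 : ContDiff ℝ n fun u : EucA 4 => ‖u‖ ^ 2 := contDiff_norm_sq ℝ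
  have h2 : ContDiff ℝ n fun u : EucA 4 => Real.smoothTransition (1 - ‖u‖ ^ 2) :=
    Real.smoothTransition.contDiff.comp (contDiff_const.sub h1)
  have h3 : ∀ u : EucA 4, (Real.smoothTransition (1 - ‖u‖ ^ 2)) ^ 2 + ‖u‖ ^ 2 ≠ 0 := by
    intro u
    rcases eq_or_ne u 0 with rfl | hu
    · simp [Real.smoothTransition.one]
    · positivity
  refine ((h2.pow 2).add h1).inv h3 |>.smul (contDiff_euclidean.2 fun i => ?_)
  have h4 : ∀ i, ContDiff ℝ n fun u : EucA 4 => u i := fun i => by fun_prop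
  fin_cases i
  · exact (contDiff_const.mul h2).mul (h4 0)
  · exact (contDiff_const.mul h2).mul (h4 1)
  · exact (contDiff_const.mul h2).mul (h4 2)
  · exact (contDiff_const.mul h2).mul (h4 3)
  · exact h1.sub (h2.pow 2)

theorem contDiffAt_cylRadius {n : WithTop ℕ∞} {y : EucA 5} (h : 0 < cylRadius y) :
    ContDiffAt ℝ n cylRadius y := by
  refine ContDiffAt.sqrt (by fun_prop) ?_
  rw [← sq_cylRadius]; positivity

theorem contDiffAt_tubeCoord {n : WithTop ℕ∞} {y : EucA 5} (h : 0 < cylRadius y) :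
    ContDiffAt ℝ n tubeCoord y := by
  have h1 : ContDiffAt ℝ n (fun y => (cylRadius y)⁻¹) y := (contDiffAt_cylRadius h).inv h.ne'
  refine contDiffAt_euclidean.2 fun i => ?_
  have h4 : ∀ i, ContDiffAt ℝ n (fun u : EucA 5 => u i) y := fun i => by fun_prop
  fin_cases i
  · exact contDiffAt_const.mul (((h4 0).mul (contDiffAt_const.sub h1)).sub
      ((h4 1).mul ((h4 2).mul h1)))
  · exact contDiffAt_const.mul (((h4 1).mul (contDiffAt_const.sub h1)).add
      ((h4 0).mul ((h4 2).mul h1)))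
  · exact h4 3
  · exact h4 4

end Collapse

section PhaseMap

/-- A pair of real coordinates, as a complex coordinate. -/
def zc (i j : Fin 6) (x : EucA 6) : ℂ := x i + x j * Complex.I

/-- The difference between the squared moduli of the first and third complex coordinates. -/
def quadA (x : EucA 6) : ℝ := x 0 ^ 2 + x 1 ^ 2 - x 4 ^ 2 - x 5 ^ 2

/-- The difference between the squared moduli of the second and third complex coordinates. -/
def quadB (x : EucA 6) : ℝ := x 2 ^ 2 + x 3 ^ 2 - x 4 ^ 2 - x 5 ^ 2

/-- The determination of the phase of the third complex coordinate close to `N * quadA`. -/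
def psiThree (N : ℝ) (x : EucA 6) : ℝ := phaseNear N (quadA x) (zc 4 5 x)

/-- The determination of the phase of the second complex coordinate close to `N * psiThree`. -/
def psiTwo (N : ℝ) (x : EucA 6) : ℝ := phaseNear N (psiThree N x) (zc 2 3 x)

/-- The determination of the phase of the first complex coordinate close to `N * psiTwo`. -/
def psiOne (N : ℝ) (x : EucA 6) : ℝ := phaseNear N (psiTwo N x) (zc 0 1 x)

/-- The points near which all the phases are smooth. -/
def PhaseRegular (N : ℝ) (x : EucA 6) : Prop :=
  rotConj N (quadA x) (zc 4 5 x) ∈ Complex.slitPlane ∧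
  rotConj N (psiThree N x) (zc 2 3 x) ∈ Complex.slitPlane ∧
  rotConj N (psiTwo N x) (zc 0 1 x) ∈ Complex.slitPlane

/-- The three phase gaps, the finest phase and the remaining quadratic coordinate. -/
def phaseMap (N : ℝ) (x : EucA 6) : EucA 5 :=
  vec5 (phaseGap N (psiTwo N x) (zc 0 1 x)) (phaseGap N (psiThree N x) (zc 2 3 x))
    (phaseGap N (quadA x) (zc 4 5 x)) (40 * (psiOne N x / N ^ 3)) (40 * quadB x)

theorem contDiff_zc {n : WithTop ℕ∞} (i j : Fin 6) : ContDiff ℝ n (zc i j) := by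
  have h : ∀ i, ContDiff ℝ n fun x : EucA 6 => ((x i : ℝ) : ℂ) := fun i =>
    Complex.ofRealCLM.contDiff.comp (by fun_prop)
  exact (h i).add ((h j).mul contDiff_const)

theorem contDiff_quadA {n : WithTop ℕ∞} : ContDiff ℝ n quadA := by unfold quadA; fun_prop

theorem contDiff_quadB {n : WithTop ℕ∞} : ContDiff ℝ n quadB := by unfold quadB; fun_prop

@[simp] theorem zc_re (i j : Fin 6) (x : EucA 6) : (zc i j x).re = x i := by simp [zc]

@[simp] theorem zc_im (i j : Fin 6) (x : EucA 6) : (zc i j x).im = x j := by simp [zc]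

theorem zc_ne_zero_of_mem {N θ : ℝ} {z : ℂ} (h : rotConj N θ z ∈ Complex.slitPlane) : z ≠ 0 := by
  rintro rfl
  simp [rotConj] at h

variable {N : ℝ} {x : EucA 6}

section Smooth

variable {n : WithTop ℕ∞}

theorem contDiffAt_psiThree (h : rotConj N (quadA x) (zc 4 5 x) ∈ Complex.slitPlane) :
    ContDiffAt ℝ n (psiThree N) x :=
  contDiffAt_phaseNear contDiff_quadA.contDiffAt (contDiff_zc _ _).contDiffAt h

theorem contDiffAt_psiTwo (h3 : rotConj N (quadA x) (zc 4 5 x) ∈ Complex.slitPlane)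
    (h2 : rotConj N (psiThree N x) (zc 2 3 x) ∈ Complex.slitPlane) :
    ContDiffAt ℝ n (psiTwo N) x :=
  contDiffAt_phaseNear (contDiffAt_psiThree h3) (contDiff_zc _ _).contDiffAt h2

theorem PhaseRegular.contDiffAt_psiOne (h : PhaseRegular N x) : ContDiffAt ℝ n (psiOne N) x :=
  contDiffAt_phaseNear (contDiffAt_psiTwo h.1 h.2.1) (contDiff_zc _ _).contDiffAt h.2.2

theorem PhaseRegular.contDiffAt_phaseMap (h : PhaseRegular N x) :
    ContDiffAt ℝ n (phaseMap N) x := by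
  refine contDiffAt_euclidean.2 fun i => ?_
  fin_cases i
  · exact contDiffAt_phaseGap (contDiffAt_psiTwo h.1 h.2.1) (contDiff_zc _ _).contDiffAt h.2.2
  · exact contDiffAt_phaseGap (contDiffAt_psiThree h.1) (contDiff_zc _ _).contDiffAt h.2.1
  · exact contDiffAt_phaseGap contDiff_quadA.contDiffAt (contDiff_zc _ _).contDiffAt h.1
  · exact contDiffAt_const.mul (h.contDiffAt_psiOne.div_const _)
  · exact contDiffAt_const.mul contDiff_quadB.contDiffAt

theorem continuousAt_rotConj {θ : EucA 6 → ℝ} (i j : Fin 6) (hθ : ContinuousAt θ x) :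
    ContinuousAt (fun y => rotConj N (θ y) (zc i j y)) x :=
  (contDiff_rotConj (n := 0) N).continuous.continuousAt.comp
    (hθ.prodMk (contDiff_zc (n := 0) i j).continuous.continuousAt)

theorem PhaseRegular.eventually (h : PhaseRegular N x) : ∀ᶠ y in nhds x, PhaseRegular N y := by
  have ho := Complex.isOpen_slitPlane
  have h3 := continuousAt_rotConj (N := N) 4 5 (x := x)
    (contDiff_quadA (n := 0)).continuous.continuousAt
  have h2 := continuousAt_rotConj (N := N) 2 3 (x := x)
    (contDiffAt_psiThree (n := 0) h.1).continuousAt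
  have h1 := continuousAt_rotConj (N := N) 0 1 (x := x)
    (contDiffAt_psiTwo (n := 0) h.1 h.2.1).continuousAt
  exact (h3.eventually (ho.mem_nhds h.1)).and
    ((h2.eventually (ho.mem_nhds h.2.1)).and (h1.eventually (ho.mem_nhds h.2.2)))

end Smooth

theorem abs_psiOne_div_sub_le (hN : 1 ≤ N) : |psiOne N x / N ^ 3 - quadA x| ≤ 12 / N := by
  have hN0 : N ≠ 0 := by positivity
  have h3 := abs_phaseGap_le N (quadA x) (zc 4 5 x)
  have h2 := abs_phaseGap_le N (psiThree N x) (zc 2 3 x)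
  have h1 := abs_phaseGap_le N (psiTwo N x) (zc 0 1 x)
  have e : psiOne N x / N ^ 3 - quadA x = -(phaseGap N (quadA x) (zc 4 5 x) * N ^ 2 +
      phaseGap N (psiThree N x) (zc 2 3 x) * N + phaseGap N (psiTwo N x) (zc 0 1 x)) / N ^ 3 := by
    have e1 : psiOne N x = N * psiTwo N x - phaseGap N (psiTwo N x) (zc 0 1 x) := rfl
    have e2 : psiTwo N x = N * psiThree N x - phaseGap N (psiThree N x) (zc 2 3 x) := rfl
    have e3 : psiThree N x = N * quadA x - phaseGap N (quadA x) (zc 4 5 x) := rfl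
    rw [eq_div_iff (by positivity), sub_mul, div_mul_cancel₀ _ (by positivity)]
    linear_combination e1 + N * e2 + N ^ 2 * e3
  rw [e, abs_div, abs_of_pos (show 0 < N ^ 3 by positivity), div_le_div_iff₀ (by positivity)
    (by positivity), abs_neg]
  have hsq : N ≤ N ^ 2 := by nlinarith
  have : |phaseGap N (quadA x) (zc 4 5 x) * N ^ 2 +
      phaseGap N (psiThree N x) (zc 2 3 x) * N + phaseGap N (psiTwo N x) (zc 0 1 x)| ≤
      12 * N ^ 2 := by
    refine (abs_add_three _ _ _).trans ?_
    rw [abs_mul, abs_mul, abs_of_pos (show 0 < N ^ 2 by positivity),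
      abs_of_pos (show 0 < N by positivity)]
    nlinarith [mul_le_mul_of_nonneg_right h3 (show 0 ≤ N ^ 2 by positivity),
      mul_le_mul_of_nonneg_right h2 (show 0 ≤ N by positivity)]
  calc _ ≤ 12 * N ^ 2 * N := mul_le_mul_of_nonneg_right this (by positivity)
    _ = _ := by ring

theorem abs_apply_le_norm {d : ℕ} (v : EucA d) (i : Fin d) : |v i| ≤ ‖v‖ :=
  PiLp.norm_apply_le v i

theorem eventually_of_large_quad (hN : 1000 ≤ N)
    (h : 1 / 8 < |quadA x| ∨ 1 / 8 < |quadB x|) : ∀ᶠ y in nhds x, 3 ≤ ‖phaseMap N y‖ := by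
  rcases h with h | h
  · have hc : ContinuousAt (fun y => |quadA y|) x :=
      (contDiff_quadA (n := 0)).continuous.abs.continuousAt
    filter_upwards [hc.eventually (lt_mem_nhds h)] with y hy
    refine le_trans ?_ (abs_apply_le_norm _ 3)
    have h1 := abs_psiOne_div_sub_le (N := N) (x := y) (by linarith)
    have h2 : 12 / N ≤ 12 / 1000 := div_le_div_of_nonneg_left (by norm_num) (by norm_num) hN
    have h3 := abs_sub_abs_le_abs_sub (quadA y) (psiOne N y / N ^ 3)
    rw [abs_sub_comm] at h3
    change 3 ≤ |40 * (psiOne N y / N ^ 3)|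
    rw [abs_mul, abs_of_pos (by norm_num : (0 : ℝ) < 40)]
    linarith
  · have hc : ContinuousAt (fun y => |quadB y|) x :=
      (contDiff_quadB (n := 0)).continuous.abs.continuousAt
    filter_upwards [hc.eventually (lt_mem_nhds h)] with y hy
    refine le_trans ?_ (abs_apply_le_norm _ 4)
    change 3 ≤ |40 * quadB y|
    rw [abs_mul, abs_of_pos (by norm_num : (0 : ℝ) < 40)]
    linarith

theorem large_quad_of_zc_eq_zero (hx : 1 / 2 < ‖x‖ ^ 2)
    (h : zc 4 5 x = 0 ∨ zc 2 3 x = 0 ∨ zc 0 1 x = 0) :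
    1 / 8 < |quadA x| ∨ 1 / 8 < |quadB x| := by
  by_contra! hc
  obtain ⟨h1, h2⟩ := hc
  rw [abs_le] at h1 h2
  rw [norm_sq_eucA6] at hx
  unfold quadA at h1; unfold quadB at h2
  have hz : ∀ i j, zc i j x = 0 → x i = 0 ∧ x j = 0 := fun i j h0 =>
    ⟨by rw [← zc_re i j, h0]; rfl, by rw [← zc_im i j, h0]; rfl⟩
  rcases h with h | h | h
  · obtain ⟨e1, e2⟩ := hz _ _ h
    simp only [e1, e2] at h1 h2 hx
    linarith [h1.2, h2.2]
  · obtain ⟨e1, e2⟩ := hz _ _ h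
    simp only [e1, e2] at h1 h2 hx
    linarith [h1.1, h2.1, h1.2, h2.2]
  · obtain ⟨e1, e2⟩ := hz _ _ h
    simp only [e1, e2] at h1 h2 hx
    linarith [h1.1, h2.1, h1.2, h2.2]

theorem eventually_three_le_norm_phaseMap (hN : 1000 ≤ N) (hx : 1 / 2 < ‖x‖ ^ 2)
    (hr : ¬ PhaseRegular N x) : ∀ᶠ y in nhds x, 3 ≤ ‖phaseMap N y‖ := by
  by_cases hz : zc 4 5 x = 0 ∨ zc 2 3 x = 0 ∨ zc 0 1 x = 0
  · exact eventually_of_large_quad hN (large_quad_of_zc_eq_zero hx hz)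
  push Not at hz
  obtain ⟨z3, z2, z1⟩ := hz
  have h0 : ∀ {θ : ℝ} {z : ℂ}, z ≠ 0 → rotConj N θ z ≠ 0 := fun hz => by
    rwa [← norm_ne_zero_iff, norm_rotConj, norm_ne_zero_iff]
  by_cases h3 : rotConj N (quadA x) (zc 4 5 x) ∈ Complex.slitPlane
  · by_cases h2 : rotConj N (psiThree N x) (zc 2 3 x) ∈ Complex.slitPlane
    · have h1 : rotConj N (psiTwo N x) (zc 0 1 x) ∉ Complex.slitPlane := fun h1 => hr ⟨h3, h2, h1⟩
      filter_upwards [eventually_three_le_abs_arg (continuousAt_rotConj (N := N) 0 1 (x := x)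
        (contDiffAt_psiTwo (n := 0) h3 h2).continuousAt) h1 (h0 z1)] with y hy
      exact hy.trans (abs_apply_le_norm (phaseMap N y) 0)
    · filter_upwards [eventually_three_le_abs_arg (continuousAt_rotConj (N := N) 2 3 (x := x)
        (contDiffAt_psiThree (n := 0) h3).continuousAt) h2 (h0 z2)] with y hy
      exact hy.trans (abs_apply_le_norm (phaseMap N y) 1)
  · filter_upwards [eventually_three_le_abs_arg (continuousAt_rotConj (N := N) 4 5 (x := x)
      (contDiff_quadA (n := 0)).continuous.continuousAt) h3 (h0 z3)] with y hy
    exact hy.trans (abs_apply_le_norm (phaseMap N y) 2)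

open Classical in
/-- The lift to `ℝ⁶` of the collapse of the (rescaled) phase map. -/
def phaseLift (N s : ℝ) (x : EucA 6) : EucA 6 :=
  if PhaseRegular N x then liftCollapse (s • phaseMap N x) else farVec

theorem phaseLift_of_regular {s : ℝ} (h : PhaseRegular N x) :
    phaseLift N s x = liftCollapse (s • phaseMap N x) := if_pos h

theorem phaseLift_of_not_regular {s : ℝ} (h : ¬ PhaseRegular N x) : phaseLift N s x = farVec :=
  if_neg h

theorem phaseLift_of_ge {s : ℝ} (hs : 1 ≤ s) (h : 3 ≤ ‖phaseMap N x‖) :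
    phaseLift N s x = farVec := by
  by_cases hr : PhaseRegular N x
  · rw [phaseLift_of_regular hr, liftCollapse_of_ge]
    rw [norm_smul, Real.norm_of_nonneg (by linarith)]
    nlinarith
  · exact phaseLift_of_not_regular hr

theorem farVec_ne_zero : farVec ≠ 0 := fun h => by
  have := congrArg (fun v : EucA 6 => v 2) h
  simp [farVec] at this

theorem phaseLift_ne_zero {s : ℝ} : phaseLift N s x ≠ 0 := by
  by_cases hr : PhaseRegular N x
  · rw [phaseLift_of_regular hr]; exact liftCollapse_ne_zero _
  · rw [phaseLift_of_not_regular hr]; exact farVec_ne_zero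

theorem continuousOn_phaseLift (hN : 1000 ≤ N) :
    ContinuousOn (fun q : ℝ × EucA 6 => phaseLift N q.1 q.2)
      (Ici 1 ×ˢ {x : EucA 6 | 1 / 2 < ‖x‖ ^ 2}) := by
  rintro ⟨s, x⟩ ⟨-, hx⟩
  by_cases hr : PhaseRegular N x
  · have hc : ContinuousAt (fun q : ℝ × EucA 6 => liftCollapse (q.1 • phaseMap N q.2)) (s, x) := by
      refine continuous_liftCollapse.continuousAt.comp (continuousAt_fst.smul ?_)
      exact ContinuousAt.comp (g := phaseMap N) (hr.contDiffAt_phaseMap (n := 0)).continuousAt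
        continuousAt_snd
    refine (hc.congr ?_).continuousWithinAt
    filter_upwards [continuousAt_snd.eventually hr.eventually] with q hq
    exact (phaseLift_of_regular hq).symm
  · refine (continuousWithinAt_const (b := farVec)).congr_of_eventuallyEq ?_
      (phaseLift_of_not_regular hr)
    have h1 : ∀ᶠ q : ℝ × EucA 6 in nhds (s, x), 3 ≤ ‖phaseMap N q.2‖ :=
      continuousAt_snd.eventually (eventually_three_le_norm_phaseMap hN hx hr)
    filter_upwards [nhdsWithin_le_nhds h1, self_mem_nhdsWithin] with q hq hq'
    exact phaseLift_of_ge hq'.1 hq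

/-- The map to `S⁴` obtained by collapsing the phase map, near the unit sphere. -/
def phaseCollapse (N : ℝ) (x : EucA 6) : EucA 5 := joinMap (phaseLift N 1 x)

theorem phaseCollapse_cases (hN : 1000 ≤ N) (hx : 1 / 2 < ‖x‖ ^ 2) :
    (phaseCollapse N =ᶠ[nhds x] fun _ => northPole) ∨
    (PhaseRegular N x ∧ 0 < cylRadius (phaseMap N x) ∧
      phaseCollapse N =ᶠ[nhds x] fun y => ballCollapse (tubeCoord (phaseMap N y))) := by
  by_cases hr : PhaseRegular N x
  · have hk := (hr.contDiffAt_phaseMap (n := 0)).continuousAt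
    rcases (cylRadius_nonneg (phaseMap N x)).eq_or_lt with h0 | h0
    · left
      have h1 : 1 < tubeSq (phaseMap N x) := by
        rw [tubeSq, ← h0]
        nlinarith [sq_nonneg (phaseMap N x 2), sq_nonneg (phaseMap N x 3),
          sq_nonneg (phaseMap N x 4)]
      filter_upwards [hr.eventually, (continuous_tubeSq.continuousAt.comp hk).eventually
        (lt_mem_nhds h1)] with y hy1 hy2
      rw [phaseCollapse, phaseLift_of_regular hy1, one_smul]
      exact joinMap_liftCollapse_of_ge hy2.le
    · refine Or.inr ⟨hr, h0, ?_⟩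
      filter_upwards [hr.eventually, (continuous_cylRadius.continuousAt.comp hk).eventually
        (lt_mem_nhds h0)] with y hy1 hy2
      rw [phaseCollapse, phaseLift_of_regular hy1, one_smul]
      exact joinMap_liftCollapse hy2
  · left
    filter_upwards [eventually_three_le_norm_phaseMap hN hx hr] with y hy
    rw [phaseCollapse, phaseLift_of_ge le_rfl hy, joinMap_farVec]

theorem contDiffAt_phaseCollapse (hN : 1000 ≤ N) (hx : 1 / 2 < ‖x‖ ^ 2) :
    ContDiffAt ℝ 1 (phaseCollapse N) x := by
  rcases phaseCollapse_cases hN hx with h | ⟨hr, h0, h⟩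
  · exact contDiffAt_const.congr_of_eventuallyEq h
  · refine ContDiffAt.congr_of_eventuallyEq ?_ h
    exact (contDiff_ballCollapse (n := 1)).contDiffAt.comp x
      ((contDiffAt_tubeCoord h0).comp x hr.contDiffAt_phaseMap)

/-- A bump function on the line equal to `1` near `1`. -/
def unitBump : ContDiffBump (1 : ℝ) := ⟨1 / 8, 1 / 4, by norm_num, by norm_num⟩

/-- The collapse of the phase map, extended to the whole of `ℝ⁶`. -/
def squeezeMap (N : ℝ) (x : EucA 6) : EucA 5 :=
  northPole + unitBump (‖x‖ ^ 2) • (phaseCollapse N x - northPole)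

theorem contDiff_squeezeMap (hN : 1000 ≤ N) : ContDiff ℝ 1 (squeezeMap N) := by
  rw [contDiff_iff_contDiffAt]
  intro x
  have hn : ContDiff ℝ 1 fun x : EucA 6 => ‖x‖ ^ 2 := contDiff_norm_sq ℝ
  rcases lt_or_ge (1 / 2) (‖x‖ ^ 2) with hx | hx
  · exact contDiffAt_const.add ((unitBump.contDiff.comp hn).contDiffAt.smul
      ((contDiffAt_phaseCollapse hN hx).sub contDiffAt_const))
  · refine (contDiffAt_const (c := northPole)).congr_of_eventuallyEq ?_
    filter_upwards [hn.continuous.continuousAt.eventually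
      (gt_mem_nhds (show ‖x‖ ^ 2 < 3 / 4 by linarith))] with y hy
    have : unitBump (‖y‖ ^ 2) = 0 := unitBump.zero_of_le_dist (by
      rw [Real.dist_eq, abs_sub_comm]
      exact le_trans (show (1 / 4 : ℝ) ≤ 1 - ‖y‖ ^ 2 by linarith) (le_abs_self _))
    rw [squeezeMap, this, zero_smul, add_zero]

theorem squeezeMap_eventuallyEq (hx : x ∈ usph 6) :
    squeezeMap N =ᶠ[nhds x] phaseCollapse N := by
  have hx : ‖x‖ = 1 := by simpa [usph] using hx
  have hn : ContinuousAt (fun x : EucA 6 => ‖x‖ ^ 2) x := by fun_prop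
  have h1 : ∀ᶠ y in nhds x, ‖y‖ ^ 2 ∈ Metric.closedBall (1 : ℝ) (1 / 8) :=
    hn.eventually (Metric.closedBall_mem_nhds_of_mem (by simp [hx]))
  filter_upwards [h1] with y hy
  rw [squeezeMap, unitBump.one_of_mem_closedBall hy, one_smul, add_sub_cancel]

theorem norm_phaseCollapse : ‖phaseCollapse N x‖ = 1 := norm_joinMap phaseLift_ne_zero

end PhaseMap

section Nontrivial

theorem SphereNullhomotopic.of_freelyHomotopic {d₁ d₂ : ℕ} {f g : EucA d₁ → EucA d₂}
    (hf : SphereNullhomotopic f) (h : FreelyHomotopic (usph d₂) f g) : SphereNullhomotopic g := by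
  obtain ⟨y, hy, H, hHc, hHm, hH0, hH1⟩ := hf
  obtain ⟨M, hMc, hMm, hM0, hM1⟩ := h
  refine ⟨y, hy, fun t x => if t ≤ 1 / 2 then M (1 - 2 * t) x else H (2 * t - 1) x,
    ?_, ?_, ?_, ?_⟩
  · have hu : Icc (0 : ℝ) 1 ×ˢ usph d₁ =
        Icc (0 : ℝ) (1 / 2) ×ˢ usph d₁ ∪ Icc (1 / 2 : ℝ) 1 ×ˢ usph d₁ := by
      rw [← union_prod, Icc_union_Icc_eq_Icc (by norm_num) (by norm_num)]
    have hcl : IsClosed (usph d₁) := Metric.isClosed_sphere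
    rw [hu]
    refine ContinuousOn.union_of_isClosed ?_ ?_ (isClosed_Icc.prod hcl) (isClosed_Icc.prod hcl)
    · refine (hMc.comp (f := fun q : ℝ × EucA d₁ => (1 - 2 * q.1, q.2)) (by fun_prop) ?_).congr ?_
      · rintro ⟨t, x⟩ ⟨⟨h1, h2⟩, hx⟩
        dsimp only at h1 h2
        exact ⟨⟨by dsimp only; linarith, by dsimp only; linarith⟩, hx⟩
      · rintro ⟨t, x⟩ ⟨⟨h1, h2⟩, hx⟩
        exact if_pos h2
    · refine (hHc.comp (f := fun q : ℝ × EucA d₁ => (2 * q.1 - 1, q.2)) (by fun_prop) ?_).congr ?_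
      · rintro ⟨t, x⟩ ⟨⟨h1, h2⟩, hx⟩
        dsimp only at h1 h2
        exact ⟨⟨by dsimp only; linarith, by dsimp only; linarith⟩, hx⟩
      · rintro ⟨t, x⟩ ⟨⟨h1, h2⟩, hx⟩
        dsimp only at h1 h2 hx ⊢
        split_ifs with h3
        · have : t = 1 / 2 := le_antisymm h3 h1
          subst this
          norm_num
          rw [hM0 hx, hH0 hx]
        · rfl
  · rintro t ⟨h1, h2⟩ x hx
    dsimp only
    split_ifs with h3
    · exact hMm _ ⟨by linarith, by linarith⟩ hx
    · exact hHm _ ⟨by linarith, by linarith⟩ hx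
  · intro x hx
    norm_num
    exact hM1 hx
  · intro x hx
    norm_num
    exact hH1 hx

/-- The linear map which the lift of the phase map resembles near its core circle. -/
def coreLin : EucA 6 →L[ℝ] EucA 6 :=
  LinearMap.toContinuousLinearMap
    { toFun := fun x => vec6 (x 3) (x 5) (-(x 0 + x 2 + x 4)) (x 0 - x 4) (x 1) (x 2 - x 4)
      map_add' := fun x y => by ext i; fin_cases i <;> simp <;> ring
      map_smul' := fun c x => by ext i; fin_cases i <;> simp <;> ring }

/-- The inverse of `coreLin`. -/
def coreLinInv : EucA 6 →L[ℝ] EucA 6 :=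
  LinearMap.toContinuousLinearMap
    { toFun := fun v => vec6 (-(v 2 + v 3 + v 5) / 3 + v 3) (v 4) (-(v 2 + v 3 + v 5) / 3 + v 5)
        (v 0) (-(v 2 + v 3 + v 5) / 3) (v 1)
      map_add' := fun x y => by ext i; fin_cases i <;> simp <;> ring
      map_smul' := fun c x => by ext i; fin_cases i <;> simp <;> ring }

theorem coreLin_apply (x : EucA 6) :
    coreLin x = vec6 (x 3) (x 5) (-(x 0 + x 2 + x 4)) (x 0 - x 4) (x 1) (x 2 - x 4) := rfl

theorem coreLin_coreLinInv (v : EucA 6) : coreLin (coreLinInv v) = v := by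
  have h : coreLinInv v = vec6 (-(v 2 + v 3 + v 5) / 3 + v 3) (v 4)
    (-(v 2 + v 3 + v 5) / 3 + v 5) (v 0) (-(v 2 + v 3 + v 5) / 3) (v 1) := rfl
  rw [coreLin_apply, h]
  ext i
  fin_cases i <;> simp <;> ring

theorem coreLin_ne_zero {x : EucA 6} (hx : x ≠ 0) : coreLin x ≠ 0 := by
  intro h
  apply hx
  rw [coreLin_apply] at h
  have e0 := congrArg (fun v : EucA 6 => v 0) h
  have e1 := congrArg (fun v : EucA 6 => v 1) h
  have e2 := congrArg (fun v : EucA 6 => v 2) h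
  have e3 := congrArg (fun v : EucA 6 => v 3) h
  have e4 := congrArg (fun v : EucA 6 => v 4) h
  have e5 := congrArg (fun v : EucA 6 => v 5) h
  simp only [vec6_zero, vec6_one, vec6_two, vec6_three, vec6_four, vec6_five,
    PiLp.zero_apply] at e0 e1 e2 e3 e4 e5
  ext i
  fin_cases i <;> simp <;> linarith

theorem phaseGap_zero_of_pos (N : ℝ) {t : ℝ} (ht : 0 < t) : phaseGap N 0 t = 0 := by
  simp [phaseGap, rotConj, Complex.arg_ofReal_of_nonneg ht.le]

theorem phaseRegular_diagonal (N : ℝ) {x : EucA 6} (h0 : 0 < x 0) (h1 : x 1 = 0) (h2 : x 2 = x 0)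
    (h3 : x 3 = 0) (h4 : x 4 = x 0) (h5 : x 5 = 0) : PhaseRegular N x ∧ phaseMap N x = 0 := by
  have hz1 : zc 0 1 x = (x 0 : ℝ) := by simp [zc, h1]
  have hz2 : zc 2 3 x = (x 0 : ℝ) := by simp [zc, h2, h3]
  have hz3 : zc 4 5 x = (x 0 : ℝ) := by simp [zc, h4, h5]
  have hA : quadA x = 0 := by simp [quadA, h1, h4, h5]
  have hB : quadB x = 0 := by simp [quadB, h2, h3, h4, h5]
  have hg := phaseGap_zero_of_pos N h0
  have p3 : psiThree N x = 0 := by simp [psiThree, hA, hz3, phaseNear, hg]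
  have p2 : psiTwo N x = 0 := by simp [psiTwo, p3, hz2, phaseNear, hg]
  have p1 : psiOne N x = 0 := by simp [psiOne, p2, hz1, phaseNear, hg]
  have hs : rotConj N 0 (x 0 : ℝ) ∈ Complex.slitPlane := by
    simp [rotConj, h0]
  constructor
  · rw [PhaseRegular, hA, p3, p2, hz1, hz2, hz3]; exact ⟨hs, hs, hs⟩
  · ext i
    rw [phaseMap, hA, p3, p2, p1, hB, hz1, hz2, hz3, hg]
    fin_cases i <;> simp

theorem liftCollapse_zero_apply_two : liftCollapse 0 2 = -2 := by
  have h1 : farCut 0 = 0 := farCut_of_le (by simp)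
  have h2 : cylRadius 0 = 0 := by simp [cylRadius]
  simp [liftCollapse, h1, h2]

theorem eq_zero_of_add_sin_eq_zero {a b ψ : ℝ} (ha : 0 ≤ a) (hb : 0 < b) (hψ : |ψ| ≤ 3)
    (h : a * ψ + b * Real.sin ψ = 0) : ψ = 0 := by
  have hpi := Real.pi_gt_three
  rw [abs_le] at hψ
  rcases lt_trichotomy ψ 0 with h1 | h1 | h1
  · have := Real.sin_neg_of_neg_of_neg_pi_lt h1 (by linarith)
    nlinarith
  · exact h1
  · have := Real.sin_pos_of_pos_of_lt_pi h1 (by linarith)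
    nlinarith

theorem abs_le_three_of_abs_mul_sub_le {N u v : ℝ} (hN : 2 ≤ N) (hu : |u| ≤ 3)
    (hv : |N * v - u| ≤ 3) : |v| ≤ 3 := by
  have h1 := abs_sub_abs_le_abs_sub (N * v) u
  rw [abs_mul, abs_of_pos (show 0 < N by linarith)] at h1
  nlinarith [abs_nonneg v]

theorem phaseLift_add_smul_ne_zero {N c : ℝ} {x : EucA 6} (hN : 1000 ≤ N) (hc : 0 < c) :
    phaseLift N (N ^ 3) x + c • coreLin x ≠ 0 := by
  intro h
  have hN0 : 0 < N := by linarith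
  suffices hd : 0 < x 0 ∧ x 1 = 0 ∧ x 2 = x 0 ∧ x 3 = 0 ∧ x 4 = x 0 ∧ x 5 = 0 by
    obtain ⟨h0, h1, h2, h3, h4, h5⟩ := hd
    obtain ⟨hr, hk⟩ := phaseRegular_diagonal N h0 h1 h2 h3 h4 h5
    have e2 := congrArg (fun v : EucA 6 => v 2) h
    rw [phaseLift_of_regular hr, hk, smul_zero, coreLin_apply] at e2
    simp [liftCollapse_zero_apply_two, h2, h4] at e2
    nlinarith
  have key : (PhaseRegular N x ∧ farCut (N ^ 3 • phaseMap N x) < 1) ∨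
      phaseLift N (N ^ 3) x = farVec := by
    by_cases hr : PhaseRegular N x
    · rcases (farCut_mem (N ^ 3 • phaseMap N x)).2.lt_or_eq with hl | hl
      · exact Or.inl ⟨hr, hl⟩
      · rw [phaseLift_of_regular hr]; exact Or.inr (liftCollapse_of_farCut hl)
    · exact Or.inr (phaseLift_of_not_regular hr)
  rcases key with ⟨hr, hl⟩ | hf
  · rw [phaseLift_of_regular hr, coreLin_apply] at h
    have hy : ‖N ^ 3 • phaseMap N x‖ < 3 := by
      by_contra! h3
      rw [farCut_of_ge h3] at hl
      exact lt_irrefl _ hl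
    set y := N ^ 3 • phaseMap N x with hydef
    have e0 := congrArg (fun v : EucA 6 => v 0) h
    have e1 := congrArg (fun v : EucA 6 => v 1) h
    have e3 := congrArg (fun v : EucA 6 => v 3) h
    have e4 := congrArg (fun v : EucA 6 => v 4) h
    have e5 := congrArg (fun v : EucA 6 => v 5) h
    simp only [liftCollapse, vec6_zero, vec6_one, vec6_three, vec6_four, vec6_five,
      PiLp.zero_apply, PiLp.add_apply, PiLp.smul_apply, smul_eq_mul] at e0 e1 e3 e4 e5
    have hη := Real.smoothTransition.nonneg (1 - tubeSq y)
    have hmax : 0 < max (cylRadius y) (1 / 2) := lt_max_of_lt_right (by norm_num)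
    generalize Real.smoothTransition (1 - tubeSq y) = η at e0 e1 hη
    generalize max (cylRadius y) (1 / 2) = r at e0 e1 hmax
    set l := 1 - farCut y with hldef
    have hl0 : 0 < l := by rw [hldef]; linarith
    have y0 : y 0 = N ^ 3 * (N * psiTwo N x - psiOne N x) := by
      simp [hydef, phaseMap, psiOne, phaseNear]
    have y1 : y 1 = N ^ 3 * (N * psiThree N x - psiTwo N x) := by
      simp [hydef, phaseMap, psiTwo, phaseNear]
    have y2 : y 2 = N ^ 3 * (N * quadA x - psiThree N x) := by
      simp [hydef, phaseMap, psiThree, phaseNear]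
    have y3 : y 3 = 40 * psiOne N x := by
      simp [hydef, phaseMap]; field_simp
    have y4 : y 4 = N ^ 3 * (40 * quadB x) := by simp [hydef, phaseMap]
    have hN3 : 1 ≤ N ^ 3 := one_le_pow₀ (by linarith)
    have b0 := (abs_apply_le_norm y 0).trans hy.le
    have b1 := (abs_apply_le_norm y 1).trans hy.le
    have b3 := (abs_apply_le_norm y 3).trans hy.le
    rw [y0, abs_mul, abs_of_pos (by positivity)] at b0
    rw [y1, abs_mul, abs_of_pos (by positivity)] at b1
    rw [y3, abs_mul, abs_of_pos (by positivity)] at b3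
    have b0' : |N * psiTwo N x - psiOne N x| ≤ 3 := by
      nlinarith [abs_nonneg (N * psiTwo N x - psiOne N x)]
    have b1' : |N * psiThree N x - psiTwo N x| ≤ 3 := by
      nlinarith [abs_nonneg (N * psiThree N x - psiTwo N x)]
    have c1 : |psiOne N x| ≤ 3 := by linarith [abs_nonneg (psiOne N x)]
    have c2 : |psiTwo N x| ≤ 3 := abs_le_three_of_abs_mul_sub_le (by linarith) c1 b0'
    have c3 : |psiThree N x| ≤ 3 := abs_le_three_of_abs_mul_sub_le (by linarith) c2 b1'
    have R1 := norm_pos_iff.2 (zc_ne_zero_of_mem hr.2.2)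
    have R2 := norm_pos_iff.2 (zc_ne_zero_of_mem hr.2.1)
    have R3 := norm_pos_iff.2 (zc_ne_zero_of_mem hr.1)
    have s1 : x 1 = ‖zc 0 1 x‖ * Real.sin (psiOne N x) := by
      rw [psiOne, ← im_eq_norm_mul_sin, zc_im]
    have s2 : x 3 = ‖zc 2 3 x‖ * Real.sin (psiTwo N x) := by
      rw [psiTwo, ← im_eq_norm_mul_sin, zc_im]
    have s3 : x 5 = ‖zc 4 5 x‖ * Real.sin (psiThree N x) := by
      rw [psiThree, ← im_eq_norm_mul_sin, zc_im]
    have t1 : x 0 = ‖zc 0 1 x‖ * Real.cos (psiOne N x) := by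
      rw [psiOne, ← re_eq_norm_mul_cos, zc_re]
    have t2 : x 2 = ‖zc 2 3 x‖ * Real.cos (psiTwo N x) := by
      rw [psiTwo, ← re_eq_norm_mul_cos, zc_re]
    have t3 : x 4 = ‖zc 4 5 x‖ * Real.cos (psiThree N x) := by
      rw [psiThree, ← re_eq_norm_mul_cos, zc_re]
    have p1 : psiOne N x = 0 :=
      eq_zero_of_add_sin_eq_zero (a := 40 * l) (b := c * ‖zc 0 1 x‖) (by positivity)
        (by positivity) c1 (by rw [y3, s1] at e4; linear_combination e4)
    have p2 : psiTwo N x = 0 :=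
      eq_zero_of_add_sin_eq_zero (a := l * η * N ^ 4 / r) (b := c * ‖zc 2 3 x‖) (by positivity)
        (by positivity) c2 (by rw [y0, s2, p1] at e0; rw [← e0]; ring)
    have p3 : psiThree N x = 0 :=
      eq_zero_of_add_sin_eq_zero (a := l * η * N ^ 4 / r) (b := c * ‖zc 4 5 x‖) (by positivity)
        (by positivity) c3 (by rw [y1, s3, p2] at e1; rw [← e1]; ring)
    rw [p1, Real.sin_zero, mul_zero] at s1
    rw [p2, Real.sin_zero, mul_zero] at s2
    rw [p3, Real.sin_zero, mul_zero] at s3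
    rw [p1, Real.cos_zero, mul_one] at t1
    rw [p2, Real.cos_zero, mul_one] at t2
    rw [p3, Real.cos_zero, mul_one] at t3
    have x0 : 0 < x 0 := t1 ▸ R1
    have x2 : 0 < x 2 := t2 ▸ R2
    have x4 : 0 < x 4 := t3 ▸ R3
    rw [y2, p3, quadA, s1, s3] at e3
    rw [y4, quadB, s2, s3] at e5
    have d0 : x 0 - x 4 = 0 := by
      have : (x 0 - x 4) * (2 * l * N ^ 4 * (x 0 + x 4) + c) = 0 := by linear_combination e3
      exact (mul_eq_zero.1 this).resolve_right (by positivity)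
    have d2 : x 2 - x 4 = 0 := by
      have : (x 2 - x 4) * (40 * l * N ^ 3 * (x 2 + x 4) + c) = 0 := by linear_combination e5
      exact (mul_eq_zero.1 this).resolve_right (by positivity)
    exact ⟨x0, s1, by linarith, s2, by linarith, s3⟩
  · rw [hf, coreLin_apply] at h
    have e0 := congrArg (fun v : EucA 6 => v 0) h
    have e1 := congrArg (fun v : EucA 6 => v 1) h
    have e2 := congrArg (fun v : EucA 6 => v 2) h
    have e3 := congrArg (fun v : EucA 6 => v 3) h
    have e4 := congrArg (fun v : EucA 6 => v 4) h
    have e5 := congrArg (fun v : EucA 6 => v 5) h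
    simp [farVec, hc.ne'] at e0 e1 e2 e3 e4 e5
    have e6 : x 4 = x 0 := by linarith
    have e7 : x 2 = x 0 := by linarith
    rw [e6, e7] at e2
    exact ⟨by nlinarith, e4, e7, e0, e6, e1⟩

/-- The segment homotopy from the lift of the phase map to `coreLin`, after rescaling the
phase map. -/
def liftHomotopy (N t : ℝ) (x : EucA 6) : EucA 6 :=
  (1 - max 0 (2 * t - 1)) • phaseLift N (1 + (N ^ 3 - 1) * min 1 (2 * t)) x +
    max 0 (2 * t - 1) • coreLin x

theorem liftHomotopy_ne_zero {N t : ℝ} {x : EucA 6} (hN : 1000 ≤ N) (ht1 : t ≤ 1) (hx : x ≠ 0) :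
    liftHomotopy N t x ≠ 0 := by
  rw [liftHomotopy]
  rcases le_or_gt (2 * t) 1 with h1 | h1
  · rw [max_eq_left (by linarith), zero_smul, add_zero, sub_zero, one_smul]
    exact phaseLift_ne_zero
  · rw [max_eq_right (by linarith), min_eq_left h1.le, mul_one, add_sub_cancel]
    rcases ht1.lt_or_eq with h2 | rfl
    · intro h
      have h3 : 0 < 1 - (2 * t - 1) := by linarith
      refine phaseLift_add_smul_ne_zero (N := N) (x := x) hN
        (div_pos (show 0 < 2 * t - 1 by linarith) h3) ?_
      have h4 := congrArg (fun v => (1 - (2 * t - 1))⁻¹ • v) h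
      simp only [smul_add, smul_smul, inv_mul_cancel₀ h3.ne', one_smul, smul_zero] at h4
      rw [div_eq_inv_mul, h4]
    · norm_num
      exact coreLin_ne_zero hx

theorem continuousOn_liftHomotopy {N : ℝ} (hN : 1000 ≤ N) :
    ContinuousOn (fun q : ℝ × EucA 6 => liftHomotopy N q.1 q.2) (Icc 0 1 ×ˢ usph 6) := by
  have hN3 : 1 ≤ N ^ 3 := one_le_pow₀ (by linarith)
  have hf : Continuous fun q : ℝ × EucA 6 => (1 + (N ^ 3 - 1) * min 1 (2 * q.1), q.2) := by
    fun_prop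
  have hc : ContinuousOn (fun q : ℝ × EucA 6 =>
      phaseLift N (1 + (N ^ 3 - 1) * min 1 (2 * q.1)) q.2) (Icc 0 1 ×ˢ usph 6) := by
    refine (continuousOn_phaseLift hN).comp hf.continuousOn ?_
    rintro ⟨t, x⟩ ⟨⟨ht0, ht1⟩, hx⟩
    have hx : ‖x‖ = 1 := by simpa [usph] using hx
    have h1 : 0 ≤ min 1 (2 * t) := le_min zero_le_one (mul_nonneg zero_le_two ht0)
    have h2 := mul_nonneg (sub_nonneg.2 hN3) h1
    refine ⟨mem_Ici.2 ?_, ?_⟩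
    · dsimp only; linarith
    · simp only [Set.mem_ofPred_eq, hx]; norm_num
  have h1 : Continuous fun q : ℝ × EucA 6 => 1 - max 0 (2 * q.1 - 1) := by fun_prop
  have h2 : Continuous fun q : ℝ × EucA 6 => max 0 (2 * q.1 - 1) • coreLin q.2 := by fun_prop
  exact (h1.continuousOn.smul hc).add h2.continuousOn

theorem freelyHomotopic_phaseCollapse {N : ℝ} (hN : 1000 ≤ N) :
    FreelyHomotopic (usph 5) (phaseCollapse N) fun x => joinMap (coreLin x) := by
  have hne : ∀ x ∈ usph 6, x ≠ 0 := by
    rintro x hx rfl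
    simp [usph] at hx
  refine ⟨fun t x => joinMap (liftHomotopy N t x), ?_, ?_, ?_, ?_⟩
  · exact continuousOn_joinMap.comp (continuousOn_liftHomotopy hN)
      fun q hq => liftHomotopy_ne_zero hN hq.1.2 (hne _ hq.2)
  · intro t ht x hx
    simpa [usph] using norm_joinMap (liftHomotopy_ne_zero hN ht.2 (hne x hx))
  · intro x hx
    simp [phaseCollapse, liftHomotopy]
  · intro x hx
    norm_num [liftHomotopy]

theorem not_sphereNullhomotopic_squeezeMap {N : ℝ} (hN : 1000 ≤ N) :
    ¬ SphereNullhomotopic (squeezeMap N) := by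
  intro h
  refine not_sphereNullhomotopic_joinMap coreLin_coreLinInv (h.of_freelyHomotopic ?_)
  obtain ⟨H, h1, h2, h3, h4⟩ := freelyHomotopic_phaseCollapse hN
  exact ⟨H, h1, h2, fun x hx => (h3 hx).trans (squeezeMap_eventuallyEq hx).eq_of_nhds.symm, h4⟩

end Nontrivial

section Dilation

theorem lamNorm_four_comp_le {E : Type*} [NormedAddCommGroup E] [InnerProductSpace ℝ E]
    {A : E →ₗ[ℝ] EucA 5} {P : E →ₗ[ℝ] EucA 4} {B : EucA 4 →L[ℝ] EucA 5} {b : ℝ} {r : Fin 4 → ℝ}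
    (hA : ∀ v, A v = B (P v)) (hB : ‖B‖ ≤ b) (hr : ∀ i, 0 < r i)
    (hP : ∀ v i, |P v i| ≤ r i * ‖v‖) : lamNorm 4 A ≤ 120 * b ^ 4 * ∏ i, r i := by
  have hb : 0 ≤ b := (norm_nonneg B).trans hB
  have hr0 : 0 ≤ ∏ i, r i := Finset.prod_nonneg fun i _ => (hr i).le
  refine Real.iSup_le ?_ (by positivity)
  rintro ⟨v, hv⟩
  set G : Matrix (Fin 4) (Fin 4) ℝ := Matrix.of fun k l =>
    ⟪B (EuclideanSpace.single k 1), B (EuclideanSpace.single l 1)⟫ with hG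
  set Q : Matrix (Fin 4) (Fin 4) ℝ := Matrix.of fun i k => P (v i) k / r k with hQ
  have hexp : ∀ u : EucA 4, B u = ∑ k, u k • B (EuclideanSpace.single k 1) := by
    intro u
    conv_lhs => rw [← (EuclideanSpace.basisFun (Fin 4) ℝ).sum_repr u]
    simp
  have hgram : (Matrix.of fun i j : Fin 4 => ⟪A (v i), A (v j)⟫) =
      (Q * Matrix.diagonal r) * G * (Q * Matrix.diagonal r).transpose := by
    ext i j
    have hQr : ∀ i k, (Q * Matrix.diagonal r) i k = P (v i) k := fun i k => by
      rw [Matrix.mul_diagonal, hQ, Matrix.of_apply, div_mul_cancel₀ _ (hr k).ne']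
    simp only [Matrix.of_apply, Matrix.mul_apply (M := Q * Matrix.diagonal r * G),
      Matrix.mul_apply (M := Q * Matrix.diagonal r), Matrix.transpose_apply, hQr]
    rw [hA, hA, hexp (P (v i)), hexp (P (v j)), inner_sum]
    refine Finset.sum_congr rfl fun l _ => ?_
    rw [sum_inner, Finset.sum_mul]
    refine Finset.sum_congr rfl fun k _ => ?_
    rw [inner_smul_left, inner_smul_right, hG, Matrix.of_apply]
    simp only [conj_trivial]
    ring
  have hQ1 : |Q.det| ≤ 24 := by
    have := Matrix.det_le (A := Q) (abv := AbsoluteValue.abs) (x := 1) fun i k => by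
      rw [hQ, Matrix.of_apply]
      change |P (v i) k / r k| ≤ 1
      rw [abs_div, abs_of_pos (hr k), div_le_one (hr k)]
      simpa [hv.1 i] using hP (v i) k
    simpa [Nat.factorial] using this
  have hG1 : |G.det| ≤ 24 * (b ^ 2) ^ 4 := by
    have := Matrix.det_le (A := G) (abv := AbsoluteValue.abs) (x := b ^ 2) fun i k => by
      rw [hG, Matrix.of_apply]
      refine (abs_real_inner_le_norm _ _).trans ?_
      rw [sq]
      have hs : ∀ k : Fin 4, ‖B (EuclideanSpace.single k 1)‖ ≤ b := fun k =>
        (B.le_opNorm _).trans (by simpa using hB)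
      exact mul_le_mul (hs i) (hs k) (norm_nonneg _) hb
    simpa [Nat.factorial] using this
  rw [hgram, Matrix.det_mul, Matrix.det_mul, Matrix.det_transpose, Matrix.det_mul,
    Matrix.det_diagonal]
  refine Real.sqrt_le_iff.2 ⟨by positivity, ?_⟩
  have hq2 : Q.det ^ 2 ≤ 24 ^ 2 := by
    rw [← sq_abs]; exact pow_le_pow_left₀ (abs_nonneg _) hQ1 2
  calc Q.det * (∏ i, r i) * G.det * (Q.det * ∏ i, r i)
      = (∏ i, r i) ^ 2 * (Q.det ^ 2 * G.det) := by ring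
    _ ≤ (∏ i, r i) ^ 2 * (24 ^ 2 * (24 * (b ^ 2) ^ 4)) := by
        refine mul_le_mul_of_nonneg_left ?_ (by positivity)
        exact mul_le_mul_of_nonneg hq2 ((le_abs_self _).trans hG1) (sq_nonneg _) (by positivity)
    _ = (∏ i, r i) ^ 2 * b ^ 8 * 13824 := by ring
    _ ≤ (∏ i, r i) ^ 2 * b ^ 8 * 14400 := by gcongr; norm_num
    _ = _ := by ring

theorem abs_fderiv_phase_le {ψ R : EucA 6 → ℝ} {i j : Fin 6} {x : EucA 6}
    (hψ : DifferentiableAt ℝ ψ x) (hi : ∀ y, y i = R y * Real.cos (ψ y))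
    (hj : ∀ y, y j = R y * Real.sin (ψ y)) (v : EucA 6) :
    R x * |fderiv ℝ ψ x v| ≤ 2 * ‖v‖ := by
  have hp : ∀ k, HasFDerivAt (fun y : EucA 6 => y k) (EuclideanSpace.proj k : EucA 6 →L[ℝ] ℝ) x :=
    fun k => (EuclideanSpace.proj k : EucA 6 →L[ℝ] ℝ).hasFDerivAt
  have h1 := ((hp i).mul hψ.hasFDerivAt.sin).sub ((hp j).mul hψ.hasFDerivAt.cos)
  have h0 : ((fun y : EucA 6 => y i) * (fun y => Real.sin (ψ y)) -
      (fun y : EucA 6 => y j) * fun y => Real.cos (ψ y)) = fun _ => (0 : ℝ) := by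
    funext y
    simp only [Pi.sub_apply, Pi.mul_apply]
    rw [hi, hj]; ring
  rw [h0] at h1
  have h2 := congrArg (fun L : EucA 6 →L[ℝ] ℝ => L v) (h1.unique (hasFDerivAt_const (0 : ℝ) x))
  simp at h2
  have h3 : R x * fderiv ℝ ψ x v = v j * Real.cos (ψ x) - v i * Real.sin (ψ x) := by
    rw [hi, hj] at h2
    linear_combination h2 - R x * fderiv ℝ ψ x v * Real.sin_sq_add_cos_sq (ψ x)
  have hi' := abs_apply_le_norm v i
  have hj' := abs_apply_le_norm v j
  have h4 : |R x * fderiv ℝ ψ x v| ≤ 2 * ‖v‖ := by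
    rw [h3]
    refine (abs_sub _ _).trans ?_
    rw [abs_mul, abs_mul]
    nlinarith [Real.abs_cos_le_one (ψ x), Real.abs_sin_le_one (ψ x), abs_nonneg (v i),
      abs_nonneg (v j), abs_nonneg (Real.cos (ψ x)), abs_nonneg (Real.sin (ψ x))]
  rw [abs_mul] at h4
  exact (mul_le_mul_of_nonneg_right (le_abs_self _) (abs_nonneg _)).trans h4

theorem exists_bound_fderiv_ballCollapse :
    ∃ C : ℝ, 0 < C ∧ ∀ u : EucA 4, ‖u‖ ≤ 1 → ‖fderiv ℝ ballCollapse u‖ ≤ C := by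
  obtain ⟨C, hC⟩ := (isCompact_closedBall (0 : EucA 4) 1).exists_bound_of_continuousOn
    ((contDiff_ballCollapse (n := 1)).continuous_fderiv (by norm_num)).continuousOn
  exact ⟨max C 1, by positivity, fun u hu => (hC u (by simpa using hu)).trans (le_max_left _ _)⟩

theorem exists_bound_fderiv_tubeCoord :
    ∃ C : ℝ, 0 < C ∧ ∀ y : EucA 5, 1 / 2 ≤ cylRadius y → ‖y‖ ≤ 2 →
      ‖fderiv ℝ tubeCoord y‖ ≤ C := by
  have hK : IsCompact (Metric.closedBall (0 : EucA 5) 2 ∩ {y | 1 / 2 ≤ cylRadius y}) :=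
    (isCompact_closedBall _ _).inter_right (isClosed_le continuous_const continuous_cylRadius)
  have hc : ContinuousOn (fderiv ℝ tubeCoord)
      (Metric.closedBall (0 : EucA 5) 2 ∩ {y | 1 / 2 ≤ cylRadius y}) := by
    rintro y ⟨-, hy⟩
    have hy : 0 < cylRadius y := lt_of_lt_of_le (by norm_num) (show 1 / 2 ≤ cylRadius y from hy)
    exact ((contDiffAt_tubeCoord (n := 1) hy).continuousAt_fderiv
      (by norm_num)).continuousWithinAt
  obtain ⟨C, hC⟩ := hK.exists_bound_of_continuousOn hc
  exact ⟨max C 1, by positivity, fun y h1 h2 =>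
    (hC y ⟨by simpa using h2, h1⟩).trans (le_max_left _ _)⟩

theorem norm_sq_zc (i j : Fin 6) (x : EucA 6) : ‖zc i j x‖ ^ 2 = x i ^ 2 + x j ^ 2 := by
  rw [Complex.sq_norm, Complex.normSq_apply, zc_re, zc_im]; ring

theorem abs_fderiv_phaseNear_le {N : ℝ} {θ : EucA 6 → ℝ} {i j : Fin 6} {x : EucA 6}
    (h : DifferentiableAt ℝ (fun y => phaseNear N (θ y) (zc i j y)) x)
    (hz : 4 / 25 ≤ x i ^ 2 + x j ^ 2) (v : EucA 6) :
    |fderiv ℝ (fun y => phaseNear N (θ y) (zc i j y)) x v| ≤ 5 * ‖v‖ := by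
  have h1 := abs_fderiv_phase_le (R := fun y => ‖zc i j y‖) (i := i) (j := j) h
    (fun y => by rw [← re_eq_norm_mul_cos, zc_re]) (fun y => by rw [← im_eq_norm_mul_sin, zc_im]) v
  have h2 : 2 / 5 ≤ ‖zc i j x‖ := by
    rw [← norm_sq_zc] at hz
    nlinarith [norm_nonneg (zc i j x)]
  have := mul_le_mul_of_nonneg_right h2
    (abs_nonneg (fderiv ℝ (fun y => phaseNear N (θ y) (zc i j y)) x v))
  linarith

theorem abs_fderiv_quad_le {f : EucA 6 → ℝ} {i j : Fin 6}
    (hf : ∀ x, f x = x i ^ 2 + x j ^ 2 - x 4 ^ 2 - x 5 ^ 2) {x : EucA 6} (hx : ‖x‖ = 1)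
    (v : EucA 6) : |fderiv ℝ f x v| ≤ 8 * ‖v‖ := by
  have hp : ∀ k, HasFDerivAt (fun y : EucA 6 => y k) (EuclideanSpace.proj k : EucA 6 →L[ℝ] ℝ) x :=
    fun k => (EuclideanSpace.proj k : EucA 6 →L[ℝ] ℝ).hasFDerivAt
  have h1 := ((((hp i).pow 2).add ((hp j).pow 2)).sub ((hp 4).pow 2)).sub ((hp 5).pow 2)
  have h2 := (h1.congr_of_eventuallyEq (Filter.Eventually.of_forall hf)).fderiv
  have h3 : fderiv ℝ f x v = 2 * (x i * v i) + 2 * (x j * v j) - 2 * (x 4 * v 4)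
      - 2 * (x 5 * v 5) := by
    rw [h2]; simp; ring
  have hk : ∀ k, |x k * v k| ≤ ‖v‖ := fun k => by
    have a1 := abs_apply_le_norm x k
    have a2 := abs_apply_le_norm v k
    rw [abs_mul]
    nlinarith [abs_nonneg (v k)]
  have e1 := abs_le.1 (hk i)
  have e2 := abs_le.1 (hk j)
  have e3 := abs_le.1 (hk 4)
  have e4 := abs_le.1 (hk 5)
  rw [h3, abs_le]
  constructor <;> linarith

variable {N : ℝ} {x : EucA 6}

/-- Near the preimage of the tube, the complex coordinates are bounded away from zero. -/
theorem coords_of_tubeSq_le (hN : 1000 ≤ N) (hx : ‖x‖ = 1) (ht : tubeSq (phaseMap N x) ≤ 1) :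
    4 / 25 ≤ x 0 ^ 2 + x 1 ^ 2 ∧ 4 / 25 ≤ x 2 ^ 2 + x 3 ^ 2 ∧ 4 / 25 ≤ x 4 ^ 2 + x 5 ^ 2 := by
  unfold tubeSq at ht
  have e3 : phaseMap N x 3 = 40 * (psiOne N x / N ^ 3) := rfl
  have e4 : phaseMap N x 4 = 40 * quadB x := rfl
  rw [e3, e4] at ht
  have h1 := abs_psiOne_div_sub_le (N := N) (x := x) (by linarith)
  have h2 : 12 / N ≤ 12 / 1000 := div_le_div_of_nonneg_left (by norm_num) (by norm_num) hN
  have h3 : (40 * (psiOne N x / N ^ 3)) ^ 2 ≤ 1 ^ 2 := by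
    nlinarith [sq_nonneg (cylRadius (phaseMap N x) - 1), sq_nonneg (phaseMap N x 2),
      sq_nonneg (40 * quadB x)]
  have h4 : (40 * quadB x) ^ 2 ≤ 1 ^ 2 := by
    nlinarith [sq_nonneg (cylRadius (phaseMap N x) - 1), sq_nonneg (phaseMap N x 2),
      sq_nonneg (40 * (psiOne N x / N ^ 3))]
  have h5 := abs_le_of_sq_le_sq' h3 zero_le_one
  have h6 := abs_le_of_sq_le_sq' h4 zero_le_one
  have h7 := abs_le.1 (h1.trans h2)
  have h8 := norm_sq_eucA6 x
  rw [hx] at h8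
  unfold quadA at h7
  unfold quadB at h6
  refine ⟨?_, ?_, ?_⟩ <;> linarith [h5.1, h5.2, h6.1, h6.2, h7.1, h7.2]

theorem fderiv_apply_coord {d e : ℕ} {f : EucA d → EucA e} {x : EucA d}
    (hf : DifferentiableAt ℝ f x) (v : EucA d) (i : Fin e) :
    fderiv ℝ f x v i = fderiv ℝ (fun y => f y i) x v := by
  have := ((EuclideanSpace.proj i : EucA e →L[ℝ] ℝ).hasFDerivAt.comp x hf.hasFDerivAt).fderiv
  change _ = fderiv ℝ ((EuclideanSpace.proj i : EucA e →L[ℝ] ℝ) ∘ f) x v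
  rw [this]; rfl

/-- Bounds on the derivative of the phase map near the preimage of the tube. -/
theorem fderiv_phaseMap_bounds (hN : 1000 ≤ N) (hx : ‖x‖ = 1) (hr : PhaseRegular N x)
    (ht : tubeSq (phaseMap N x) ≤ 1) (v : EucA 6) :
    ‖fderiv ℝ (phaseMap N) x v‖ ≤ 20 * N * ‖v‖ ∧
    |fderiv ℝ (phaseMap N) x v 3| ≤ 200 / N ^ 3 * ‖v‖ ∧
    |fderiv ℝ (phaseMap N) x v 4| ≤ 320 * ‖v‖ := by
  obtain ⟨z1, z2, z3⟩ := coords_of_tubeSq_le hN hx ht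
  have hN0 : 0 < N := by linarith
  have hd : DifferentiableAt ℝ (phaseMap N) x :=
    (hr.contDiffAt_phaseMap (n := 1)).differentiableAt (by norm_num)
  have d3 : DifferentiableAt ℝ (psiThree N) x :=
    (contDiffAt_psiThree (n := 1) hr.1).differentiableAt (by norm_num)
  have d2 : DifferentiableAt ℝ (psiTwo N) x :=
    (contDiffAt_psiTwo (n := 1) hr.1 hr.2.1).differentiableAt (by norm_num)
  have d1 : DifferentiableAt ℝ (psiOne N) x :=
    (hr.contDiffAt_psiOne (n := 1)).differentiableAt (by norm_num)
  have dA : DifferentiableAt ℝ quadA x :=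
    (contDiff_quadA (n := 1)).contDiffAt.differentiableAt (by norm_num)
  have dB : DifferentiableAt ℝ quadB x :=
    (contDiff_quadB (n := 1)).contDiffAt.differentiableAt (by norm_num)
  have b3 : |fderiv ℝ (psiThree N) x v| ≤ 5 * ‖v‖ := abs_fderiv_phaseNear_le d3 z3 v
  have b2 : |fderiv ℝ (psiTwo N) x v| ≤ 5 * ‖v‖ := abs_fderiv_phaseNear_le d2 z2 v
  have b1 : |fderiv ℝ (psiOne N) x v| ≤ 5 * ‖v‖ := abs_fderiv_phaseNear_le d1 z1 v
  have bA : |fderiv ℝ quadA x v| ≤ 8 * ‖v‖ := abs_fderiv_quad_le (fun _ => rfl) hx v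
  have bB : |fderiv ℝ quadB x v| ≤ 8 * ‖v‖ := abs_fderiv_quad_le (fun _ => rfl) hx v
  have gap : ∀ {f g : EucA 6 → ℝ} {i : Fin 5}, DifferentiableAt ℝ f x → DifferentiableAt ℝ g x →
      (∀ y, phaseMap N y i = N * f y - g y) → |fderiv ℝ f x v| ≤ 8 * ‖v‖ →
      |fderiv ℝ g x v| ≤ 5 * ‖v‖ → |fderiv ℝ (phaseMap N) x v i| ≤ 10 * N * ‖v‖ := by
    intro f g i hf hg h hfv hgv
    have hfg : fderiv ℝ (fun y => N * f y - g y) x = N • fderiv ℝ f x - fderiv ℝ g x :=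
      ((hf.hasFDerivAt.const_mul N).sub hg.hasFDerivAt).fderiv
    rw [fderiv_apply_coord hd, funext h, hfg]
    change |N * fderiv ℝ f x v - fderiv ℝ g x v| ≤ _
    refine (abs_sub _ _).trans ?_
    rw [abs_mul, abs_of_pos hN0]
    nlinarith [norm_nonneg v]
  have g0 : |fderiv ℝ (phaseMap N) x v 0| ≤ 10 * N * ‖v‖ :=
    gap d2 d1 (fun y => by simp [phaseMap, psiOne, phaseNear]) (by linarith [norm_nonneg v]) b1
  have g1 : |fderiv ℝ (phaseMap N) x v 1| ≤ 10 * N * ‖v‖ :=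
    gap d3 d2 (fun y => by simp [phaseMap, psiTwo, phaseNear]) (by linarith [norm_nonneg v]) b2
  have g2 : |fderiv ℝ (phaseMap N) x v 2| ≤ 10 * N * ‖v‖ :=
    gap dA d3 (fun y => by simp [phaseMap, psiThree, phaseNear]) bA b3
  have g3 : |fderiv ℝ (phaseMap N) x v 3| ≤ 200 / N ^ 3 * ‖v‖ := by
    rw [fderiv_apply_coord hd, show (fun y => phaseMap N y 3) = fun y => 40 / N ^ 3 * psiOne N y from
      funext fun y => by simp [phaseMap]; ring, (d1.hasFDerivAt.const_mul _).fderiv]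
    rw [smul_apply, smul_eq_mul, abs_mul, abs_of_pos (by positivity)]
    calc _ ≤ 40 / N ^ 3 * (5 * ‖v‖) := mul_le_mul_of_nonneg_left b1 (by positivity)
      _ = _ := by ring
  have g4 : |fderiv ℝ (phaseMap N) x v 4| ≤ 320 * ‖v‖ := by
    rw [fderiv_apply_coord hd, show (fun y => phaseMap N y 4) = fun y => 40 * quadB y from
      funext fun y => by simp [phaseMap], (dB.hasFDerivAt.const_mul _).fderiv]
    rw [smul_apply, smul_eq_mul, abs_mul, abs_of_pos (by norm_num)]
    linarith
  refine ⟨?_, g3, g4⟩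
  have hw : 200 / N ^ 3 * ‖v‖ ≤ N * ‖v‖ := by
    refine mul_le_mul_of_nonneg_right ?_ (norm_nonneg v)
    rw [div_le_iff₀ (by positivity)]
    nlinarith [one_le_pow₀ (n := 3) (show 1 ≤ N by linarith)]
  have hw4 : 320 * ‖v‖ ≤ N * ‖v‖ := mul_le_mul_of_nonneg_right (by linarith) (norm_nonneg v)
  refine abs_le_of_sq_le_sq' (b := 20 * N * ‖v‖) ?_ (by positivity) |>.2
  have hN' : 0 ≤ N * ‖v‖ := by positivity
  have s0 := sq_le_sq' (abs_le.1 g0).1 (abs_le.1 g0).2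
  have s1 := sq_le_sq' (abs_le.1 g1).1 (abs_le.1 g1).2
  have s2 := sq_le_sq' (abs_le.1 g2).1 (abs_le.1 g2).2
  have s3 := sq_le_sq' (abs_le.1 (g3.trans hw)).1 (abs_le.1 (g3.trans hw)).2
  have s4 := sq_le_sq' (abs_le.1 (g4.trans hw4)).1 (abs_le.1 (g4.trans hw4)).2
  rw [norm_sq_eucA5]
  nlinarith [sq_nonneg (N * ‖v‖)]

theorem exists_kDilation_squeezeMap_le :
    ∃ C : ℝ, 0 < C ∧ ∀ N : ℝ, 1000 ≤ N → kDilation 4 (squeezeMap N) ≤ C / N := by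
  obtain ⟨b, hb0, hb⟩ := exists_bound_fderiv_ballCollapse
  obtain ⟨c, hc0, hc⟩ := exists_bound_fderiv_tubeCoord
  refine ⟨120 * b ^ 4 * (25600000 * c ^ 2), by positivity, fun N hN => ?_⟩
  have hN0 : 0 < N := by linarith
  refine Real.iSup_le ?_ (by positivity)
  rintro ⟨x, hxs⟩
  have hx : ‖x‖ = 1 := by simpa [usph] using hxs
  set r : Fin 4 → ℝ := ![c * (20 * N), c * (20 * N), 200 / N ^ 3, 320] with hrdef
  have hr0 : ∀ i, 0 < r i := by
    intro i
    fin_cases i <;> simp [hrdef] <;> positivity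
  have hprod : 120 * b ^ 4 * (25600000 * c ^ 2) / N = 120 * b ^ 4 * ∏ i, r i := by
    simp [hrdef, Fin.prod_univ_four]
    field_simp
    ring
  rw [hprod, (squeezeMap_eventuallyEq hxs).fderiv_eq]
  have hconst : (phaseCollapse N =ᶠ[nhds x] fun _ => northPole) →
      lamNorm 4 ((fderiv ℝ (phaseCollapse N) x).toLinearMap ∘ₗ ((ℝ ∙ x)ᗮ).subtype) ≤
        120 * b ^ 4 * ∏ i, r i := by
    intro h
    refine lamNorm_four_comp_le (P := 0) (B := 0) (fun v => ?_) (by simpa using hb0.le) hr0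
      fun v i => ?_
    · rw [LinearMap.comp_apply, h.fderiv_eq]; simp
    · simpa using mul_nonneg (hr0 i).le (norm_nonneg v)
  rcases phaseCollapse_cases hN (show 1 / 2 < ‖x‖ ^ 2 by rw [hx]; norm_num) with h | ⟨hr, hρ, h⟩
  · exact hconst h
  have dK : DifferentiableAt ℝ (phaseMap N) x :=
    (hr.contDiffAt_phaseMap (n := 1)).differentiableAt (by norm_num)
  have dT : DifferentiableAt ℝ tubeCoord (phaseMap N x) :=
    (contDiffAt_tubeCoord (n := 1) hρ).differentiableAt (by norm_num)
  have dQ : DifferentiableAt ℝ ballCollapse (tubeCoord (phaseMap N x)) :=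
    (contDiff_ballCollapse (n := 1)).contDiffAt.differentiableAt (by norm_num)
  rcases lt_or_ge 1 ‖tubeCoord (phaseMap N x)‖ with h1 | h1
  · refine hconst (h.trans ?_)
    have hcont : ContinuousAt (fun y => ‖tubeCoord (phaseMap N y)‖) x :=
      (dT.continuousAt.comp dK.continuousAt).norm
    filter_upwards [hcont.eventually (lt_mem_nhds h1)] with y hy
    exact ballCollapse_of_ge hy.le
  have ht : tubeSq (phaseMap N x) ≤ 1 := by
    rw [← norm_sq_tubeCoord hρ]; exact pow_le_one₀ (norm_nonneg _) h1
  obtain ⟨hn1, hn2⟩ := near_of_tubeSq_lt ht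
  have hTK : HasFDerivAt (fun y => tubeCoord (phaseMap N y))
      ((fderiv ℝ tubeCoord (phaseMap N x)).comp (fderiv ℝ (phaseMap N) x)) x :=
    dT.hasFDerivAt.comp x dK.hasFDerivAt
  have hF := (dQ.hasFDerivAt.comp x hTK).congr_of_eventuallyEq h
  refine lamNorm_four_comp_le (B := fderiv ℝ ballCollapse (tubeCoord (phaseMap N x)))
    (P := ((fderiv ℝ tubeCoord (phaseMap N x)).comp (fderiv ℝ (phaseMap N) x)).toLinearMap ∘ₗ
      ((ℝ ∙ x)ᗮ).subtype) (fun v => ?_) (hb _ h1) hr0 fun v i => ?_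
  · rw [LinearMap.comp_apply, hF.fderiv]; rfl
  · obtain ⟨k1, k2, k3⟩ := fderiv_phaseMap_bounds hN hx hr ht (v : EucA 6)
    change |fderiv ℝ tubeCoord (phaseMap N x) (fderiv ℝ (phaseMap N) x v) i| ≤ r i * ‖(v : EucA 6)‖
    have hgen : |fderiv ℝ tubeCoord (phaseMap N x) (fderiv ℝ (phaseMap N) x v) i| ≤
        c * (20 * N) * ‖(v : EucA 6)‖ := by
      refine (abs_apply_le_norm _ i).trans ((ContinuousLinearMap.le_opNorm _ _).trans ?_)
      rw [mul_assoc]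
      exact mul_le_mul (hc _ hn1 hn2) k1 (norm_nonneg _) hc0.le
    have hlast : ∀ {i : Fin 4} {j : Fin 5}, (∀ y, tubeCoord y i = y j) →
        fderiv ℝ tubeCoord (phaseMap N x) (fderiv ℝ (phaseMap N) x v) i =
          fderiv ℝ (phaseMap N) x v j := by
      intro i j hij
      rw [fderiv_apply_coord dT, funext hij]
      exact congrArg (fun L : EucA 5 →L[ℝ] ℝ => L _)
        (EuclideanSpace.proj j : EucA 5 →L[ℝ] ℝ).hasFDerivAt.fderiv
    fin_cases i
    · exact hgen
    · exact hgen
    · change |fderiv ℝ tubeCoord (phaseMap N x) (fderiv ℝ (phaseMap N) x v) 2| ≤ _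
      rw [hlast (j := 3) fun _ => rfl]; exact k2
    · change |fderiv ℝ tubeCoord (phaseMap N x) (fderiv ℝ (phaseMap N) x v) 3| ≤ _
      rw [hlast (j := 4) fun _ => rfl]; exact k3

end Dilation

/-- For every `ε > 0` there exists a homotopically non-trivial `C¹` map from `S^5` to
`S^4` with `4`-dilation less than `ε`.  (The class of such a map is the non-trivial element of `π₅(S⁴) ≅ ℤ/2`, the double suspension of the Hopf fibration.)
(`S^5 = usph 6 ⊆ ℝ^6`, `S^4 = usph 5 ⊆ ℝ^5`; a `C¹` map of spheres is
represented by a `C¹` ambient map sending the unit sphere to the unit sphere.) -/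
theorem nontrivial_small_4dilation_S5_S4 :
    ∀ ε : ℝ, 0 < ε →
      ∃ F : EucA 6 → EucA 5,
        ContDiff ℝ 1 F ∧
        MapsTo F (usph 6) (usph 5) ∧
        ¬ SphereNullhomotopic F ∧
        kDilation 4 F < ε := by
  intro ε hε
  obtain ⟨C, hC0, hC⟩ := exists_kDilation_squeezeMap_le
  have hN : (1000 : ℝ) ≤ C / ε + 1000 := by have := div_pos hC0 hε; linarith
  refine ⟨squeezeMap (C / ε + 1000), contDiff_squeezeMap hN, fun x hx => ?_,
    not_sphereNullhomotopic_squeezeMap hN, (hC _ hN).trans_lt ?_⟩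
  · rw [(squeezeMap_eventuallyEq hx).eq_of_nhds]
    simpa [usph] using norm_phaseCollapse
  · rw [div_lt_iff₀ (by positivity), mul_add, mul_div_cancel₀ _ hε.ne']
    linarith
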